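/- Let D be a domain in ℂⁿ and let f : D → ℂ be a continuous function. If the graph Γ(f) = {(z, f(z)) : z ∈ D} is a pluripolar subset of ℂ^{n+1}, then f is holomorphic on D. -/

import Mathlib

open Metric Set Polynomial

noncomputable section

/-- A function `u : ℂ → EReal` is subharmonic on an open set `U` if it is upper
semicontinuous on `U` and satisfies the maximum principle with respect to harmonic
majorants of the form `Re p`, `p` a complex polynomial, on every closed disc in `U`. -/
def SubharmonicOn (u : ℂ → EReal) (U : Set ℂ) : Prop :=
  UpperSemicontinuousOn u U ∧
    ∀ (c : ℂ) (r : ℝ), 0 < r → closedBall c r ⊆ U →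
      ∀ p : Polynomial ℂ,
        (∀ z ∈ sphere c r, u z ≤ (((p.eval z).re : ℝ) : EReal)) →
        ∀ z ∈ closedBall c r, u z ≤ (((p.eval z).re : ℝ) : EReal)

/-- `u : ℂ^N → [-∞, ∞)` is plurisubharmonic if it is upper semicontinuous, takes values
in `[-∞, ∞)`, and its restriction to every complex affine line is subharmonic. -/
def Plurisubharmonic {N : ℕ} (u : (Fin N → ℂ) → EReal) : Prop :=
  UpperSemicontinuous u ∧ (∀ z, u z ≠ ⊤) ∧
    ∀ a b : Fin N → ℂ, SubharmonicOn (fun t : ℂ => u (a + t • b)) Set.univ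

/-- A set `E ⊆ ℂ^N` is pluripolar if there is a plurisubharmonic function on `ℂ^N`,
not identically `-∞`, which is `-∞` on `E`. -/
def Pluripolar {N : ℕ} (E : Set (Fin N → ℂ)) : Prop :=
  ∃ u : (Fin N → ℂ) → EReal,
    Plurisubharmonic u ∧ ¬ (∀ z, u z = ⊥) ∧ ∀ z ∈ E, u z = ⊥

section PartCF

open Filter Topology

set_option linter.unusedSectionVars false

section CF
variable {A : Type*} [NormedCommRing A] [NormedAlgebra ℂ A]

/-- `φ` is a resolvent of `W` at `w` modulo the ideal generated by `Z - η`. -/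
def Res (Z W : A) (η w : ℂ) (φ : A) : Prop :=
  ∃ a : A, (W - algebraMap ℂ A w) * φ = 1 + (Z - algebraMap ℂ A η) * a

theorem Res.unique {Z W : A} {η w : ℂ} {φ ψ : A} (h1 : Res Z W η w φ) (h2 : Res Z W η w ψ)
    (L : A →L[ℂ] ℂ) (hL : ∀ a, L ((Z - algebraMap ℂ A η) * a) = 0) : L φ = L ψ := by
  obtain ⟨a, ha⟩ := h1
  obtain ⟨b, hb⟩ := h2
  have : φ - ψ = (Z - algebraMap ℂ A η) * (a * ψ - b * φ) := by
    linear_combination ψ * ha - φ * hb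
  have h3 := hL (a * ψ - b * φ)
  rw [← this, map_sub, sub_eq_zero] at h3
  exact h3

variable [CompleteSpace A]

theorem isUnit_one_sub_of_norm {x : A} (h : ‖x‖ < 1) : IsUnit (1 - x) :=
  ⟨Units.oneSub x h, rfl⟩

theorem isUnit_one_add_of_norm {x : A} (h : ‖x‖ < 1) : IsUnit (1 + x) := by
  have := isUnit_one_sub_of_norm (x := -x) (by simpa using h)
  simpa using this

theorem res_move_aux {Z W : A} {η w : ℂ} {φ a : A}
    (ha : (W - algebraMap ℂ A w) * φ = 1 + (Z - algebraMap ℂ A η) * a) {h : ℂ}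
    (hh : ‖h • φ‖ < 1) :
    (W - algebraMap ℂ A (w + h)) * (φ * Ring.inverse (1 - h • φ)) =
      1 + (Z - algebraMap ℂ A η) * (a * Ring.inverse (1 - h • φ)) := by
  have hu := isUnit_one_sub_of_norm hh
  have h2 := Ring.mul_inverse_cancel _ hu
  rw [map_add]
  rw [Algebra.smul_def] at *
  linear_combination (Ring.inverse (1 - algebraMap ℂ A h * φ)) * ha + h2

theorem Res.move {Z W : A} {η w : ℂ} {φ : A} (h1 : Res Z W η w φ) {h : ℂ} (hh : ‖h • φ‖ < 1) :
    Res Z W η (w + h) (φ * Ring.inverse (1 - h • φ)) := by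
  obtain ⟨a, ha⟩ := h1
  exact ⟨a * Ring.inverse (1 - h • φ), res_move_aux ha hh⟩

theorem Res.eventually {Z W : A} {η w : ℂ} {φ : A} (h1 : Res Z W η w φ) :
    ∀ᶠ w' in 𝓝 w, Res Z W η w' (φ * Ring.inverse (1 - (w' - w) • φ)) := by
  have : ∀ᶠ w' in 𝓝 w, ‖(w' - w) • φ‖ < 1 := by
    have hc : Continuous fun w' : ℂ => ‖(w' - w) • φ‖ := by fun_prop
    refine hc.continuousAt.eventually (gt_mem_nhds ?_)
    simp
  filter_upwards [this] with w' hw'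
  have := h1.move hw'
  simpa using this

theorem hasDerivAt_inv_move (φ : A) (w : ℂ) :
    HasDerivAt (fun w' : ℂ => φ * Ring.inverse (1 - (w' - w) • φ)) (φ * φ) w := by
  have h0 : HasDerivAt (fun w' : ℂ => 1 - (w' - w) • φ) (-φ) w := by
    have := (((hasDerivAt_id w).sub_const w).smul_const φ).const_sub 1
    simpa using this
  have h1 := hasFDerivAt_ringInverse (𝕜 := ℂ) (1 : Aˣ)
  have h2 : HasFDerivAt (Ring.inverse : A → A)
      (-ContinuousLinearMap.mulLeftRight ℂ A ↑(1 : Aˣ)⁻¹ ↑(1 : Aˣ)⁻¹)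
      ((fun w' : ℂ => 1 - (w' - w) • φ) w) := by
    simpa using h1
  have h3 := (h2.comp_hasDerivAt w h0).const_mul φ
  refine h3.congr_deriv ?_
  have : (-ContinuousLinearMap.mulLeftRight ℂ A ↑(1 : Aˣ)⁻¹ ↑(1 : Aˣ)⁻¹) (-φ) =
      -((↑(1 : Aˣ)⁻¹ : A) * -φ * (↑(1 : Aˣ)⁻¹ : A)) := rfl
  rw [this]
  simp

theorem Res.hasDerivAt {Z W : A} {η : ℂ} (R : ℂ → A) {w : ℂ}
    (hR : ∀ᶠ w' in 𝓝 w, Res Z W η w' (R w'))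
    (L : A →L[ℂ] ℂ) (hL : ∀ a, L ((Z - algebraMap ℂ A η) * a) = 0) :
    HasDerivAt (fun w' => L (R w')) (L (R w * R w)) w := by
  have h1 : Res Z W η w (R w) := hR.self_of_nhds
  have h2 := L.hasFDerivAt.comp_hasDerivAt w (hasDerivAt_inv_move (R w) w)
  refine h2.congr_of_eventuallyEq ?_
  filter_upwards [hR, h1.eventually] with w' ha hb
  exact ha.unique hb L hL

theorem res_eventually_exists {Z W : A} {η w : ℂ} {φ : A} (h1 : Res Z W η w φ) :
    ∀ᶠ w' in 𝓝 w, ∃ ψ, Res Z W η w' ψ :=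
  h1.eventually.mono fun _ h => ⟨_, h⟩

theorem mem_closure_of_dual {S : Submodule ℂ A} {x : A}
    (h : ∀ L : A →L[ℂ] ℂ, (∀ a ∈ S, L a = 0) → L x = 0) : x ∈ S.topologicalClosure := by
  by_contra hx
  obtain ⟨f, u, hf, hu⟩ := RCLike.geometric_hahn_banach_closed_point (𝕜 := ℂ)
    (s := (S.topologicalClosure : Set A)) (x := x)
    ((S.topologicalClosure.restrictScalars ℝ).convex) S.isClosed_topologicalClosure hx
  have hf' : ∀ a ∈ S, (f a) = 0 := by
    intro a ha
    by_contra hne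
    have h1 := hf ((((|u| + 1 : ℝ) : ℂ) / f a) • a)
      (S.topologicalClosure.smul_mem _ (S.le_topologicalClosure ha))
    rw [map_smul, smul_eq_mul, div_mul_cancel₀ _ hne] at h1
    have h2 : RCLike.re (((|u| + 1 : ℝ) : ℂ)) = |u| + 1 := Complex.ofReal_re _
    rw [h2] at h1
    have := le_abs_self u
    linarith
  have h0 := h f hf'
  rw [h0] at hu
  have h1 := hf 0 (Submodule.zero_mem _)
  simp at h1 hu
  linarith


theorem norm_smul_sub_lt (w : ℂ) (φ : A) : ∀ᶠ w' in 𝓝 w, ‖(w' - w) • φ‖ < 1 := by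
  have hc : Continuous fun w' : ℂ => ‖(w' - w) • φ‖ := by fun_prop
  refine hc.continuousAt.eventually (gt_mem_nhds ?_)
  simp

theorem continuousOn_inverse {X : Type*} [TopologicalSpace X] {f : X → A} {s : Set X}
    (hf : ContinuousOn f s) (hu : ∀ x ∈ s, IsUnit (f x)) :
    ContinuousOn (fun x => Ring.inverse (f x)) s := by
  intro x hx
  obtain ⟨u, hu⟩ := hu x hx
  have := NormedRing.inverse_continuousAt u
  rw [hu] at this
  exact ContinuousAt.comp_continuousWithinAt this (hf x hx)

theorem cfr_selection {Z W : A} {r : ℝ}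
    (h0 : ∀ w ∈ sphere (0 : ℂ) r, ∃ φ, Res Z W 0 w φ) :
    ∃ φ α : ℂ → A, ContinuousOn φ (sphere 0 r) ∧ ContinuousOn α (sphere 0 r) ∧
      ∀ w ∈ sphere (0 : ℂ) r, (W - algebraMap ℂ A w) * φ w = 1 + Z * α w := by
  classical
  obtain ⟨g, hg⟩ := exists_continuous_forall_mem_convex_of_local
    (X := sphere (0 : ℂ) r) (E := A × A)
    (t := fun x => {p | (W - algebraMap ℂ A (x : ℂ)) * p.1 = 1 + Z * p.2}) (by
      intro x p hp q hq a b ha hb hab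
      simp only [mem_ofPred_eq, Prod.fst_add, Prod.snd_add, Prod.smul_fst, Prod.smul_snd] at *
      have h1 : (1 : A) = a • (1 : A) + b • (1 : A) := by rw [← add_smul, hab, one_smul]
      rw [mul_add, mul_smul_comm, mul_smul_comm, hp, hq, mul_add, mul_smul_comm, mul_smul_comm]
      nth_rewrite 3 [h1]
      simp only [smul_add]
      abel) (by
      intro x
      obtain ⟨φ, a, ha⟩ := h0 x x.2
      refine ⟨{y | ‖((y : ℂ) - x) • φ‖ < 1}, ?_, fun y =>
        (φ * Ring.inverse (1 - ((y : ℂ) - x) • φ), a * Ring.inverse (1 - ((y : ℂ) - x) • φ)),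
        ?_, ?_⟩
      · exact (continuous_subtype_val.continuousAt (x := x)).eventually (norm_smul_sub_lt _ _)
      · have : ContinuousOn (fun y : sphere (0 : ℂ) r => Ring.inverse (1 - ((y : ℂ) - x) • φ))
            {y | ‖((y : ℂ) - x) • φ‖ < 1} := by
          refine continuousOn_inverse (by fun_prop) ?_
          intro y hy
          exact isUnit_one_sub_of_norm hy
        exact (continuousOn_const.mul this).prodMk (continuousOn_const.mul this)
      · intro y hy
        have := res_move_aux ha (h := (y : ℂ) - x) hy
        simpa using this)
  refine ⟨fun w => if h : w ∈ sphere (0 : ℂ) r then (g ⟨w, h⟩).1 else 0,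
    fun w => if h : w ∈ sphere (0 : ℂ) r then (g ⟨w, h⟩).2 else 0, ?_, ?_, ?_⟩
  · rw [continuousOn_iff_continuous_domRestrict]
    have : (sphere (0 : ℂ) r).domRestrict (fun w => if h : w ∈ sphere (0 : ℂ) r
        then (g ⟨w, h⟩).1 else 0) = fun x => (g x).1 := by
      ext x
      rw [domRestrict_apply, dif_pos x.2]
    rw [this]
    fun_prop
  · rw [continuousOn_iff_continuous_domRestrict]
    have : (sphere (0 : ℂ) r).domRestrict (fun w => if h : w ∈ sphere (0 : ℂ) r
        then (g ⟨w, h⟩).2 else 0) = fun x => (g x).2 := by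
      ext x
      rw [domRestrict_apply, dif_pos x.2]
    rw [this]
    fun_prop
  · intro w hw
    simp only [dif_pos hw]
    exact hg ⟨w, hw⟩

theorem norm_inverse_le [NormOneClass A] {x : A} (h : ‖x‖ ≤ 1 / 2) :
    ‖Ring.inverse (1 + x)‖ ≤ 2 := by
  have hu := isUnit_one_add_of_norm (x := x) (by linarith)
  have h2 := Ring.inverse_mul_cancel _ hu
  have h3 : Ring.inverse (1 + x) = 1 - Ring.inverse (1 + x) * x := by
    linear_combination h2
  have h4 : ‖Ring.inverse (1 + x)‖ ≤ 1 + ‖Ring.inverse (1 + x)‖ * (1 / 2) := by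
    calc ‖Ring.inverse (1 + x)‖ = ‖1 - Ring.inverse (1 + x) * x‖ := by rw [← h3]
      _ ≤ ‖(1 : A)‖ + ‖Ring.inverse (1 + x) * x‖ := norm_sub_le _ _
      _ ≤ 1 + ‖Ring.inverse (1 + x)‖ * (1 / 2) := by
        rw [norm_one]
        gcongr
        exact (norm_mul_le _ _).trans (by gcongr)
  linarith

theorem circle_integral_inv_sub_outside {r : ℝ} (hr : 0 < r) {c : ℂ} (hc : r < ‖c‖) :
    (∮ w in C(0, r), (c - w)⁻¹) = 0 := by
  refine Complex.circleIntegral_eq_zero_of_differentiable_on_off_countable hr.le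
    countable_empty ?_ ?_
  · refine ContinuousOn.inv₀ (by fun_prop) ?_
    intro w hw h
    rw [sub_eq_zero] at h
    rw [← h] at hw
    simp at hw
    linarith
  · intro w hw
    refine DifferentiableAt.inv (by fun_prop) ?_
    intro h
    rw [sub_eq_zero] at h
    rw [← h] at hw
    simp at hw
    linarith

theorem clm_circleIntegral (L : A →L[ℂ] ℂ) {f : ℂ → A} {r : ℝ} (hr : 0 ≤ r)
    (hf : ContinuousOn f (sphere 0 r)) :
    L (∮ w in C(0, r), f w) = ∮ w in C(0, r), L (f w) := by
  have hi := hf.circleIntegrable hr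
  rw [circleIntegral, ← ContinuousLinearMap.intervalIntegral_comp_comm]
  · simp [circleIntegral]
  · exact hi.out

theorem cfr [NormOneClass A] {Z W : A} {r τ : ℝ} (hr : 0 < r) (hτ : 0 < τ)
    (h0 : ∀ w ∈ sphere (0 : ℂ) r, ∃ φ, Res Z W 0 w φ) :
    ∃ C > 0, ∃ η₁ > 0, ∀ η : ℝ, 0 < η → η < η₁ →
      (∀ w ∈ closedBall (0 : ℂ) r, ∃ φ, Res Z W η w φ) →
      ∃ Φ : A, (∀ δ > 0, ∃ a, ‖Φ - (Z - algebraMap ℂ A η) * a‖ < δ) ∧ ‖Φ‖ ≤ C ∧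
        (∀ χ : A →ₐ[ℂ] ℂ, r + τ ≤ ‖χ W‖ → ‖χ Φ‖ ≤ C * ‖χ Z - η‖) ∧
        (∀ χ : A →ₐ[ℂ] ℂ, χ Z = 0 → χ W = 0 → ‖χ Φ - 1‖ ≤ C * η) := by
  obtain ⟨φ, α, hφ, hα, hφα⟩ := cfr_selection h0
  obtain ⟨M1, hM1⟩ := (isCompact_sphere (0 : ℂ) r).exists_bound_of_continuousOn hφ
  obtain ⟨M2, hM2⟩ := (isCompact_sphere (0 : ℂ) r).exists_bound_of_continuousOn hα
  set M := max (max M1 M2) 1 with hM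
  have hM0 : 1 ≤ M := le_max_right _ _
  have hM1' : ∀ w ∈ sphere (0 : ℂ) r, ‖φ w‖ ≤ M := fun w hw =>
    (hM1 w hw).trans ((le_max_left _ _).trans (le_max_left _ _))
  have hM2' : ∀ w ∈ sphere (0 : ℂ) r, ‖α w‖ ≤ M := fun w hw =>
    (hM2 w hw).trans ((le_max_right _ _).trans (le_max_left _ _))
  have hMp : 0 < M := by linarith
  refine ⟨2 * M * r + 2 * M * r / τ + 2 * M, by positivity, 1 / (2 * M), by positivity, ?_⟩
  intro η hη hη1 hdisc
  have hsmall : ∀ w ∈ sphere (0 : ℂ) r, ‖(η : ℂ) • α w‖ ≤ 1 / 2 := by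
    intro w hw
    rw [norm_smul, Complex.norm_real, Real.norm_of_nonneg hη.le]
    calc η * ‖α w‖ ≤ 1 / (2 * M) * M := by
          gcongr
          exact hM2' w hw
      _ = 1 / 2 := by field_simp
  set v : ℂ → A := fun w => Ring.inverse (1 + (η : ℂ) • α w) with hv
  have hu : ∀ w ∈ sphere (0 : ℂ) r, IsUnit (1 + (η : ℂ) • α w) := fun w hw =>
    isUnit_one_add_of_norm (by linarith [hsmall w hw])
  have hvc : ContinuousOn v (sphere 0 r) :=
    continuousOn_inverse (continuousOn_const.add (continuousOn_const.smul hα)) hu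
  have hv2 : ∀ w ∈ sphere (0 : ℂ) r, ‖v w‖ ≤ 2 := fun w hw => norm_inverse_le (hsmall w hw)
  have hvm : ∀ w ∈ sphere (0 : ℂ) r, (1 + algebraMap ℂ A η * α w) * v w = 1 := fun w hw => by
    have := Ring.mul_inverse_cancel _ (hu w hw)
    rw [Algebra.smul_def] at this
    simp only [hv, Algebra.smul_def]
    exact this
  set ψ : ℂ → A := fun w => φ w * v w with hψ
  have hψc : ContinuousOn ψ (sphere 0 r) := hφ.mul hvc
  have hψr : ∀ w ∈ sphere (0 : ℂ) r, (W - algebraMap ℂ A w) * ψ w =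
      1 + (Z - algebraMap ℂ A η) * (α w * v w) := by
    intro w hw
    linear_combination (v w) * hφα w hw + hvm w hw
  have hψ2 : ∀ w ∈ sphere (0 : ℂ) r, ‖ψ w‖ ≤ 2 * M := fun w hw => by
    calc ‖ψ w‖ ≤ ‖φ w‖ * ‖v w‖ := norm_mul_le _ _
      _ ≤ M * 2 := by
        gcongr
        · exact hM1' w hw
        · exact hv2 w hw
      _ = 2 * M := by ring
  have hαv : ∀ w ∈ sphere (0 : ℂ) r, ‖α w * v w‖ ≤ 2 * M := fun w hw => by
    calc ‖α w * v w‖ ≤ ‖α w‖ * ‖v w‖ := norm_mul_le _ _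
      _ ≤ M * 2 := by
        gcongr
        · exact hM2' w hw
        · exact hv2 w hw
      _ = 2 * M := by ring
  have hχle : ∀ (χ : A →ₐ[ℂ] ℂ) (a : A), ‖χ a‖ ≤ ‖a‖ := fun χ a =>
    AlgHom.norm_apply_le_self χ a
  have hχi : ∀ χ : A →ₐ[ℂ] ℂ, χ (-((2 * Real.pi * Complex.I : ℂ)⁻¹ • ∮ w in C(0, r), ψ w)) =
      -((2 * Real.pi * Complex.I : ℂ)⁻¹ • ∮ w in C(0, r), χ (ψ w)) := by
    intro χ
    have := clm_circleIntegral (AlgHom.toContinuousLinearMap χ) hr.le hψc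
    rw [map_neg, map_smul]
    congr 2
  have hχψ : ∀ (χ : A →ₐ[ℂ] ℂ), ∀ w ∈ sphere (0 : ℂ) r, χ W - w ≠ 0 → χ (ψ w) =
      (χ W - w)⁻¹ + (χ Z - η) * χ (α w * v w) * (χ W - w)⁻¹ := by
    intro χ w hw hne
    have h1 := congrArg χ (hψr w hw)
    simp only [map_mul, map_sub, map_add, map_one, AlgHom.commutes, Algebra.algebraMap_self,
      RingHom.id_apply] at h1
    rw [map_mul χ (α w)]
    field_simp
    linear_combination h1
  -- general estimate
  have hest : ∀ (χ : A →ₐ[ℂ] ℂ) (d : ℝ), 0 < d → (∀ w ∈ sphere (0 : ℂ) r, d ≤ ‖χ W - w‖) →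
      ‖χ (-((2 * Real.pi * Complex.I : ℂ)⁻¹ • ∮ w in C(0, r), ψ w)) +
        (2 * Real.pi * Complex.I : ℂ)⁻¹ • ∮ w in C(0, r), (χ W - w)⁻¹‖ ≤
        r * (‖χ Z - η‖ * (2 * M) / d) := by
    intro χ d hd hdw
    have hne : ∀ w ∈ sphere (0 : ℂ) r, χ W - w ≠ 0 := fun w hw h => by
      have := hdw w hw
      rw [h, norm_zero] at this
      linarith
    rw [hχi, neg_add_eq_sub, ← smul_sub, ← circleIntegral.integral_sub]
    · refine circleIntegral.norm_two_pi_i_inv_smul_integral_le_of_norm_le_const hr.le ?_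
      intro w hw
      rw [hχψ χ w hw (hne w hw)]
      have : (χ W - w)⁻¹ - ((χ W - w)⁻¹ + (χ Z - η) * χ (α w * v w) * (χ W - w)⁻¹) =
        - ((χ Z - η) * χ (α w * v w) * (χ W - w)⁻¹) := by ring
      rw [this, norm_neg, norm_mul, norm_mul, norm_inv, div_eq_mul_inv]
      gcongr
      · exact (hχle χ _).trans (hαv w hw)
      · exact hdw w hw
    · refine ContinuousOn.circleIntegrable hr.le ?_
      exact ContinuousOn.inv₀ (by fun_prop) hne
    · refine ContinuousOn.circleIntegrable hr.le ?_
      exact (AlgHom.toContinuousLinearMap χ).continuous.comp_continuousOn hψc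
  refine ⟨-((2 * Real.pi * Complex.I : ℂ)⁻¹ • ∮ w in C(0, r), ψ w), ?_, ?_, ?_, ?_⟩
  · intro δ hδ
    have hcl : (∮ w in C(0, r), ψ w) ∈
        ((Ideal.span {Z - algebraMap ℂ A η}).restrictScalars ℂ).topologicalClosure := by
      apply mem_closure_of_dual
      intro L hL
      have hL' : ∀ a, L ((Z - algebraMap ℂ A η) * a) = 0 := fun a => hL _ (by
        rw [Submodule.restrictScalars_mem]
        exact Ideal.mul_mem_right _ _ (Ideal.subset_span rfl))
      rw [clm_circleIntegral L hr.le hψc]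
      choose! R hR using fun w => show ((∃ φ, Res Z W η w φ) → ∃ φ, Res Z W η w φ) from id
      have hRes : ∀ w ∈ closedBall (0 : ℂ) r, ∀ᶠ w' in 𝓝 w, Res Z W η w' (R w') := by
        intro w hw
        obtain ⟨p, hp⟩ := hdisc w hw
        filter_upwards [res_eventually_exists hp] with w' hw'
        exact hR w' hw'
      have hd : ∀ w ∈ closedBall (0 : ℂ) r, DifferentiableAt ℂ (fun w => L (R w)) w :=
        fun w hw => (Res.hasDerivAt R (hRes w hw) L hL').differentiableAt
      have hz : (∮ w in C(0, r), L (R w)) = 0 :=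
        Complex.circleIntegral_eq_zero_of_differentiable_on_off_countable hr.le
        countable_empty (fun w hw => (hd w hw).continuousAt.continuousWithinAt)
        (fun w hw => hd w (ball_subset_closedBall hw.1))
      refine Eq.trans ?_ hz
      refine circleIntegral.integral_congr (f := fun w => L (ψ w)) (g := fun w => L (R w)) hr.le ?_
      intro w hw
      have h1 : Res Z W η w (ψ w) := ⟨_, hψr w hw⟩
      exact h1.unique (hRes w (sphere_subset_closedBall hw)).self_of_nhds L hL'
    have hcl2 := Submodule.neg_mem _
      (Submodule.smul_mem _ ((2 * Real.pi * Complex.I : ℂ)⁻¹) hcl)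
    have hcl3 := Metric.mem_closure_iff.1 hcl2 δ hδ
    obtain ⟨b, hb, hbd⟩ := hcl3
    have hb' : b ∈ Ideal.span {Z - algebraMap ℂ A η} := hb
    rw [Ideal.mem_span_singleton] at hb'
    obtain ⟨a, rfl⟩ := hb'
    exact ⟨a, by rwa [dist_eq_norm] at hbd⟩
  · rw [norm_neg]
    refine (circleIntegral.norm_two_pi_i_inv_smul_integral_le_of_norm_le_const hr.le hψ2).trans ?_
    have : 0 ≤ 2 * M * r / τ := by positivity
    nlinarith
  · intro χ hχ
    have h1 := hest χ τ hτ (fun w hw => by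
      have := norm_sub_norm_le (χ W) w
      rw [mem_sphere_zero_iff_norm] at hw
      linarith)
    rw [circle_integral_inv_sub_outside hr (by linarith), smul_zero, add_zero] at h1
    refine h1.trans ?_
    have h2 : r * (‖χ Z - η‖ * (2 * M) / τ) = 2 * M * r / τ * ‖χ Z - η‖ := by ring
    rw [h2]
    gcongr
    have : 0 ≤ 2 * M * r := by positivity
    linarith
  · intro χ hZ hW
    have h1 := hest χ r hr (fun w hw => by
      rw [hW, zero_sub, norm_neg]
      rw [mem_sphere_zero_iff_norm] at hw
      linarith)
    have h3 : (∮ w in C(0, r), (χ W - w)⁻¹) = - (2 * Real.pi * Complex.I) := by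
      rw [hW]
      have h4 := circleIntegral.integral_sub_center_inv (0 : ℂ) hr.ne'
      have h5 := circleIntegral.integral_const_mul (-1) (fun w => (w - (0 : ℂ))⁻¹) 0 r
      rw [h4, neg_one_mul] at h5
      rw [← h5]
      congr 1
      ext w
      rw [zero_sub, sub_zero, inv_neg, neg_one_mul]
    rw [h3, hZ] at h1
    have h5 : (2 * Real.pi * Complex.I : ℂ)⁻¹ • -(2 * Real.pi * Complex.I : ℂ) = -1 := by
      rw [smul_eq_mul, mul_neg, inv_mul_cancel₀ Complex.two_pi_I_ne_zero]
    rw [h5, ← sub_eq_add_neg] at h1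
    refine h1.trans ?_
    have h6 : ‖(0 : ℂ) - η‖ = η := by
      rw [zero_sub, norm_neg, Complex.norm_real, Real.norm_of_nonneg hη.le]
    rw [h6]
    have h7 : r * (η * (2 * M) / r) = 2 * M * η := by field_simp
    rw [h7]
    gcongr
    have : 0 ≤ 2 * M * r := by positivity
    have : 0 ≤ 2 * M * r / τ := by positivity
    linarith

end CF

end PartCF

section PartPolyHull

open Filter Topology
set_option linter.unusedSectionVars false

/-- Polynomials in two variables. -/
abbrev MM : Type := MvPolynomial (Fin 2) ℂ

section ev
variable {A : Type*} [CommRing A] [Algebra ℂ A]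

/-- Evaluation of a polynomial in two variables in a commutative algebra. -/
def ev (x y : A) : MM →ₐ[ℂ] A := MvPolynomial.aeval ![x, y]

@[simp] theorem ev_X0 (x y : A) : ev x y (MvPolynomial.X 0) = x := by simp [ev]
@[simp] theorem ev_X1 (x y : A) : ev x y (MvPolynomial.X 1) = y := by simp [ev]
@[simp] theorem ev_C (x y : A) (c : ℂ) : ev x y (MvPolynomial.C c) = algebraMap ℂ A c := by
  simp [ev]

theorem map_ev {B : Type*} [CommRing B] [Algebra ℂ B] (φ : A →ₐ[ℂ] B) (x y : A) (P : MM) :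
    φ (ev x y P) = ev (φ x) (φ y) P := by
  have : φ.comp (ev x y) = ev (φ x) (φ y) := by
    apply MvPolynomial.algHom_ext
    intro i
    fin_cases i <;> simp [ev]
  exact congrArg (fun f => f P) this

theorem ev_self (P : MM) : ev (MvPolynomial.X 0 : MM) (MvPolynomial.X 1 : MM) P = P := by
  have : ev (MvPolynomial.X 0 : MM) (MvPolynomial.X 1 : MM) = AlgHom.id ℂ MM := by
    apply MvPolynomial.algHom_ext
    intro i
    fin_cases i <;> simp [ev]
  rw [this]
  rfl

theorem sub_dvd_ev_sub (x x' y y' : A) (d : A) (h1 : d ∣ x - x') (h2 : d ∣ y - y') (P : MM) :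
    d ∣ ev x y P - ev x' y' P := by
  induction P using MvPolynomial.induction_on with
  | C a => simp
  | add p q hp hq =>
    rw [map_add, map_add, add_sub_add_comm]
    exact dvd_add hp hq
  | mul_X p i hp =>
    rw [map_mul, map_mul]
    have hi : d ∣ ev x y (MvPolynomial.X i) - ev x' y' (MvPolynomial.X i) := by
      fin_cases i <;> simpa
    have : ev x y p * ev x y (MvPolynomial.X i) - ev x' y' p * ev x' y' (MvPolynomial.X i) =
      (ev x y p - ev x' y' p) * ev x y (MvPolynomial.X i) +
        ev x' y' p * (ev x y (MvPolynomial.X i) - ev x' y' (MvPolynomial.X i)) := by ring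
    rw [this]
    exact dvd_add (Dvd.dvd.mul_right hp _) (Dvd.dvd.mul_left hi _)

theorem exists_decomp (P : MM) (η w : ℂ) : ∃ B D : MM,
    P = MvPolynomial.C (ev η w P) + (MvPolynomial.X 1 - MvPolynomial.C w) * B +
      (MvPolynomial.X 0 - MvPolynomial.C η) * D := by
  obtain ⟨D, hD⟩ := sub_dvd_ev_sub (MvPolynomial.X 0 : MM) (MvPolynomial.C η)
    (MvPolynomial.X 1) (MvPolynomial.X 1) (MvPolynomial.X 0 - MvPolynomial.C η) dvd_rfl (by simp) P
  obtain ⟨B, hB⟩ := sub_dvd_ev_sub (MvPolynomial.C η : MM) (MvPolynomial.C η)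
    (MvPolynomial.X 1) (MvPolynomial.C w) (MvPolynomial.X 1 - MvPolynomial.C w) (by simp) dvd_rfl P
  have h3 : ev (MvPolynomial.C η : MM) (MvPolynomial.C w) P = MvPolynomial.C (ev η w P) := by
    have := map_ev (Algebra.ofId ℂ MM) η w P
    exact this.symm
  rw [ev_self] at hD
  rw [h3] at hB
  exact ⟨B, D, by linear_combination hD + hB⟩

end ev

theorem continuous_ev (P : MM) : Continuous fun p : ℂ × ℂ => ev p.1 p.2 P := by
  induction P using MvPolynomial.induction_on with
  | C a => simp only [ev_C]; exact continuous_const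
  | add p q hp hq => simp only [map_add]; exact hp.add hq
  | mul_X p i hp =>
    simp only [map_mul]
    refine hp.mul ?_
    fin_cases i
    · simp only [Fin.zero_eta, ev_X0]; exact continuous_fst
    · simp only [Fin.mk_one, ev_X1]; exact continuous_snd

theorem exists_res_poly {A : Type*} [NormedCommRing A] [NormedAlgebra ℂ A]
    {Z W : A} {η w : ℂ} {P : MM} (h : ‖ev Z W P‖ < ‖ev η w P‖) :
    ∃ Q D e : MM, (MvPolynomial.X 1 - MvPolynomial.C w) * Q =
      1 + (MvPolynomial.X 0 - MvPolynomial.C η) * D + e ∧ ‖ev Z W e‖ < 1 := by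
  set c := ev η w P with hc
  have hpos : 0 < ‖c‖ := (norm_nonneg _).trans_lt h
  have hc0 : c ≠ 0 := norm_pos_iff.1 hpos
  obtain ⟨B, D, hBD⟩ := exists_decomp P η w
  refine ⟨-(MvPolynomial.C c⁻¹ * B), MvPolynomial.C c⁻¹ * D, -(MvPolynomial.C c⁻¹ * P), ?_, ?_⟩
  · have h1 : (MvPolynomial.C c⁻¹ * MvPolynomial.C c : MM) = 1 := by
      rw [← MvPolynomial.C_mul, inv_mul_cancel₀ hc0, MvPolynomial.C_1]
    rw [← hc] at hBD
    linear_combination MvPolynomial.C c⁻¹ * hBD + h1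
  · rw [map_neg, norm_neg, map_mul, ev_C, ← Algebra.smul_def, norm_smul, norm_inv]
    rw [inv_mul_lt_iff₀ hpos]
    simpa using h

theorem res_of_poly {A : Type*} [NormedCommRing A] [NormedAlgebra ℂ A] [CompleteSpace A]
    {Z W : A} {η w : ℂ} {Q D e : MM} (h1 : (MvPolynomial.X 1 - MvPolynomial.C w) * Q =
      1 + (MvPolynomial.X 0 - MvPolynomial.C η) * D + e) (h2 : ‖ev Z W e‖ < 1) :
    Res Z W η w (ev Z W Q * Ring.inverse (1 + ev Z W e)) := by
  have h3 := Ring.mul_inverse_cancel _ (isUnit_one_add_of_norm h2)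
  have h4 := congrArg (ev Z W) h1
  simp only [map_mul, map_sub, map_add, map_one, ev_X0, ev_X1, ev_C] at h4
  refine ⟨ev Z W D * Ring.inverse (1 + ev Z W e), ?_⟩
  linear_combination Ring.inverse (1 + ev Z W e) * h4 + h3

/-- Polynomially convex hull. -/
def phull (K : Set (ℂ × ℂ)) : Set (ℂ × ℂ) :=
  {x | ∀ P : MM, ∃ y ∈ K, ‖ev x.1 x.2 P‖ ≤ ‖ev y.1 y.2 P‖}

theorem subset_phull (K : Set (ℂ × ℂ)) : K ⊆ phull K := fun x hx _ => ⟨x, hx, le_rfl⟩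

theorem mem_phull_iff {K : Set (ℂ × ℂ)} (hK : IsCompact K) (hne : K.Nonempty) (x : ℂ × ℂ) :
    x ∈ phull K ↔ ∀ (P : MM) (M : ℝ), (∀ y ∈ K, ‖ev y.1 y.2 P‖ ≤ M) → ‖ev x.1 x.2 P‖ ≤ M := by
  constructor
  · intro h P M hM
    obtain ⟨y, hy, hxy⟩ := h P
    exact hxy.trans (hM y hy)
  · intro h P
    obtain ⟨y, hy, hmax⟩ := hK.exists_isMaxOn hne (continuous_ev P).norm.continuousOn
    exact ⟨y, hy, h P _ fun z hz => hmax hz⟩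

theorem isCompact_phull {K : Set (ℂ × ℂ)} (hK : IsCompact K) (hne : K.Nonempty) :
    IsCompact (phull K) := by
  apply Metric.isCompact_of_isClosed_isBounded
  · have : phull K = ⋂ (P : MM) (M : ℝ) (_ : ∀ y ∈ K, ‖ev y.1 y.2 P‖ ≤ M),
        {x | ‖ev x.1 x.2 P‖ ≤ M} := by
      ext x
      rw [mem_phull_iff hK hne]
      simp only [mem_iInter, mem_ofPred_eq]
    rw [this]
    refine isClosed_iInter fun P => isClosed_iInter fun M => isClosed_iInter fun _ => ?_
    exact isClosed_le (continuous_ev P).norm continuous_const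
  · obtain ⟨M, hM⟩ := hK.isBounded.exists_norm_le
    rw [isBounded_iff_forall_norm_le]
    refine ⟨M, fun x hx => ?_⟩
    rw [mem_phull_iff hK hne] at hx
    have h1 := hx (MvPolynomial.X 0) M (fun y hy => by
      rw [ev_X0]; exact (norm_fst_le y).trans (hM y hy))
    have h2 := hx (MvPolynomial.X 1) M (fun y hy => by
      rw [ev_X1]; exact (norm_snd_le y).trans (hM y hy))
    rw [ev_X0] at h1
    rw [ev_X1] at h2
    exact max_le h1 h2

theorem exists_poly_of_not_mem_phull {K : Set (ℂ × ℂ)} {x : ℂ × ℂ} (hx : x ∉ phull K) :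
    ∃ P : MM, ∀ y ∈ K, ‖ev y.1 y.2 P‖ < ‖ev x.1 x.2 P‖ := by
  simp only [phull, mem_ofPred_eq, not_forall, not_exists, not_and, not_le] at hx
  exact hx

section CY
variable (Y : Set (ℂ × ℂ)) [CompactSpace Y]

/-- first coordinate -/
def cZ : C(Y, ℂ) := ⟨fun y => y.1.1, by fun_prop⟩
/-- second coordinate -/
def cW : C(Y, ℂ) := ⟨fun y => y.1.2, by fun_prop⟩

theorem ev_cZ_apply (P : MM) (y : Y) : ev (cZ Y) (cW Y) P y = ev y.1.1 y.1.2 P := by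
  have := map_ev (ContinuousMap.evalAlgHom ℂ ℂ y) (cZ Y) (cW Y) P
  exact this

/-- Closure of the polynomials in `C(Y)`. -/
def pAlg : Subalgebra ℂ C(Y, ℂ) := (ev (cZ Y) (cW Y)).range.topologicalClosure

theorem ev_mem_pAlg (P : MM) : ev (cZ Y) (cW Y) P ∈ pAlg Y :=
  Subalgebra.le_topologicalClosure _ ⟨P, rfl⟩

/-- first coordinate -/
def pZ : pAlg Y := ⟨cZ Y, by have := ev_mem_pAlg Y (MvPolynomial.X 0); rwa [ev_X0] at this⟩
/-- second coordinate -/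
def pW : pAlg Y := ⟨cW Y, by have := ev_mem_pAlg Y (MvPolynomial.X 1); rwa [ev_X1] at this⟩

theorem ev_pZ (P : MM) : ((ev (pZ Y) (pW Y) P : pAlg Y) : C(Y, ℂ)) = ev (cZ Y) (cW Y) P :=
  map_ev (pAlg Y).val (pZ Y) (pW Y) P

instance : CompleteSpace (pAlg Y) :=
  (Subalgebra.isClosed_topologicalClosure _).completeSpace_coe

instance [Nonempty Y] : NormOneClass (pAlg Y) := ⟨by
  change ‖(1 : C(Y, ℂ))‖ = 1
  exact norm_one⟩

/-- Evaluation at a point. -/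
def pEval (y : Y) : pAlg Y →ₐ[ℂ] ℂ := (ContinuousMap.evalAlgHom ℂ ℂ y).comp (pAlg Y).val

theorem pEval_ev (y : Y) (P : MM) : pEval Y y (ev (pZ Y) (pW Y) P) = ev y.1.1 y.1.2 P :=
  map_ev (pEval Y y) (pZ Y) (pW Y) P

theorem norm_pEval_le (y : Y) (a : pAlg Y) : ‖pEval Y y a‖ ≤ ‖a‖ :=
  ContinuousMap.norm_coe_le_norm (a : C(Y, ℂ)) y

theorem exists_approx_pAlg (a : pAlg Y) {δ : ℝ} (hδ : 0 < δ) :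
    ∃ P : MM, ‖a - ev (pZ Y) (pW Y) P‖ < δ := by
  have h := a.2
  change (a : C(Y, ℂ)) ∈ closure _ at h
  obtain ⟨b, ⟨P, rfl⟩, hb⟩ := Metric.mem_closure_iff.1 h δ hδ
  refine ⟨P, ?_⟩
  rw [dist_eq_norm] at hb
  change ‖(a : C(Y, ℂ)) - ((ev (pZ Y) (pW Y) P : pAlg Y) : C(Y, ℂ))‖ < δ
  rw [ev_pZ]
  exact hb

theorem norm_ev_lt [Nonempty Y] {P : MM} {M : ℝ} (h : ∀ y ∈ Y, ‖ev y.1 y.2 P‖ < M) :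
    ‖ev (pZ Y) (pW Y) P‖ < M := by
  change ‖((ev (pZ Y) (pW Y) P : pAlg Y) : C(Y, ℂ))‖ < M
  rw [ev_pZ]
  obtain ⟨y0⟩ := ‹Nonempty Y›
  rw [ContinuousMap.norm_lt_iff _ ((norm_nonneg _).trans_lt (h y0 y0.2))]
  intro y
  rw [ev_cZ_apply]
  exact h y y.2

theorem exists_res_of_not_mem [Nonempty Y] {η w : ℂ} (h : ((η, w) : ℂ × ℂ) ∉ phull Y) :
    ∃ φ, Res (pZ Y) (pW Y) η w φ := by
  obtain ⟨P, hP⟩ := exists_poly_of_not_mem_phull h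
  obtain ⟨Q, D, e, h1, h2⟩ := exists_res_poly (norm_ev_lt Y hP)
  exact ⟨_, res_of_poly h1 h2⟩

end CY

theorem phull_phull (K : Set (ℂ × ℂ)) : phull (phull K) ⊆ phull K := by
  intro x hx P
  obtain ⟨y, hy, h1⟩ := hx P
  obtain ⟨z, hz, h2⟩ := hy P
  exact ⟨z, hz, h1.trans h2⟩

theorem rossi {K : Set (ℂ × ℂ)} (hK : IsCompact K) {κ r τ η₀ : ℝ} (hκ : 0 < κ)
    (hr : 0 < r) (hτ : 0 < τ) (hη₀ : 0 < η₀) (h0 : ((0, 0) : ℂ × ℂ) ∈ phull K)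
    (hK0 : ∀ p ∈ K, ‖p.1‖ ≤ κ → r + τ ≤ ‖p.2‖)
    (hX : ∀ η : ℝ, 0 ≤ η → η ≤ η₀ → ∀ w : ℂ, ‖w‖ ≤ r → (((η : ℂ), w) : ℂ × ℂ) ∈ phull K →
      η = 0 ∧ w = 0) : False := by
  have hne : K.Nonempty := by
    obtain ⟨y, hy, _⟩ := h0 0
    exact ⟨y, hy⟩
  have hYc := isCompact_phull hK hne
  set Y := phull K with hY
  have : CompactSpace Y := isCompact_iff_compactSpace.1 hYc
  have : Nonempty Y := ⟨⟨_, h0⟩⟩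
  obtain ⟨C, hC, η₁, hη₁, hmain⟩ := cfr (Z := pZ Y) (W := pW Y) hr hτ (by
    intro w hw
    apply exists_res_of_not_mem
    intro hmem
    have := hX 0 le_rfl hη₀.le w (by rw [mem_sphere_zero_iff_norm] at hw; exact hw.le)
      (by simpa using phull_phull K hmem)
    rw [this.2] at hw
    simp at hw
    linarith)
  -- choose η small
  set T := C * (C + 1) + C * ((C + 1) * (2 / κ)) + 1 with hT
  have hTp : 0 < T := by positivity
  obtain ⟨η, hηp, hη⟩ : ∃ η : ℝ, 0 < η ∧ η < min (min (min η₀ η₁) (κ / 2))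
      (min (1 / (2 * C)) (1 / (8 * T))) := exists_between (by positivity)
  simp only [lt_min_iff] at hη
  obtain ⟨⟨⟨e1, e2⟩, e3⟩, e4, e5⟩ := hη
  obtain ⟨Φ, hΦ1, hΦ2, hΦ3, hΦ4⟩ := hmain η hηp e2 (by
    intro w hw
    apply exists_res_of_not_mem
    intro hmem
    have := hX η hηp.le e1.le w (by simpa using hw) (phull_phull K hmem)
    linarith [this.1])
  obtain ⟨a, ha⟩ := hΦ1 (1 / 4) (by norm_num)
  -- value of χ on the difference
  have hd : ∀ y : Y, ‖pEval Y y Φ - (y.1.1 - η) * pEval Y y a‖ < 1 / 4 := by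
    intro y
    refine lt_of_le_of_lt ?_ ha
    refine le_trans (le_of_eq ?_) (norm_pEval_le Y y _)
    rw [map_sub, map_mul, map_sub, AlgHom.commutes]
    rfl
  have hKb : ∀ y : Y, y.1 ∈ K → ‖pEval Y y (Φ * a)‖ ≤ T - 1 := by
    intro y hy
    have h1 := hd y
    have h2 : ‖pEval Y y Φ‖ ≤ C := (norm_pEval_le Y y _).trans hΦ2
    have h3 : ‖(y.1.1 - η) * pEval Y y a‖ ≤ C + 1 := by
      have := norm_le_norm_add_norm_sub (pEval Y y Φ) ((y.1.1 - η) * pEval Y y a)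
      linarith
    rw [norm_mul] at h3
    rw [map_mul, norm_mul]
    have hTT : T - 1 = C * (C + 1) + C * ((C + 1) * (2 / κ)) := by rw [hT]; ring
    rw [hTT]
    by_cases hκy : ‖y.1.1‖ ≤ κ
    · have h4 : ‖pEval Y y Φ‖ ≤ C * ‖y.1.1 - η‖ := hΦ3 (pEval Y y) (hK0 _ hy hκy)
      have h5 : ‖pEval Y y Φ‖ * ‖pEval Y y a‖ ≤ C * (‖y.1.1 - η‖ * ‖pEval Y y a‖) := by
        rw [← mul_assoc]
        gcongr
      have h6 : C * (‖y.1.1 - (η : ℂ)‖ * ‖pEval Y y a‖) ≤ C * (C + 1) := by gcongr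
      have : 0 ≤ C * ((C + 1) * (2 / κ)) := by positivity
      linarith
    · push Not at hκy
      have h4 : κ / 2 ≤ ‖y.1.1 - (η : ℂ)‖ := by
        have := norm_sub_norm_le y.1.1 (η : ℂ)
        rw [Complex.norm_real, Real.norm_of_nonneg hηp.le] at this
        linarith
      have h5 : ‖pEval Y y a‖ ≤ (C + 1) * (2 / κ) := by
        have h6 : κ / 2 * ‖pEval Y y a‖ ≤ C + 1 := le_trans (by gcongr) h3
        calc ‖pEval Y y a‖ = (κ / 2 * ‖pEval Y y a‖) * (2 / κ) := by field_simp
          _ ≤ _ := by gcongr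
      have h6 : ‖pEval Y y Φ‖ * ‖pEval Y y a‖ ≤ C * ((C + 1) * (2 / κ)) := by gcongr
      have : 0 ≤ C * (C + 1) := by positivity
      linarith
  set o : Y := ⟨(0, 0), h0⟩ with ho
  have hob : ‖pEval Y o (Φ * a)‖ ≤ T - 1 / 4 := by
    obtain ⟨P, hP⟩ := exists_approx_pAlg Y (Φ * a) (δ := 1 / 4) (by norm_num)
    have hd2 : ∀ y : Y, ‖pEval Y y (Φ * a) - ev y.1.1 y.1.2 P‖ ≤ 1 / 4 := by
      intro y
      have := (norm_pEval_le Y y _).trans hP.le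
      rwa [map_sub, pEval_ev] at this
    have h1 : ‖ev (0 : ℂ) 0 P‖ ≤ T - 1 + 1 / 4 := by
      refine (mem_phull_iff hK hne (0, 0)).1 h0 P _ ?_
      intro y hy
      have h2 := hKb ⟨y, subset_phull K hy⟩ hy
      have h3 := hd2 ⟨y, subset_phull K hy⟩
      have h4 := norm_le_norm_add_norm_sub (pEval Y ⟨y, subset_phull K hy⟩ (Φ * a)) (ev y.1 y.2 P)
      linarith
    have h3 := hd2 o
    have h4 := norm_le_norm_add_norm_sub (ev (0 : ℂ) 0 P) (pEval Y o (Φ * a))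
    rw [norm_sub_rev] at h3
    have h5 : ‖ev (0 : ℂ) 0 P - pEval Y o (Φ * a)‖ ≤ 1 / 4 := h3
    linarith
  have h1 : ‖pEval Y o Φ - 1‖ ≤ 1 / 2 := by
    refine (hΦ4 (pEval Y o) rfl rfl).trans ?_
    calc C * η ≤ C * (1 / (2 * C)) := by gcongr
      _ = 1 / 2 := by field_simp
  have h2 : 1 / 2 ≤ ‖pEval Y o Φ‖ := by
    have h := norm_le_norm_add_norm_sub (pEval Y o Φ) 1
    rw [norm_one] at h
    linarith
  have h3 : 1 / 4 ≤ η * ‖pEval Y o a‖ := by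
    have h4 := hd o
    have h5 := norm_le_norm_add_norm_sub ((o.1.1 - (η : ℂ)) * pEval Y o a) (pEval Y o Φ)
    rw [norm_sub_rev] at h5
    have h6 : ‖(o.1.1 - (η : ℂ)) * pEval Y o a‖ = η * ‖pEval Y o a‖ := by
      rw [norm_mul]
      congr 1
      change ‖(0 : ℂ) - η‖ = η
      rw [zero_sub, norm_neg, Complex.norm_real, Real.norm_of_nonneg hηp.le]
    linarith
  rw [map_mul, norm_mul] at hob
  have h4 : 1 / 2 * ‖pEval Y o a‖ ≤ T := by
    have : 1 / 2 * ‖pEval Y o a‖ ≤ ‖pEval Y o Φ‖ * ‖pEval Y o a‖ := by gcongr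
    linarith
  have h5 : η * T < 1 / 8 := by
    calc η * T < 1 / (8 * T) * T := by gcongr
      _ = 1 / 8 := by field_simp
  nlinarith

end PartPolyHull

section PartLocMax

open Filter Topology ComplexConjugate
set_option linter.unusedSectionVars false

/-- Image of a hull under a polynomial map. -/
theorem phull_map {K : Set (ℂ × ℂ)} (T1 T2 : MM) {x : ℂ × ℂ} (hx : x ∈ phull K) :
    ((ev x.1 x.2 T1, ev x.1 x.2 T2) : ℂ × ℂ) ∈
      phull ((fun y : ℂ × ℂ => (ev y.1 y.2 T1, ev y.1 y.2 T2)) '' K) := by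
  intro P
  obtain ⟨y, hy, h⟩ := hx (ev T1 T2 P)
  refine ⟨_, ⟨y, hy, rfl⟩, ?_⟩
  have h1 := map_ev (ev x.1 x.2) T1 T2 P
  have h2 := map_ev (ev y.1 y.2) T1 T2 P
  rw [h1, h2] at h
  exact h

theorem rl_aux1 {m s : ℝ} (hm : 1 ≤ m) (hs : 0 ≤ s) :
    m * (s + m * s) + m * s ≤ 3 * m ^ 2 * s := by
  have : m * s ≤ m * (m * s) := by
    have : 0 ≤ m * s := by positivity
    nlinarith
  nlinarith

theorem rl_aux2 {m s c η w B : ℝ} (hm1 : 1 ≤ m) (hs0 : 0 ≤ s) (hs1 : s ≤ 1)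
    (hs3 : 16 * m ^ 3 * s < 1) (hs4 : 16 * m ^ 3 * s < c) (hη0 : 0 ≤ η) (hη1 : η ≤ s)
    (hw0 : 0 ≤ w) (hws : w ≤ s)
    (hB : B ≤ (η + m * w ^ 2) * (m * (η + m * w ^ 2) + m * w))
    (h : η + c * w ^ 2 ≤ B) : η = 0 ∧ w = 0 := by
  have hm3 : 0 ≤ m ^ 3 * s := by positivity
  have hc : 0 < c := by linarith
  have f1 : m * (η + m * w ^ 2) + m * w ≤ 4 * m ^ 2 * s := by
    have j0 : w ^ 2 ≤ s := by nlinarith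
    have j1 : m * (η + m * w ^ 2) ≤ m * (s + m * s) := by gcongr
    have j2 : m * w ≤ m * s := by gcongr
    have j3 := rl_aux1 hm1 hs0
    have j4 : 0 ≤ m ^ 2 * s := by positivity
    linarith
  have f2 : (η + m * w ^ 2) * (m * (η + m * w ^ 2) + m * w) ≤
      (η + m * w ^ 2) * (4 * m ^ 2 * s) := by gcongr
  have f3 : η * (4 * m ^ 2 * s) ≤ η * (1 / 4) := by
    have : m ^ 2 * s ≤ m ^ 3 * s := by
      have : m ^ 2 ≤ m ^ 3 := pow_le_pow_right₀ hm1 (by norm_num)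
      gcongr
    have : 4 * m ^ 2 * s ≤ 1 / 4 := by linarith
    gcongr
  have f4 : m * w ^ 2 * (4 * m ^ 2 * s) ≤ c / 4 * w ^ 2 := by
    have : m * w ^ 2 * (4 * m ^ 2 * s) = (4 * m ^ 3 * s) * w ^ 2 := by ring
    rw [this]
    have : 4 * m ^ 3 * s ≤ c / 4 := by linarith
    gcongr
  have f5 : η * (3 / 4) + c * (3 / 4) * w ^ 2 ≤ 0 := by
    linarith [add_mul η (m * w ^ 2) (4 * m ^ 2 * s)]
  have f6 : 0 ≤ c * (3 / 4) * w ^ 2 := by positivity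
  have f7 : η = 0 := by linarith
  refine ⟨f7, ?_⟩
  have f8 : c * (3 / 4) * w ^ 2 = 0 := by linarith
  rcases mul_eq_zero.1 f8 with h | h
  · linarith
  · exact (pow_eq_zero_iff two_ne_zero).1 h

set_option maxHeartbeats 1000000 in
theorem rossi_local {K : Set (ℂ × ℂ)} (hK : IsCompact K) {x₀ : ℂ × ℂ} (hx₀ : x₀ ∈ phull K)
    {l₁ l₂ q₁ q₂ q₃ : ℂ} {c ρ : ℝ} (hc : 0 < c) (hρ : 0 < ρ)
    (hKρ : ∀ h : ℂ × ℂ, ‖h‖ < ρ → x₀ + h ∉ K)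
    (hX : ∀ h : ℂ × ℂ, ‖h‖ < ρ → x₀ + h ∈ phull K →
      (l₁ * h.1 + l₂ * h.2 + (q₁ * h.1 ^ 2 + q₂ * h.1 * h.2 + q₃ * h.2 ^ 2)).re ≤
        -(c * (Complex.normSq h.1 + Complex.normSq h.2)))
    (hl : ¬ (l₁ = 0 ∧ l₂ = 0)) : False := by
  set N : ℂ := l₁ * conj l₁ + l₂ * conj l₂ with hN
  have hNr : N = ((Complex.normSq l₁ + Complex.normSq l₂ : ℝ) : ℂ) := by
    rw [hN, Complex.mul_conj, Complex.mul_conj]; push_cast; rfl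
  have hN0 : N ≠ 0 := by
    rw [hNr]
    intro h
    have h' : Complex.normSq l₁ + Complex.normSq l₂ = 0 := by exact_mod_cast h
    have h1 := Complex.normSq_nonneg l₁
    have h2 := Complex.normSq_nonneg l₂
    exact hl ⟨Complex.normSq_eq_zero.1 (by linarith), Complex.normSq_eq_zero.1 (by linarith)⟩
  set u₁ := conj l₁ / N
  set u₂ := -l₂ / N
  set v₁ := conj l₂ / N
  set v₂ := l₁ / N
  set α := q₁ * u₁ ^ 2 + q₂ * u₁ * v₁ + q₃ * v₁ ^ 2
  set β := 2 * q₁ * u₁ * u₂ + q₂ * (u₁ * v₂ + u₂ * v₁) + 2 * q₃ * v₁ * v₂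
  set γ := q₁ * u₂ ^ 2 + q₂ * u₂ * v₂ + q₃ * v₂ ^ 2
  -- the coordinate change
  set a : ℂ × ℂ → ℂ := fun x => l₁ * (x.1 - x₀.1) + l₂ * (x.2 - x₀.2)
  set b : ℂ × ℂ → ℂ := fun x => -conj l₂ * (x.1 - x₀.1) + conj l₁ * (x.2 - x₀.2)
  set θ : ℂ × ℂ → ℂ × ℂ := fun x => (a x + γ * b x ^ 2, b x) with hθ
  set θi : ℂ × ℂ → ℂ × ℂ := fun p => (x₀.1 + u₁ * (p.1 - γ * p.2 ^ 2) + u₂ * p.2,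
    x₀.2 + v₁ * (p.1 - γ * p.2 ^ 2) + v₂ * p.2) with hθi
  have hinv : ∀ x, θi (θ x) = x := by
    intro x
    have e1 : u₁ * a x + u₂ * b x = x.1 - x₀.1 := by
      simp only [u₁, u₂, a, b]; field_simp; rw [hN]; ring
    have e2 : v₁ * a x + v₂ * b x = x.2 - x₀.2 := by
      simp only [v₁, v₂, a, b]; field_simp; rw [hN]; ring
    ext
    · simp only [hθ, hθi]; linear_combination e1
    · simp only [hθ, hθi]; linear_combination e2
  set X0 : MM := MvPolynomial.X 0
  set X1 : MM := MvPolynomial.X 1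
  let C : ℂ → MM := MvPolynomial.C
  set Bp : MM := C (-conj l₂) * (X0 - C x₀.1) + C (conj l₁) * (X1 - C x₀.2)
  set Ap : MM := C l₁ * (X0 - C x₀.1) + C l₂ * (X1 - C x₀.2) + C γ * Bp ^ 2
  have hθp : θ = fun x => (ev x.1 x.2 Ap, ev x.1 x.2 Bp) := by
    funext x
    simp [hθ, Ap, Bp, C, X0, X1, a, b]
  have hθip : θi = fun p => (ev p.1 p.2 (C x₀.1 + C u₁ * (X0 - C γ * X1 ^ 2) + C u₂ * X1),
      ev p.1 p.2 (C x₀.2 + C v₁ * (X0 - C γ * X1 ^ 2) + C v₂ * X1)) := by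
    funext x
    simp [hθi, C, X0, X1]
  have hθc : Continuous θ := by
    simp only [hθ, a, b]; fun_prop
  set K' := θ '' K with hK'
  have h1 : ∀ x ∈ phull K, θ x ∈ phull K' := by
    intro x hx
    have := phull_map Ap Bp hx
    rw [hK', hθp]
    exact this
  have h2 : ∀ p ∈ phull K', θi p ∈ phull K := by
    intro p hp
    have := phull_map (C x₀.1 + C u₁ * (X0 - C γ * X1 ^ 2) + C u₂ * X1)
      (C x₀.2 + C v₁ * (X0 - C γ * X1 ^ 2) + C v₂ * X1) hp
    have h3 : (fun p : ℂ × ℂ => (ev p.1 p.2 (C x₀.1 + C u₁ * (X0 - C γ * X1 ^ 2) + C u₂ * X1),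
      ev p.1 p.2 (C x₀.2 + C v₁ * (X0 - C γ * X1 ^ 2) + C v₂ * X1))) '' K' = K := by
      rw [← hθip, hK', image_image]
      simp [hinv]
    rw [h3] at this
    rw [hθip]
    exact this
  -- constants
  set m : ℝ := ‖u₁‖ + ‖u₂‖ + ‖v₁‖ + ‖v₂‖ + ‖α‖ + ‖β‖ + ‖γ‖ + 1 with hm
  have hm1 : 1 ≤ m := by
    rw [hm]
    have := norm_nonneg u₁; have := norm_nonneg u₂; have := norm_nonneg v₁
    have := norm_nonneg v₂; have := norm_nonneg α; have := norm_nonneg β; have := norm_nonneg γ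
    linarith
  have hmu₁ : ‖u₁‖ ≤ m := by
    rw [hm]
    have := norm_nonneg u₁; have := norm_nonneg u₂; have := norm_nonneg v₁
    have := norm_nonneg v₂; have := norm_nonneg α; have := norm_nonneg β; have := norm_nonneg γ
    linarith
  have hmu₂ : ‖u₂‖ ≤ m := by
    rw [hm]
    have := norm_nonneg u₁; have := norm_nonneg u₂; have := norm_nonneg v₁
    have := norm_nonneg v₂; have := norm_nonneg α; have := norm_nonneg β; have := norm_nonneg γ
    linarith
  have hmv₁ : ‖v₁‖ ≤ m := by
    rw [hm]
    have := norm_nonneg u₁; have := norm_nonneg u₂; have := norm_nonneg v₁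
    have := norm_nonneg v₂; have := norm_nonneg α; have := norm_nonneg β; have := norm_nonneg γ
    linarith
  have hmv₂ : ‖v₂‖ ≤ m := by
    rw [hm]
    have := norm_nonneg u₁; have := norm_nonneg u₂; have := norm_nonneg v₁
    have := norm_nonneg v₂; have := norm_nonneg α; have := norm_nonneg β; have := norm_nonneg γ
    linarith
  have hmα : ‖α‖ ≤ m := by
    rw [hm]
    have := norm_nonneg u₁; have := norm_nonneg u₂; have := norm_nonneg v₁
    have := norm_nonneg v₂; have := norm_nonneg α; have := norm_nonneg β; have := norm_nonneg γ
    linarith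
  have hmβ : ‖β‖ ≤ m := by
    rw [hm]
    have := norm_nonneg u₁; have := norm_nonneg u₂; have := norm_nonneg v₁
    have := norm_nonneg v₂; have := norm_nonneg α; have := norm_nonneg β; have := norm_nonneg γ
    linarith
  have hmγ : ‖γ‖ ≤ m := by
    rw [hm]
    have := norm_nonneg u₁; have := norm_nonneg u₂; have := norm_nonneg v₁
    have := norm_nonneg v₂; have := norm_nonneg α; have := norm_nonneg β; have := norm_nonneg γ
    linarith
  -- bound on b in terms of h
  set n : ℝ := Complex.normSq l₁ + Complex.normSq l₂ with hn
  have hnpos : 0 < n := by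
    have h1 := Complex.normSq_nonneg l₁
    have h2 := Complex.normSq_nonneg l₂
    rcases (add_nonneg h1 h2).lt_or_eq with h | h
    · exact h
    · exfalso
      apply hN0
      rw [hNr]
      exact_mod_cast h.symm
  set c' := c / n with hc'
  have hc'p : 0 < c' := by positivity
  have hsmall : ∀ (p : ℂ × ℂ) (s : ℝ), 0 < s → s ≤ 1 → ‖p.1‖ ≤ s → ‖p.2‖ ≤ s →
      ‖u₁ * (p.1 - γ * p.2 ^ 2) + u₂ * p.2‖ ≤ 3 * m ^ 2 * s ∧
      ‖v₁ * (p.1 - γ * p.2 ^ 2) + v₂ * p.2‖ ≤ 3 * m ^ 2 * s := by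
    intro p s hs hs1 hp1 hp2
    have e1 : ‖p.1 - γ * p.2 ^ 2‖ ≤ s + m * s := by
      refine (norm_sub_le _ _).trans ?_
      rw [norm_mul, norm_pow]
      gcongr
      calc ‖p.2‖ ^ 2 ≤ s ^ 2 := by gcongr
        _ ≤ s := by nlinarith
    constructor
    · refine (norm_add_le _ _).trans ?_
      rw [norm_mul, norm_mul]
      calc _ ≤ m * (s + m * s) + m * s := by gcongr
        _ ≤ _ := rl_aux1 hm1 hs.le
    · refine (norm_add_le _ _).trans ?_
      rw [norm_mul, norm_mul]
      calc _ ≤ m * (s + m * s) + m * s := by gcongr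
        _ ≤ _ := rl_aux1 hm1 hs.le
  have hθi' : ∀ p, θi p = x₀ + (u₁ * (p.1 - γ * p.2 ^ 2) + u₂ * p.2,
      v₁ * (p.1 - γ * p.2 ^ 2) + v₂ * p.2) := by
    intro p
    ext <;> simp [hθi, add_assoc]
  obtain ⟨s, hs0, hs⟩ : ∃ s : ℝ, 0 < s ∧ s < min (min 1 (ρ / (3 * m ^ 2)))
      (min (1 / (16 * m ^ 3)) (c' / (16 * m ^ 3))) := exists_between (by positivity)
  simp only [lt_min_iff] at hs
  obtain ⟨⟨hs1, hs2⟩, hs3, hs4⟩ := hs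
  have hs2' : 3 * m ^ 2 * s < ρ := by rwa [lt_div_iff₀ (by positivity), mul_comm] at hs2
  have hs3' : 16 * m ^ 3 * s < 1 := by rwa [lt_div_iff₀ (by positivity), mul_comm] at hs3
  have hs4' : 16 * m ^ 3 * s < c' := by rwa [lt_div_iff₀ (by positivity), mul_comm] at hs4
  refine rossi (K := K') (hK.image hθc) (κ := s) (r := s / 2) (τ := s / 4) (η₀ := s) hs0
    (by positivity) (by positivity) hs0 ?_ ?_ ?_
  · have := h1 x₀ hx₀
    simpa [hθ, a, b] using this
  · rintro p ⟨x, hx, rfl⟩ hp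
    by_contra hlt
    push Not at hlt
    obtain ⟨e1, e2⟩ := hsmall (θ x) s hs0 hs1.le hp (by linarith)
    have e3 := hθi' (θ x)
    rw [hinv] at e3
    refine hKρ _ ?_ (e3 ▸ hx)
    exact (max_le e1 e2).trans_lt hs2'
  · intro η hη0 hη1 w hw hmem
    have hηn : ‖(η : ℂ)‖ = η := by rw [Complex.norm_real, Real.norm_of_nonneg hη0]
    obtain ⟨e1, e2⟩ := hsmall ((η : ℂ), w) s hs0 hs1.le (by rw [hηn]; exact hη1)
      (hw.trans (by linarith))
    have e3 := h2 _ hmem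
    rw [hθi'] at e3
    have e4 := hX _ ((max_le e1 e2).trans_lt hs2') e3
    simp only at e4
    set A := (η : ℂ) - γ * w ^ 2 with hA
    have i1 : l₁ * u₁ + l₂ * v₁ = 1 := by
      simp only [u₁, v₁]; field_simp; rw [hN]
    have i2 : l₁ * u₂ + l₂ * v₂ = 0 := by
      simp only [u₂, v₂]; field_simp; ring
    have e5 : l₁ * (u₁ * A + u₂ * w) + l₂ * (v₁ * A + v₂ * w) +
        (q₁ * (u₁ * A + u₂ * w) ^ 2 + q₂ * (u₁ * A + u₂ * w) * (v₁ * A + v₂ * w) +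
          q₃ * (v₁ * A + v₂ * w) ^ 2) = η + A * (α * A + β * w) := by
      simp only [α, β]
      linear_combination A * i1 + w * i2 + hA
    rw [e5] at e4
    -- lower bound for |k|^2
    have e6 : Complex.normSq w ≤ n * (Complex.normSq (u₁ * A + u₂ * w) +
        Complex.normSq (v₁ * A + v₂ * w)) := by
      have i3 : w = -conj l₂ * (u₁ * A + u₂ * w) + conj l₁ * (v₁ * A + v₂ * w) := by
        simp only [u₁, v₁, u₂, v₂]; field_simp; rw [hN]; ring
      set k1 := u₁ * A + u₂ * w
      set k2 := v₁ * A + v₂ * w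
      have i4 : n * (Complex.normSq k1 + Complex.normSq k2) =
          Complex.normSq (-conj l₂ * k1 + conj l₁ * k2) +
          Complex.normSq (l₁ * k1 + l₂ * k2) := by
        rw [hn]
        simp only [Complex.normSq_apply, Complex.add_re, Complex.add_im, Complex.mul_re,
          Complex.mul_im, Complex.neg_re, Complex.neg_im, Complex.conj_re, Complex.conj_im]
        ring
      rw [i4, ← i3]
      have := Complex.normSq_nonneg (l₁ * k1 + l₂ * k2)
      linarith
    rw [Complex.normSq_eq_norm_sq w] at e6
    have e7 : c' * ‖w‖ ^ 2 ≤ c * (Complex.normSq (u₁ * A + u₂ * w) +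
        Complex.normSq (v₁ * A + v₂ * w)) := by
      rw [hc', div_mul_eq_mul_div, div_le_iff₀ hnpos]
      calc c * ‖w‖ ^ 2 ≤ c * (n * (Complex.normSq (u₁ * A + u₂ * w) +
            Complex.normSq (v₁ * A + v₂ * w))) := by gcongr
        _ = _ := by ring
    have e8 : ‖A * (α * A + β * w)‖ ≤ (η + m * ‖w‖ ^ 2) * (m * (η + m * ‖w‖ ^ 2) + m * ‖w‖) := by
      have i5 : ‖A‖ ≤ η + m * ‖w‖ ^ 2 := by
        refine (norm_sub_le _ _).trans ?_
        rw [norm_mul, norm_pow, hηn]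
        gcongr
      rw [norm_mul]
      gcongr
      refine (norm_add_le _ _).trans ?_
      rw [norm_mul, norm_mul]
      gcongr
    have e9 : -‖A * (α * A + β * w)‖ ≤ (A * (α * A + β * w)).re := by
      have := Complex.abs_re_le_norm (A * (α * A + β * w))
      exact (abs_le.1 this).1
    rw [Complex.add_re, Complex.ofReal_re] at e4
    have hws : ‖w‖ ≤ s := hw.trans (by linarith)
    obtain ⟨f7, f9⟩ := rl_aux2 hm1 hs0.le hs1.le hs3' hs4' hη0 hη1 (norm_nonneg w) hws
      e8 (by linarith)
    exact ⟨f7, norm_eq_zero.1 f9⟩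

end PartLocMax

section PartB1

open Filter Topology ComplexConjugate
set_option linter.unusedSectionVars false

theorem exists_isotropic (q₁ q₂ q₃ : ℂ) {ε : ℝ} (hε : 0 < ε) :
    ∃ y : ℂ × ℂ, y ≠ 0 ∧ ‖y‖ < ε ∧ q₁ * y.1 ^ 2 + q₂ * y.1 * y.2 + q₃ * y.2 ^ 2 = 0 := by
  obtain ⟨y, hy0, hy⟩ : ∃ y : ℂ × ℂ, y ≠ 0 ∧
      q₁ * y.1 ^ 2 + q₂ * y.1 * y.2 + q₃ * y.2 ^ 2 = 0 := by
    by_cases h : q₁ = 0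
    · exact ⟨(1, 0), by simp, by simp [h]⟩
    · obtain ⟨s, hs⟩ := IsAlgClosed.exists_eq_mul_self (discrim q₁ q₂ q₃)
      obtain ⟨x, hx⟩ := exists_quadratic_eq_zero h ⟨s, hs⟩
      refine ⟨(x, 1), by simp, ?_⟩
      simp only
      linear_combination hx
  have hn : 0 < ‖y‖ := norm_pos_iff.2 hy0
  set t : ℝ := ε / 2 / ‖y‖ with ht
  have htp : 0 < t := by positivity
  refine ⟨((t : ℂ)) • y, ?_, ?_, ?_⟩
  · exact smul_ne_zero (by exact_mod_cast htp.ne') hy0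
  · rw [norm_smul, Complex.norm_real, Real.norm_of_nonneg htp.le, ht, div_mul_cancel₀ _ hn.ne']
    linarith
  · simp only [Prod.smul_fst, Prod.smul_snd, smul_eq_mul]
    linear_combination (t : ℂ) ^ 2 * hy

theorem b1_aux (q₁ q₂ q₃ : ℂ) (h y : ℂ × ℂ) :
    |(2 * q₁ * h.1 * y.1 + q₂ * (h.1 * y.2 + h.2 * y.1) + 2 * q₃ * h.2 * y.2).re| ≤
      (2 * ‖q₁‖ + 2 * ‖q₂‖ + 2 * ‖q₃‖) * (‖h‖ * ‖y‖) := by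
  have h1 : ‖h.1‖ ≤ ‖h‖ := norm_fst_le h
  have h2 : ‖h.2‖ ≤ ‖h‖ := norm_snd_le h
  have y1 : ‖y.1‖ ≤ ‖y‖ := norm_fst_le y
  have y2 : ‖y.2‖ ≤ ‖y‖ := norm_snd_le y
  refine (Complex.abs_re_le_norm _).trans ?_
  have e1 : ‖2 * q₁ * h.1 * y.1‖ ≤ 2 * ‖q₁‖ * (‖h‖ * ‖y‖) := by
    simp only [norm_mul, Complex.norm_ofNat, mul_assoc]; gcongr
  have e2 : ‖q₂ * (h.1 * y.2 + h.2 * y.1)‖ ≤ 2 * ‖q₂‖ * (‖h‖ * ‖y‖) := by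
    rw [norm_mul]
    have : ‖h.1 * y.2 + h.2 * y.1‖ ≤ ‖h‖ * ‖y‖ + ‖h‖ * ‖y‖ := by
      refine (norm_add_le _ _).trans ?_
      rw [norm_mul, norm_mul]; gcongr
    calc _ ≤ ‖q₂‖ * (‖h‖ * ‖y‖ + ‖h‖ * ‖y‖) := by gcongr
      _ = _ := by ring
  have e3 : ‖2 * q₃ * h.2 * y.2‖ ≤ 2 * ‖q₃‖ * (‖h‖ * ‖y‖) := by
    simp only [norm_mul, Complex.norm_ofNat, mul_assoc]; gcongr
  calc _ ≤ ‖2 * q₁ * h.1 * y.1‖ + ‖q₂ * (h.1 * y.2 + h.2 * y.1)‖ + ‖2 * q₃ * h.2 * y.2‖ :=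
        norm_add₃_le
    _ ≤ _ := by linarith

theorem b1_aux2 (h y : ℂ × ℂ) :
    |(conj h.1 * y.1 + conj h.2 * y.2).re| ≤ 2 * (‖h‖ * ‖y‖) := by
  have h1 : ‖h.1‖ ≤ ‖h‖ := norm_fst_le h
  have h2 : ‖h.2‖ ≤ ‖h‖ := norm_snd_le h
  have y1 : ‖y.1‖ ≤ ‖y‖ := norm_fst_le y
  have y2 : ‖y.2‖ ≤ ‖y‖ := norm_snd_le y
  refine (Complex.abs_re_le_norm _).trans ?_
  refine (norm_add_le _ _).trans ?_
  rw [norm_mul, norm_mul, RCLike.norm_conj, RCLike.norm_conj, two_mul]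
  gcongr

theorem norm_sq_le_normSq (h : ℂ × ℂ) : ‖h‖ ^ 2 ≤ Complex.normSq h.1 + Complex.normSq h.2 := by
  rw [Complex.normSq_eq_norm_sq, Complex.normSq_eq_norm_sq]
  rcases max_choice ‖h.1‖ ‖h.2‖ with e | e
  · have : ‖h‖ = ‖h.1‖ := e
    rw [this]; nlinarith [sq_nonneg ‖h.2‖]
  · have : ‖h‖ = ‖h.2‖ := e
    rw [this]; nlinarith [sq_nonneg ‖h.1‖]

/-- degenerate case. -/
theorem rossi_local0 {K : Set (ℂ × ℂ)} (hK : IsCompact K) {x₀ : ℂ × ℂ} (hx₀ : x₀ ∈ phull K)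
    {q₁ q₂ q₃ : ℂ} {c ρ : ℝ} (hc : 0 < c) (hρ : 0 < ρ)
    (hKρ : ∀ h : ℂ × ℂ, ‖h‖ < ρ → x₀ + h ∉ K)
    (hX : ∀ h : ℂ × ℂ, ‖h‖ < ρ → x₀ + h ∈ phull K →
      ((q₁ * h.1 ^ 2 + q₂ * h.1 * h.2 + q₃ * h.2 ^ 2)).re ≤
        -(c * (Complex.normSq h.1 + Complex.normSq h.2))) : False := by
  have hKne : K.Nonempty := by obtain ⟨y, hy, -⟩ := hx₀ 0; exact ⟨y, hy⟩
  set r := ρ / 2 with hr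
  have hr0 : 0 < r := by positivity
  set M := 2 * ‖q₁‖ + 2 * ‖q₂‖ + 2 * ‖q₃‖ + 2 * c with hM
  have hM0 : 0 < M := by positivity
  obtain ⟨y, hy0, hyε, hQy⟩ := exists_isotropic q₁ q₂ q₃ (ε := c * r / (2 * M)) (by positivity)
  have hyn : 0 < ‖y‖ := norm_pos_iff.2 hy0
  set Q : ℂ × ℂ → ℂ := fun h => q₁ * h.1 ^ 2 + q₂ * h.1 * h.2 + q₃ * h.2 ^ 2 with hQ
  set n2 : ℂ × ℂ → ℝ := fun h => Complex.normSq h.1 + Complex.normSq h.2 with hn2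
  set χ : ℂ × ℂ → ℝ := fun h => (Q (h - y)).re + c / 2 * n2 (h - y) with hχ
  have hχc : Continuous χ := by
    simp only [hχ, hQ, hn2, Complex.normSq_eq_norm_sq]
    fun_prop
  have hSc : IsCompact (phull K ∩ closedBall x₀ r) :=
    (isCompact_phull hK hKne).inter_right isClosed_closedBall
  obtain ⟨x1, ⟨hx1X, hx1r⟩, hmax⟩ := hSc.exists_isMaxOn ⟨x₀, hx₀, by simp [hr0.le]⟩
    ((hχc.comp (continuous_id.sub continuous_const)).continuousOn (f := fun x => χ (x - x₀)))
  set y' := x1 - x₀ with hy'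
  have hx1 : x1 = x₀ + y' := by simp [hy']
  have hχ0 : c / 2 * n2 y ≤ χ y' := by
    have := hmax (a := x₀) ⟨hx₀, by simp [hr0.le]⟩
    simp only [mem_ofPred_eq, sub_self] at this
    refine le_trans (le_of_eq ?_) this
    have : Q (0 - y) = 0 := by
      simp only [hQ, Prod.fst_sub, Prod.snd_sub, Prod.fst_zero, Prod.snd_zero]
      linear_combination hQy
    simp only [hχ, this]
    simp [hn2]
  have hy'r : ‖y'‖ ≤ r := mem_closedBall_iff_norm.1 hx1r
  -- interior
  have hy'lt : ‖y'‖ < r := by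
    have e1 := hX y' (by linarith) (hx1 ▸ hx1X)
    have e2 : χ y' = (Q y').re - (2 * q₁ * y'.1 * y.1 + q₂ * (y'.1 * y.2 + y'.2 * y.1)
        + 2 * q₃ * y'.2 * y.2).re + c / 2 * (n2 y' + n2 y)
        - c * (conj y'.1 * y.1 + conj y'.2 * y.2).re := by
      have : Q (y' - y) = Q y' - (2 * q₁ * y'.1 * y.1 + q₂ * (y'.1 * y.2 + y'.2 * y.1)
        + 2 * q₃ * y'.2 * y.2) := by
        simp only [hQ, Prod.fst_sub, Prod.snd_sub]; linear_combination hQy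
      simp only [hχ, this, Complex.sub_re, hn2, Prod.fst_sub, Prod.snd_sub,
        Complex.normSq_apply, Complex.add_re, Complex.mul_re, Complex.conj_re, Complex.conj_im,
        Complex.sub_im]
      ring
    have e3 := b1_aux q₁ q₂ q₃ y' y
    have e4 := b1_aux2 y' y
    have e5 := norm_sq_le_normSq y'
    have e6 := (abs_le.1 e3).1
    have e7 := (abs_le.1 e4).1
    have e8 : c / 2 * n2 y' ≤ M * (‖y'‖ * ‖y‖) := by
      have e9 : -(c * (conj y'.1 * y.1 + conj y'.2 * y.2).re) ≤ c * (2 * (‖y'‖ * ‖y‖)) := by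
        rw [← mul_neg]; gcongr; linarith
      have e10 : (Q y').re ≤ -(c * n2 y') := e1
      rw [hM]
      linarith
    have e9 : c / 2 * ‖y'‖ ^ 2 ≤ M * (‖y'‖ * ‖y‖) := le_trans (by gcongr) e8
    rcases (norm_nonneg y').eq_or_lt with h0 | h0
    · rw [← h0]; exact hr0
    · have e10 : c / 2 * ‖y'‖ ≤ M * ‖y‖ := by
        refine le_of_mul_le_mul_right ?_ h0
        linarith
      rw [lt_div_iff₀ (by positivity)] at hyε
      have : c * ‖y'‖ < c * r := by linarith
      exact lt_of_mul_lt_mul_left this hc.le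
  set d := y' - y with hd
  set L₁ := 2 * q₁ * d.1 + q₂ * d.2 + c * conj d.1 with hL₁
  set L₂ := q₂ * d.1 + 2 * q₃ * d.2 + c * conj d.2 with hL₂
  refine rossi_local hK (x₀ := x1) hx1X (l₁ := L₁) (l₂ := L₂) (q₁ := q₁) (q₂ := q₂) (q₃ := q₃)
    (c := c / 2) (ρ := r - ‖y'‖) (by positivity) (by linarith) ?_ ?_ ?_
  · intro k hk
    rw [hx1, add_assoc]
    refine hKρ _ ((norm_add_le _ _).trans_lt ?_)
    linarith
  · intro k hk hkX
    have e1 := hmax (a := x1 + k) ⟨hkX, by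
      rw [mem_closedBall_iff_norm, hx1, add_assoc, add_sub_cancel_left]
      exact (norm_add_le _ _).trans (by linarith)⟩
    simp only [mem_ofPred_eq] at e1
    have e2 : x1 + k - x₀ = y' + k := by rw [hx1]; abel
    rw [e2] at e1
    have e3 : y' + k - y = d + k := by rw [hd]; abel
    simp only [hχ, e3, ← hy', ← hd] at e1
    have e4 : Q (d + k) = Q d + ((2 * q₁ * d.1 + q₂ * d.2) * k.1 +
      (q₂ * d.1 + 2 * q₃ * d.2) * k.2) + Q k := by
      simp only [hQ, Prod.fst_add, Prod.snd_add]; ring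
    have e5 : n2 (d + k) = n2 d + 2 * (conj d.1 * k.1 + conj d.2 * k.2).re + n2 k := by
      simp only [hn2, Prod.fst_add, Prod.snd_add, Complex.normSq_apply, Complex.add_re,
        Complex.mul_re, Complex.conj_re, Complex.conj_im, Complex.add_im]
      ring
    rw [e4, e5] at e1
    have e6 : L₁ * k.1 + L₂ * k.2 + Q k = ((2 * q₁ * d.1 + q₂ * d.2) * k.1 +
      (q₂ * d.1 + 2 * q₃ * d.2) * k.2) + Q k + (c : ℂ) * (conj d.1 * k.1 + conj d.2 * k.2) := by
      rw [hL₁, hL₂]; ring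
    have e7 : (L₁ * k.1 + L₂ * k.2 + Q k).re ≤ -(c / 2 * n2 k) := by
      rw [e6, Complex.add_re, Complex.re_ofReal_mul, Complex.add_re]
      rw [Complex.add_re, Complex.add_re] at e1
      linarith
    exact e7
  · rintro ⟨z1, z2⟩
    have e1 : 2 * Q d + c * ((n2 d : ℝ) : ℂ) = 0 := by
      have : 2 * Q d + c * (d.1 * conj d.1 + d.2 * conj d.2) = L₁ * d.1 + L₂ * d.2 := by
        rw [hL₁, hL₂]; simp only [hQ]; ring
      rw [z1, z2] at this
      rw [Complex.mul_conj, Complex.mul_conj] at this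
      simp only [hn2]; push_cast
      linear_combination this
    have e2 : 2 * (Q d).re + c * n2 d = 0 := by
      have := congrArg Complex.re e1
      rw [Complex.add_re, Complex.re_ofReal_mul, Complex.ofReal_re] at this
      simpa using this
    have e3 : χ y' = 0 := by simp only [hχ, ← hd]; linarith
    have e4 := norm_sq_le_normSq y
    have e5 : 0 < n2 y := lt_of_lt_of_le (by positivity) e4
    have : 0 < c / 2 * n2 y := by positivity
    linarith

/-- Strict Taylor expansion with positive Levi form. -/
def StrictTaylor (Ψ : ℂ × ℂ → ℝ) : Prop :=
  ∀ x₀ : ℂ × ℂ, ∃ l₁ l₂ q₁ q₂ q₃ : ℂ, ∃ c ρ : ℝ, 0 < c ∧ 0 < ρ ∧ ∀ h : ℂ × ℂ, ‖h‖ < ρ →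
    Ψ x₀ + (l₁ * h.1 + l₂ * h.2 + (q₁ * h.1 ^ 2 + q₂ * h.1 * h.2 + q₃ * h.2 ^ 2)).re
      + c * (Complex.normSq h.1 + Complex.normSq h.2) ≤ Ψ (x₀ + h)

theorem hull_max {K : Set (ℂ × ℂ)} (hK : IsCompact K) {Ψ : ℂ × ℂ → ℝ} (hΨ : Continuous Ψ)
    (hT : StrictTaylor Ψ) {p : ℂ × ℂ} (hp : p ∈ phull K) : ∃ y ∈ K, Ψ p ≤ Ψ y := by
  by_contra hcon
  push Not at hcon
  have hKne : K.Nonempty := by obtain ⟨y, hy, -⟩ := hp 0; exact ⟨y, hy⟩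
  obtain ⟨x₀, hx₀, hmax⟩ := (isCompact_phull hK hKne).exists_isMaxOn ⟨p, hp⟩ hΨ.continuousOn
  have hx₀K : x₀ ∉ K := fun h => (hcon x₀ h).not_ge (hmax hp)
  obtain ⟨ρ', hρ', hball⟩ := Metric.isOpen_iff.1 hK.isClosed.isOpen_compl x₀ hx₀K
  obtain ⟨l₁, l₂, q₁, q₂, q₃, c, ρ, hc, hρ, hh⟩ := hT x₀
  have hA : ∀ h : ℂ × ℂ, ‖h‖ < min ρ ρ' → x₀ + h ∉ K := by
    intro h hh'
    exact hball (by simpa using hh'.trans_le (min_le_right _ _))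
  have hB : ∀ h : ℂ × ℂ, ‖h‖ < min ρ ρ' → x₀ + h ∈ phull K →
      (l₁ * h.1 + l₂ * h.2 + (q₁ * h.1 ^ 2 + q₂ * h.1 * h.2 + q₃ * h.2 ^ 2)).re ≤
        -(c * (Complex.normSq h.1 + Complex.normSq h.2)) := by
    intro h hh' hX
    have e1 := hh h (hh'.trans_le (min_le_left _ _))
    have e2 : Ψ (x₀ + h) ≤ Ψ x₀ := hmax hX
    linarith
  by_cases hl : l₁ = 0 ∧ l₂ = 0
  · refine rossi_local0 hK hx₀ hc (lt_min hρ hρ') hA (q₁ := q₁) (q₂ := q₂) (q₃ := q₃) ?_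
    intro h hh' hX
    have := hB h hh' hX
    simpa [hl.1, hl.2] using this
  · exact rossi_local hK hx₀ hc (lt_min hρ hρ') hA hB hl

end PartB1

section PartB2

open Filter Topology ComplexConjugate
set_option linter.unusedSectionVars false

theorem taylor_two {E : Type*} [NormedAddCommGroup E] [NormedSpace ℝ E] {v : E → ℝ}
    (hv : ContDiff ℝ 2 v) (x₀ : E) {ε : ℝ} (hε : 0 < ε) :
    ∃ ρ > 0, ∀ h : E, ‖h‖ < ρ →
      |v (x₀ + h) - v x₀ - fderiv ℝ v x₀ h - 1 / 2 * fderiv ℝ (fderiv ℝ v) x₀ h h| ≤ ε * ‖h‖ ^ 2 := by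
  have hd : Differentiable ℝ v := hv.differentiable (by norm_num)
  have hv' : ContDiff ℝ 1 (fderiv ℝ v) := hv.fderiv_right (by norm_num)
  have hF : HasFDerivAt (fderiv ℝ v) (fderiv ℝ (fderiv ℝ v) x₀) x₀ :=
    (hv'.differentiable (by norm_num) x₀).hasFDerivAt
  set L := fderiv ℝ v x₀
  set S := fderiv ℝ (fderiv ℝ v) x₀
  have h1 := (hF.isLittleO.def hε)
  obtain ⟨ρ, hρ, hb⟩ := Metric.eventually_nhds_iff.1 h1
  refine ⟨ρ, hρ, fun h hh => ?_⟩
  have key : ∀ t : ℝ, HasDerivAt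
      (fun t : ℝ => v (x₀ + t • h) - v x₀ - t * L h - 1 / 2 * (t ^ 2 * S h h))
      (fderiv ℝ v (x₀ + t • h) h - L h - t * S h h) t := by
    intro t
    have e1 : HasDerivAt (fun t : ℝ => x₀ + t • h) h t := by
      simpa using ((hasDerivAt_id t).smul_const h).const_add x₀
    have e2 := (hd (x₀ + t • h)).hasFDerivAt.comp_hasDerivAt t e1
    have e3 : HasDerivAt (fun t : ℝ => t * L h) (L h) t := by
      simpa using (hasDerivAt_id t).mul_const (L h)
    have e4 : HasDerivAt (fun t : ℝ => 1 / 2 * (t ^ 2 * S h h)) (t * S h h) t := by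
      have := (((hasDerivAt_pow 2 t).mul_const (S h h)).const_mul (1 / 2 : ℝ))
      refine this.congr_deriv ?_
      simp; ring
    exact ((e2.sub_const _).sub e3).sub e4
  have := norm_image_sub_le_of_norm_deriv_le_segment_01' (C := ε * ‖h‖ ^ 2)
    (fun t _ => (key t).hasDerivWithinAt) (by
      intro t ht
      have ht0 : 0 ≤ t := ht.1
      have ht1 : t ≤ 1 := ht.2.le
      have hn : ‖t • h‖ ≤ ‖h‖ := by
        rw [norm_smul, Real.norm_of_nonneg ht0]
        exact mul_le_of_le_one_left (norm_nonneg _) ht1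
      have e1 := hb (y := x₀ + t • h) (by simpa using hn.trans_lt hh)
      rw [add_sub_cancel_left] at e1
      have e2 : fderiv ℝ v (x₀ + t • h) h - L h - t * S h h =
        (fderiv ℝ v (x₀ + t • h) - fderiv ℝ v x₀ - S (t • h)) h := by
        simp [L]
      rw [e2]
      refine (ContinuousLinearMap.le_opNorm _ _).trans ?_
      calc _ ≤ (ε * ‖t • h‖) * ‖h‖ := by gcongr
        _ ≤ (ε * ‖h‖) * ‖h‖ := by gcongr
        _ = _ := by ring)
  simpa using this

section
variable (L : (ℂ × ℂ) →L[ℝ] ℝ) (S : (ℂ × ℂ) →L[ℝ] (ℂ × ℂ) →L[ℝ] ℝ)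

theorem pair_expand (h : ℂ × ℂ) : h = h.1.re • ((1, 0) : ℂ × ℂ) + h.1.im • ((Complex.I, 0) : ℂ × ℂ)
    + h.2.re • ((0, 1) : ℂ × ℂ) + h.2.im • ((0, Complex.I) : ℂ × ℂ) := by
  ext <;> simp

/-- Levi form -/
def levi (h : ℂ × ℂ) : ℝ := (S h h + S (Complex.I • h) (Complex.I • h)) / 4

theorem levi_smul (t : ℂ) (h : ℂ × ℂ) : levi S (t • h) = Complex.normSq t * levi S h := by
  have e1 : t • h = t.re • h + t.im • (Complex.I • h) := by
    ext1 <;> apply Complex.ext <;> simp <;> ring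
  have e2 : Complex.I • t • h = t.re • (Complex.I • h) + (-t.im) • h := by
    ext1 <;> apply Complex.ext <;> simp <;> ring
  unfold levi
  rw [e2, e1]
  simp only [map_add, map_smul, add_apply, smul_apply,
    smul_eq_mul, Complex.normSq_apply]
  ring

theorem quad_decomp : ∃ l₁ l₂ q₁ q₂ q₃ : ℂ, ∀ h : ℂ × ℂ, L h + 1 / 2 * S h h =
    (l₁ * h.1 + l₂ * h.2 + (q₁ * h.1 ^ 2 + q₂ * h.1 * h.2 + q₃ * h.2 ^ 2)).re + levi S h := by
  let b : ℂ × ℂ → ℂ × ℂ → ℂ := fun h k => (1 / 4 : ℂ) *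
    ⟨S h k - S (Complex.I • h) (Complex.I • k), -(S h (Complex.I • k) + S (Complex.I • h) k)⟩
  refine ⟨⟨L (1, 0), -L (Complex.I, 0)⟩, ⟨L (0, 1), -L (0, Complex.I)⟩, b (1, 0) (1, 0),
    b (1, 0) (0, 1) + b (0, 1) (1, 0), b (0, 1) (0, 1), fun h => ?_⟩
  have e1 : Complex.I • h = (-h.1.im) • ((1, 0) : ℂ × ℂ) + h.1.re • ((Complex.I, 0) : ℂ × ℂ)
    + (-h.2.im) • ((0, 1) : ℂ × ℂ) + h.2.re • ((0, Complex.I) : ℂ × ℂ) := by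
    ext1 <;> apply Complex.ext <;> simp <;> ring
  have e2 : Complex.I • ((1, 0) : ℂ × ℂ) = (Complex.I, 0) := by ext <;> simp
  have e3 : Complex.I • ((0, 1) : ℂ × ℂ) = (0, Complex.I) := by ext <;> simp
  simp only [b, levi, e2, e3]
  rw [e1]
  have e4 := pair_expand h
  generalize ((1, 0) : ℂ × ℂ) = a1 at *
  generalize ((Complex.I, 0) : ℂ × ℂ) = a2 at *
  generalize ((0, 1) : ℂ × ℂ) = a3 at *
  generalize ((0, Complex.I) : ℂ × ℂ) = a4 at *
  have e5 : L h = L (h.1.re • a1 + h.1.im • a2 + h.2.re • a3 + h.2.im • a4) := by rw [← e4]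
  have e6 : S h h = S (h.1.re • a1 + h.1.im • a2 + h.2.re • a3 + h.2.im • a4)
      (h.1.re • a1 + h.1.im • a2 + h.2.re • a3 + h.2.im • a4) := by rw [← e4]
  rw [e5, e6]
  simp only [map_add, map_smul, add_apply, smul_apply,
    smul_eq_mul, Complex.add_re, Complex.mul_re, Complex.mul_im, Complex.add_im, pow_two]
  have e7 : ((1 / 4 : ℂ)).re = 1 / 4 := by norm_num
  have e8 : ((1 / 4 : ℂ)).im = 0 := by norm_num
  rw [e7, e8]
  ring
end

/-- circle submean inequality on all complex discs -/
def CSub (v : ℂ × ℂ → ℝ) : Prop :=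
  ∀ x h : ℂ × ℂ, v x ≤ Real.circleAverage (fun t : ℂ => v (x + t • h)) 0 1

theorem circleAverage_re_entire {G : ℂ → ℂ} (hG : Differentiable ℂ G) (R : ℝ) :
    Real.circleAverage (fun t => (G t).re) 0 R = (G 0).re := by
  have h1 : Real.circleAverage G 0 R = G 0 := (hG.diffContOnCl).circleAverage
  have h2 := Complex.reCLM.circleAverage_comp_comm (f := G) (c := 0) (R := R)
    (hG.continuous.continuousOn.circleIntegrable')
  rw [h1] at h2
  exact h2

theorem strictTaylor_of_CSub {v : ℂ × ℂ → ℝ} (hv : ContDiff ℝ 2 v) (hs : CSub v) {δ : ℝ}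
    (hδ : 0 < δ) :
    StrictTaylor (fun x => v x + δ * (Complex.normSq x.1 + Complex.normSq x.2)) := by
  intro x₀
  set L := fderiv ℝ v x₀
  set S := fderiv ℝ (fderiv ℝ v) x₀
  obtain ⟨l₁, l₂, q₁, q₂, q₃, hq⟩ := quad_decomp L S
  obtain ⟨ρ, hρ, hT⟩ := taylor_two hv x₀ (ε := δ / 4) (by positivity)
  refine ⟨l₁ + 2 * δ * conj x₀.1, l₂ + 2 * δ * conj x₀.2, q₁, q₂, q₃, δ / 2, ρ, by positivity, hρ, ?_⟩
  intro h hh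
  have hlev : -(δ / 4 * ‖h‖ ^ 2) ≤ levi S h := by
    set G : ℂ → ℂ := fun t => ((v x₀ + levi S h + δ / 4 * ‖h‖ ^ 2 : ℝ) : ℂ) +
      (t * (l₁ * h.1 + l₂ * h.2) + t ^ 2 * (q₁ * h.1 ^ 2 + q₂ * h.1 * h.2 + q₃ * h.2 ^ 2)) with hG
    have hGd : Differentiable ℂ G := by simp only [hG]; fun_prop
    have e1 := circleAverage_re_entire hGd 1
    have e2 : Real.circleAverage (fun t : ℂ => v (x₀ + t • h)) 0 1 ≤
        Real.circleAverage (fun t => (G t).re) 0 1 := by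
      have hvc := hv.continuous
      have hGc := hGd.continuous
      refine Real.circleAverage_mono ?_ ?_ ?_
      · exact (by fun_prop : Continuous fun t : ℂ => v (x₀ + t • h)).continuousOn.circleIntegrable'
      · exact (by fun_prop : Continuous fun t : ℂ => (G t).re).continuousOn.circleIntegrable'
      · intro t ht
        have ht1 : ‖t‖ = 1 := by simpa using ht
        have e3 := hT (t • h) (by rw [norm_smul, ht1, one_mul]; exact hh)
        rw [norm_smul, ht1, one_mul] at e3
        have e4 := (abs_le.1 e3).2
        have e5 := hq (t • h)
        rw [levi_smul, Complex.normSq_eq_norm_sq, ht1, one_pow, one_mul] at e5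
        have e6 : (G t).re = v x₀ + levi S h + δ / 4 * ‖h‖ ^ 2 + (l₁ * (t • h).1 + l₂ * (t • h).2 +
          (q₁ * (t • h).1 ^ 2 + q₂ * (t • h).1 * (t • h).2 + q₃ * (t • h).2 ^ 2)).re := by
          simp only [hG]
          rw [Complex.add_re, Complex.ofReal_re]
          congr 2
          simp only [Prod.smul_fst, Prod.smul_snd, smul_eq_mul]
          ring
        rw [e6]
        linarith
    have e3 := (hs x₀ h).trans e2
    rw [e1] at e3
    have e4 : (G 0).re = v x₀ + levi S h + δ / 4 * ‖h‖ ^ 2 := by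
      simp only [hG]
      rw [Complex.add_re, Complex.ofReal_re]; simp
    linarith
  have e1 := (abs_le.1 (hT h hh)).1
  have e2 := hq h
  have e3 := norm_sq_le_normSq h
  have e4 : (l₁ + 2 * δ * conj x₀.1) * h.1 + (l₂ + 2 * δ * conj x₀.2) * h.2 +
      (q₁ * h.1 ^ 2 + q₂ * h.1 * h.2 + q₃ * h.2 ^ 2) = (l₁ * h.1 + l₂ * h.2 +
      (q₁ * h.1 ^ 2 + q₂ * h.1 * h.2 + q₃ * h.2 ^ 2)) +
      ((2 * δ : ℝ) : ℂ) * (conj x₀.1 * h.1 + conj x₀.2 * h.2) := by push_cast; ring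
  have e5 : Complex.normSq (x₀ + h).1 + Complex.normSq (x₀ + h).2 =
      Complex.normSq x₀.1 + Complex.normSq x₀.2 + 2 * (conj x₀.1 * h.1 + conj x₀.2 * h.2).re +
      (Complex.normSq h.1 + Complex.normSq h.2) := by
    simp only [Prod.fst_add, Prod.snd_add, Complex.normSq_apply, Complex.add_re,
        Complex.mul_re, Complex.conj_re, Complex.conj_im, Complex.add_im]
    ring
  simp only
  rw [e4, e5, Complex.add_re, Complex.re_ofReal_mul]
  have e6 : δ / 2 * ‖h‖ ^ 2 ≤ δ / 2 * (Complex.normSq h.1 + Complex.normSq h.2) := by gcongr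
  linarith

theorem CSub.add_re {v : ℂ × ℂ → ℝ} (hvc : Continuous v) (hs : CSub v) {F : ℂ × ℂ → ℂ}
    (hF : Differentiable ℂ F) : CSub (fun x => v x + (F x).re) := by
  intro x h
  have hG : Differentiable ℂ (fun t : ℂ => F (x + t • h)) := by fun_prop
  have e1 := circleAverage_re_entire hG 1
  have hFc := hF.continuous
  rw [Real.circleAverage_fun_add
    ((by fun_prop : Continuous fun t : ℂ => v (x + t • h)).continuousOn.circleIntegrable')
    ((by fun_prop : Continuous fun t : ℂ => (F (x + t • h)).re).continuousOn.circleIntegrable'), e1]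
  have := hs x h
  simp only [zero_smul, add_zero]
  linarith

end PartB2

section PartCFA

open Filter Topology ComplexConjugate
set_option linter.unusedSectionVars false

section
variable {A : Type*} [NormedCommRing A] [NormedAlgebra ℂ A] [CompleteSpace A]

theorem cfa_tendsto {x : A} (hx : ‖x‖ < 1) :
    Tendsto (fun k : ℕ => (-x) ^ k) atTop (𝓝 0) := by
  exact tendsto_pow_atTop_nhds_zero_of_norm_lt_one (by simpa using hx)

theorem cfa_tendsto' {x : A} (hx : ‖x‖ < 1) :
    Tendsto (fun k : ℕ => (k : A) * (-x) ^ (k - 1)) atTop (𝓝 0) := by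
  rw [← tendsto_add_atTop_iff_nat 2]
  have h1 : Tendsto (fun k : ℕ => (k : ℝ) * ‖x‖ ^ k) atTop (𝓝 0) :=
    tendsto_self_mul_const_pow_of_lt_one (norm_nonneg _) hx
  have h1' := (tendsto_add_atTop_iff_nat 1).2 h1
  have h2 : Tendsto (fun k : ℕ => ‖x‖ ^ (k + 1)) atTop (𝓝 0) :=
    (tendsto_add_atTop_iff_nat 1).2 (tendsto_pow_atTop_nhds_zero_of_lt_one (norm_nonneg _) hx)
  have h3 := (h1'.add h2)
  rw [add_zero] at h3
  refine squeeze_zero_norm (fun k => ?_) h3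
  have e1 : ((k + 2 : ℕ) : A) * (-x) ^ (k + 2 - 1) = ((k + 2 : ℕ) : ℝ) • (-x) ^ (k + 1) := by
    rw [show ((k + 2 : ℕ) : ℝ) • (-x) ^ (k + 1) = (k + 2 : ℕ) • (-x) ^ (k + 1) from
      Nat.cast_smul_eq_nsmul ℝ _ _, nsmul_eq_mul]
    rfl
  have : ‖((k + 2 : ℕ) : A) * (-x) ^ (k + 2 - 1)‖ ≤ ((k + 2 : ℕ) : ℝ) * ‖x‖ ^ (k + 1) := by
    rw [e1]
    refine (norm_smul_le _ _).trans ?_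
    gcongr
    · exact (Real.norm_of_nonneg (Nat.cast_nonneg _)).le
    · refine (norm_pow_le' _ (by omega)).trans ?_
      simp
  refine this.trans (le_of_eq ?_)
  push_cast
  ring

theorem cfa_value {Z W : A} {η w κ c₁ c₂ : ℂ} (L : A →L[ℂ] ℂ)
    (hL : ∀ a, L ((Z - algebraMap ℂ A η) * a) = 0)
    (hQ : ∀ Q : MM, L (ev Z W (MvPolynomial.pderiv 1 Q)) = κ * (ev η c₁ Q - ev η c₂ Q))
    (hn₁ : ∀ Q : MM, ‖ev η c₁ Q‖ ≤ ‖ev Z W Q‖) (hn₂ : ∀ Q : MM, ‖ev η c₂ Q‖ ≤ ‖ev Z W Q‖)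
    {P : MM} (h : ‖ev Z W P‖ < ‖ev η w P‖) :
    ∃ R : A, Res Z W η w R ∧ L (R * R) = κ * ((w - c₁)⁻¹ - (w - c₂)⁻¹) := by
  obtain ⟨Q, D, e, hid, he⟩ := exists_res_poly h
  have hv := Ring.mul_inverse_cancel _ (isUnit_one_add_of_norm he)
  refine ⟨_, res_of_poly hid he, ?_⟩
  set v := Ring.inverse (1 + ev Z W e) with hvdef
  set d : MM → MM := fun x => (MvPolynomial.pderiv (R := ℂ) (σ := Fin 2) 1) x with hd
  have hdm : ∀ x y : MM, d (x * y) = d x * y + x * d y := by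
    intro x y; simp only [hd, Derivation.leibniz, smul_eq_mul]; ring
  have hda : ∀ x y : MM, d (x + y) = d x + d y := fun x y => by simp [hd]
  have hds : ∀ x y : MM, d (x - y) = d x - d y := fun x y => by simp [hd]
  have hd1 : d 1 = 0 := by simp [hd]
  have hid' : Q + (MvPolynomial.X 1 - MvPolynomial.C w) * d Q =
      (MvPolynomial.X 0 - MvPolynomial.C η) * d D + d e := by
    have := congrArg d hid
    have a1 : d (MvPolynomial.X 1 - MvPolynomial.C w) = 1 := by simp [hd]
    have a2 : d (MvPolynomial.X 0 - MvPolynomial.C η) = 0 := by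
      simp [hd, MvPolynomial.pderiv_X]
    rw [hdm, hda, hda, hdm, a1, a2, hd1] at this
    linear_combination this
  have i1 := congrArg (ev Z W) hid
  have i2 := congrArg (ev Z W) hid'
  simp only [map_add, map_mul, map_sub, ev_X0, ev_X1, ev_C, map_one] at i1 i2
  set E := ev Z W with hE
  set ψ := E (d Q) * v - E Q * E (d e) * v ^ 2 with hψ
  have hR : E Q * v * (E Q * v) = (Z - algebraMap ℂ A η) * (v ^ 2 * (E Q * E (d D) - E D * E (d Q)))
      - ψ := by
    rw [hψ]
    linear_combination v ^ 2 * (E Q) * i2 - v ^ 2 * E (d Q) * i1 - E (d Q) * v * hv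
  have hLR : L (E Q * v * (E Q * v)) = - L ψ := by
    rw [hR, map_sub, hL, zero_sub]
  rw [hLR]
  -- the approximations
  set S : ℕ → MM := fun k => ∑ j ∈ Finset.range k, (-e) ^ j with hS
  have hSk : ∀ k, (1 + e) * S k = 1 - (-e) ^ k := by
    intro k
    have := mul_neg_geom_sum (-e) k
    rw [← this]; simp only [hS]; ring
  have hdpow : ∀ k : ℕ, d ((-e) ^ k) = -((k : MM) * (-e) ^ (k - 1) * d e) := by
    intro k
    simp only [hd, Derivation.leibniz_pow, map_neg, smul_eq_mul, nsmul_eq_mul]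
    ring
  have hSk' : ∀ k : ℕ, d e * S k + (1 + e) * d (S k) = (k : MM) * (-e) ^ (k - 1) * d e := by
    intro k
    have := congrArg d (hSk k)
    rw [hdm, hda, hds, hd1, hdpow] at this
    linear_combination this
  have j1 : ∀ k, E (S k) = v * (1 - (-E e) ^ k) := by
    intro k
    have := congrArg E (hSk k)
    simp only [map_add, map_mul, map_sub, map_one, map_pow, map_neg] at this
    linear_combination v * this - E (S k) * hv
  have j2 : ∀ k : ℕ, E (d (S k)) = v * ((k : A) * (-E e) ^ (k - 1) * E (d e) - E (d e) * E (S k)) := by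
    intro k
    have := congrArg E (hSk' k)
    simp only [map_add, map_mul, map_sub, map_one, map_pow, map_neg, map_natCast] at this
    linear_combination v * this - E (d (S k)) * hv
  have t1 : Tendsto (fun k => E (S k)) atTop (𝓝 v) := by
    simp only [j1]
    have := (((cfa_tendsto he).const_sub 1).const_mul v)
    simpa using this
  have t2 : Tendsto (fun k => E (d (S k))) atTop (𝓝 (v * (0 * E (d e) - E (d e) * v))) := by
    simp only [j2]
    exact ((((cfa_tendsto' he).mul_const _).sub (t1.const_mul _)).const_mul v)
  have t3 : Tendsto (fun k => E (d (Q * S k))) atTop (𝓝 ψ) := by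
    simp only [hdm, map_add, map_mul]
    have := (t1.const_mul (E (d Q))).add (t2.const_mul (E Q))
    convert this using 2
    rw [hψ]; ring
  have t4 : Tendsto (fun k => L (E (d (Q * S k)))) atTop (𝓝 (L ψ)) :=
    (L.continuous.tendsto _).comp t3
  have val : ∀ c : ℂ, (∀ Q : MM, ‖ev η c Q‖ ≤ ‖ev Z W Q‖) →
      Tendsto (fun k => ev η c (Q * S k)) atTop (𝓝 ((c - w)⁻¹)) := by
    intro c hc
    have hec : ‖ev η c e‖ < 1 := (hc e).trans_lt he
    have k1 := congrArg (ev η c) hid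
    simp only [map_add, map_mul, map_sub, ev_X0, ev_X1, ev_C, map_one, sub_self, zero_mul,
      add_zero, Algebra.algebraMap_self, RingHom.id_apply] at k1
    have hne : (1 : ℂ) + ev η c e ≠ 0 := (isUnit_one_add_of_norm hec).ne_zero
    have hcw : c - w ≠ 0 := by
      intro h0
      rw [h0, zero_mul] at k1
      exact hne k1.symm
    have k2 : ∀ k, ev η c (Q * S k) = (c - w)⁻¹ * (1 - (-ev η c e) ^ k) := by
      intro k
      have k3 := congrArg (ev η c) (hSk k)
      simp only [map_add, map_mul, map_sub, map_one, map_pow, map_neg] at k3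
      rw [map_mul]
      field_simp
      linear_combination k3 + k1 * ev η c (S k)
    simp only [k2]
    have := (((cfa_tendsto hec).const_sub 1).const_mul (c - w)⁻¹)
    simpa using this
  have t5 : Tendsto (fun k => L (E (d (Q * S k)))) atTop (𝓝 (κ * ((c₁ - w)⁻¹ - (c₂ - w)⁻¹))) := by
    have : (fun k => L (E (d (Q * S k)))) = fun k => κ * (ev η c₁ (Q * S k) - ev η c₂ (Q * S k)) := by
      funext k; exact hQ _
    rw [this]
    exact ((val c₁ hn₁).sub (val c₂ hn₂)).const_mul κ
  rw [tendsto_nhds_unique t4 t5, ← neg_sub c₁, ← neg_sub c₂, inv_neg, inv_neg]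
  ring

theorem cfa {Z W : A} {η κ c₁ c₂ : ℂ} (hκ : κ ≠ 0) (L : A →L[ℂ] ℂ)
    (hL : ∀ a, L ((Z - algebraMap ℂ A η) * a) = 0)
    (hQ : ∀ Q : MM, L (ev Z W (MvPolynomial.pderiv 1 Q)) = κ * (ev η c₁ Q - ev η c₂ Q))
    (hn₁ : ∀ Q : MM, ‖ev η c₁ Q‖ ≤ ‖ev Z W Q‖) (hn₂ : ∀ Q : MM, ‖ev η c₂ Q‖ ≤ ‖ev Z W Q‖)
    {s : ℝ} (hs : 0 < s) (hs2 : s < ‖c₂ - c₁‖)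
    (h : ∀ w ∈ sphere c₁ s, ∃ P : MM, ‖ev Z W P‖ < ‖ev η w P‖) : False := by
  classical
  set R : ℂ → A := fun w => if hw : ∃ φ, Res Z W η w φ then hw.choose else 0 with hRdef
  have hR : ∀ w, (∃ φ, Res Z W η w φ) → Res Z W η w (R w) := by
    intro w hw
    simp only [hRdef, dif_pos hw]
    exact hw.choose_spec
  have key : ∀ w ∈ sphere c₁ s, HasDerivAt (fun w => L (R w))
      (κ * ((w - c₁)⁻¹ - (w - c₂)⁻¹)) w := by
    intro w hw
    obtain ⟨P, hP⟩ := h w hw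
    obtain ⟨R', hR', hval⟩ := cfa_value L hL hQ hn₁ hn₂ hP
    have h1 := Res.hasDerivAt R ((res_eventually_exists hR').mono hR) L hL
    refine h1.congr_deriv ?_
    rw [← hval]
    obtain ⟨a, ha⟩ := hR w ⟨_, hR'⟩
    obtain ⟨b, hb⟩ := hR'
    have e1 : R w - R' = (Z - algebraMap ℂ A η) * (a * R' - b * R w) := by
      linear_combination R' * ha - R w * hb
    have e2 : R w * R w = R' * R' + (Z - algebraMap ℂ A η) * ((a * R' - b * R w) * (R w + R')) := by
      linear_combination (R w + R') * e1
    rw [e2, map_add, hL, add_zero]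
  have h0 := circleIntegral.integral_eq_zero_of_hasDerivWithinAt hs.le
    (fun w hw => (key w hw).hasDerivWithinAt)
  have n1 : ∀ w ∈ sphere c₁ s, w - c₁ ≠ 0 := by
    intro w hw h
    rw [mem_sphere_iff_norm, h, norm_zero] at hw
    exact hs.ne hw
  have n2 : ∀ w ∈ closedBall c₁ s, w - c₂ ≠ 0 := by
    intro w hw h
    rw [sub_eq_zero] at h
    rw [mem_closedBall_iff_norm, h] at hw
    linarith
  have h1 : (∮ w in C(c₁, s), (w - c₂)⁻¹) = 0 := by
    refine Complex.circleIntegral_eq_zero_of_differentiable_on_off_countable hs.le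
      countable_empty ?_ ?_
    · exact ContinuousOn.inv₀ (by fun_prop) n2
    · intro z hz
      have := n2 z (ball_subset_closedBall hz.1)
      fun_prop (disch := assumption)
  have h2 : (∮ w in C(c₁, s), (w - c₁)⁻¹) = 2 * Real.pi * Complex.I :=
    circleIntegral.integral_sub_center_inv c₁ hs.ne'
  rw [circleIntegral.integral_const_mul, circleIntegral.integral_sub, h1, h2] at h0
  · simp [hκ, Real.pi_ne_zero] at h0
  · exact ContinuousOn.circleIntegrable hs.le (ContinuousOn.inv₀ (by fun_prop) n1)
  · exact ContinuousOn.circleIntegrable hs.le (ContinuousOn.inv₀ (by fun_prop)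
      fun w hw => n2 w (sphere_subset_closedBall hw))
end

end PartCFA

section PartPomp

open Filter Topology ComplexConjugate MeasureTheory
set_option linter.unusedSectionVars false

/-- (twice) the Cauchy-Riemann operator -/
def dbar (G : ℂ → ℂ) (z : ℂ) : ℂ := fderiv ℝ G z 1 + Complex.I * fderiv ℝ G z Complex.I

theorem dbar_mul {F G : ℂ → ℂ} {z : ℂ} (hF : DifferentiableAt ℝ F z) (hG : DifferentiableAt ℝ G z) :
    dbar (fun z => F z * G z) z = F z * dbar G z + G z * dbar F z := by
  unfold dbar
  rw [fderiv_fun_mul hF hG]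
  simp only [add_apply, smul_apply, smul_eq_mul]
  ring

theorem dbar_add {F G : ℂ → ℂ} {z : ℂ} (hF : DifferentiableAt ℝ F z) (hG : DifferentiableAt ℝ G z) :
    dbar (fun z => F z + G z) z = dbar F z + dbar G z := by
  unfold dbar
  rw [fderiv_fun_add hF hG]
  simp only [add_apply]
  ring

theorem dbar_sub {F G : ℂ → ℂ} {z : ℂ} (hF : DifferentiableAt ℝ F z) (hG : DifferentiableAt ℝ G z) :
    dbar (fun z => F z - G z) z = dbar F z - dbar G z := by
  unfold dbar
  rw [fderiv_fun_sub hF hG]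
  simp only [sub_apply]
  ring

theorem continuous_dbar {G : ℂ → ℂ} (hG : ContDiff ℝ 1 G) : Continuous (dbar G) := by
  have := hG.continuous_fderiv (by norm_num)
  unfold dbar
  fun_prop

theorem dbar_hasCompactSupport {G : ℂ → ℂ} (h : HasCompactSupport G) :
    HasCompactSupport (dbar G) := by
  have h1 := h.fderiv_apply (𝕜 := ℝ) 1
  have h2 := h.fderiv_apply (𝕜 := ℝ) Complex.I
  exact h1.add (h2.mul_left (f := fun _ => Complex.I))

theorem integral_fderiv_zero {G : ℂ → ℂ} (hG : ContDiff ℝ 1 G) (h : HasCompactSupport G) (v : ℂ) :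
    ∫ z, fderiv ℝ G z v = 0 := by
  have hc : Continuous fun z => fderiv ℝ G z v := by
    have := hG.continuous_fderiv (by norm_num)
    fun_prop
  have := integral_mul_fderiv_eq_neg_fderiv_mul_of_integrable (μ := (volume : Measure ℂ))
    (f := fun _ : ℂ => (1 : ℂ)) (g := G) (v := v) (by simp)
    (by simpa using hc.integrable_of_hasCompactSupport (h.fderiv_apply (𝕜 := ℝ) v))
    (by simpa using hG.continuous.integrable_of_hasCompactSupport h)
    (by simp) (fun x _ => hG.differentiable (by norm_num) x)
  simpa using this

theorem integral_dbar_zero {G : ℂ → ℂ} (hG : ContDiff ℝ 1 G) (h : HasCompactSupport G) :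
    ∫ z, dbar G z = 0 := by
  have hc : ∀ v, Continuous fun z => fderiv ℝ G z v := by
    intro v
    have := hG.continuous_fderiv (by norm_num)
    fun_prop
  unfold dbar
  rw [integral_add, integral_const_mul, integral_fderiv_zero hG h, integral_fderiv_zero hG h]
  · simp
  · exact (hc 1).integrable_of_hasCompactSupport (h.fderiv_apply (𝕜 := ℝ) 1)
  · exact ((hc Complex.I).integrable_of_hasCompactSupport (h.fderiv_apply (𝕜 := ℝ) Complex.I)).const_mul _

theorem locallyIntegrable_inv : LocallyIntegrable (fun z : ℂ => z⁻¹) := by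
  refine locallyIntegrable_of_norm_le_rpow (C := 1) (α := 1) (by simp) (by simp) ?_ ?_
  · refine Eventually.of_forall fun z => ?_
    rw [norm_inv, one_mul, Real.rpow_neg_one]
  · exact measurable_inv.aestronglyMeasurable

/-- regularized Cauchy kernel -/
def kreg (ε : ℝ) (z : ℂ) : ℂ := conj z * (z * conj z + ε)⁻¹

theorem kreg_den {ε : ℝ} (hε : 0 < ε) (z : ℂ) : z * conj z + (ε : ℂ) = ((‖z‖ ^ 2 + ε : ℝ) : ℂ) := by
  rw [Complex.mul_conj, Complex.normSq_eq_norm_sq]; push_cast; rfl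

theorem kreg_den_ne {ε : ℝ} (hε : 0 < ε) (z : ℂ) : z * conj z + (ε : ℂ) ≠ 0 := by
  rw [kreg_den hε]
  have : 0 < ‖z‖ ^ 2 + ε := by positivity
  exact_mod_cast this.ne'

theorem contDiff_kreg {ε : ℝ} (hε : 0 < ε) : ContDiff ℝ 1 (kreg ε) := by
  unfold kreg
  have hc : ContDiff ℝ 1 (fun z : ℂ => conj z) := Complex.conjCLE.contDiff
  exact hc.mul (((contDiff_id.mul hc).add contDiff_const).inv (kreg_den_ne hε))

theorem dbar_kreg {ε : ℝ} (hε : 0 < ε) (z : ℂ) :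
    dbar (kreg ε) z = 2 * ε * ((z * conj z + ε)⁻¹) ^ 2 := by
  have hcd : ContDiff ℝ 1 (fun z : ℂ => conj z) := Complex.conjCLE.contDiff
  have hc : HasFDerivAt (fun z : ℂ => conj z) (Complex.conjCLE : ℂ →L[ℝ] ℂ) z :=
    Complex.conjCLE.hasFDerivAt
  have hne := kreg_den_ne hε z
  have h1 : dbar (fun z : ℂ => conj z) z = 2 := by
    unfold dbar
    rw [hc.fderiv]
    simp
    norm_num
  have h2 : dbar (fun z : ℂ => z) z = 0 := by
    unfold dbar
    simp
  have h3 : dbar (fun z : ℂ => z * conj z + (ε : ℂ)) z = 2 * z := by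
    have hd : DifferentiableAt ℝ (fun z : ℂ => z * conj z) z :=
      differentiableAt_fun_id.mul hc.differentiableAt
    rw [dbar_add hd (differentiableAt_const _),
      dbar_mul differentiableAt_fun_id hc.differentiableAt, h1, h2]
    simp [dbar]
    ring
  have h4 := dbar_mul (((contDiff_kreg hε).differentiable (by norm_num)) z)
    ((((contDiff_id.mul hcd).add (contDiff_const (c := (ε : ℂ)))).differentiable (by norm_num)) z)
  have h5 : (fun z => kreg ε z * (id z * conj z + (ε : ℂ))) = fun z => conj z := by
    funext z
    simp only [kreg, id]
    rw [mul_assoc, inv_mul_cancel₀ (kreg_den_ne hε z), mul_one]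
  rw [h5, h1] at h4
  simp only [id] at h4
  rw [h3] at h4
  have hi := mul_inv_cancel₀ hne
  have h6 : dbar (kreg ε) z = (2 - kreg ε z * (2 * z)) * (z * conj z + ε)⁻¹ := by
    linear_combination (-(z * conj z + (ε : ℂ))⁻¹) * h4 - dbar (kreg ε) z * hi
  rw [h6, kreg]
  linear_combination (-2 * (z * conj z + (ε : ℂ))⁻¹) * hi

theorem norm_kreg_le {ε : ℝ} (hε : 0 < ε) (z : ℂ) : ‖kreg ε z‖ ≤ ‖z‖⁻¹ := by
  unfold kreg
  rw [kreg_den hε, norm_mul, RCLike.norm_conj, norm_inv, Complex.norm_real,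
    Real.norm_of_nonneg (by positivity)]
  rcases eq_or_ne z 0 with h | h
  · simp [h]
  · have : 0 < ‖z‖ := norm_pos_iff.2 h
    rw [← div_eq_mul_inv, div_le_iff₀ (by positivity), inv_mul_eq_div, le_div_iff₀ this]
    nlinarith

/-- the constant of Pompeiu's formula. -/
def pompC : ℂ := ∫ y : ℂ, ((2 * ((1 + ‖y‖ ^ 2) ^ 2)⁻¹ : ℝ) : ℂ)

theorem integrable_pomp : Integrable (fun y : ℂ => 2 * ((1 + ‖y‖ ^ 2) ^ 2)⁻¹) := by
  have := (integrable_rpow_neg_one_add_norm_sq (E := ℂ) (μ := volume) (r := 4)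
    (by simp; norm_num)).const_mul 2
  refine this.congr (Eventually.of_forall fun y => ?_)
  simp only
  have h : (-4 / 2 : ℝ) = -(2 : ℕ) := by norm_num
  rw [h, Real.rpow_neg (by positivity), Real.rpow_natCast]

theorem pompC_ne : pompC ≠ 0 := by
  unfold pompC
  rw [integral_complex_ofReal]
  have : 0 < ∫ y : ℂ, 2 * ((1 + ‖y‖ ^ 2) ^ 2)⁻¹ := by
    rw [integral_pos_iff_support_of_nonneg (fun y => by positivity) integrable_pomp]
    have : Function.support (fun y : ℂ => 2 * ((1 + ‖y‖ ^ 2) ^ 2)⁻¹) = univ := by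
      ext y
      simp only [Function.mem_support, mem_univ, iff_true]
      positivity
    rw [this]
    simp
  exact_mod_cast this.ne'

theorem pompeiu0 {G : ℂ → ℂ} (hG : ContDiff ℝ 1 G) (h : HasCompactSupport G) :
    ∫ z, z⁻¹ * dbar G z = - (pompC * G 0) := by
  set δ : ℕ → ℝ := fun n => 1 / ((n : ℝ) + 1) with hδ
  have hδ0 : ∀ n, 0 < δ n := fun n => by positivity
  have hδt : Tendsto δ atTop (𝓝 0) := tendsto_one_div_add_atTop_nhds_zero_nat
  have hdc := continuous_dbar hG
  have hIntg : Integrable (fun z : ℂ => z⁻¹ * dbar G z) := by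
    have := locallyIntegrable_inv.integrable_smul_left_of_hasCompactSupport hdc
      (dbar_hasCompactSupport h)
    simpa [mul_comm] using this
  have key : ∀ n, ∫ z, kreg (δ n ^ 2) z * dbar G z =
      -∫ y : ℂ, ((2 * ((1 + ‖y‖ ^ 2) ^ 2)⁻¹ : ℝ) : ℂ) * G (δ n • y) := by
    intro n
    have hε : 0 < δ n ^ 2 := pow_pos (hδ0 n) 2
    have hk := contDiff_kreg hε
    have e1 : ∫ z, dbar (fun z => kreg (δ n ^ 2) z * G z) z = 0 :=
      integral_dbar_zero (hk.mul hG) (h.mul_left (f := kreg (δ n ^ 2)))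
    have e2 : ∀ z, dbar (fun z => kreg (δ n ^ 2) z * G z) z = kreg (δ n ^ 2) z * dbar G z +
        G z * dbar (kreg (δ n ^ 2)) z := fun z =>
      dbar_mul (hk.differentiable (by norm_num) z) (hG.differentiable (by norm_num) z)
    simp only [e2] at e1
    rw [integral_add] at e1
    · have e3 : ∫ z, G z * dbar (kreg (δ n ^ 2)) z =
          ∫ y : ℂ, ((2 * ((1 + ‖y‖ ^ 2) ^ 2)⁻¹ : ℝ) : ℂ) * G (δ n • y) := by
        have e4 := Measure.integral_comp_smul (volume : Measure ℂ)
          (fun z => G z * dbar (kreg (δ n ^ 2)) z) (δ n)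
        have e5 : ∀ y : ℂ, G (δ n • y) * dbar (kreg (δ n ^ 2)) (δ n • y) =
          ((δ n ^ 2)⁻¹ : ℝ) • (((2 * ((1 + ‖y‖ ^ 2) ^ 2)⁻¹ : ℝ) : ℂ) * G (δ n • y)) := by
          intro y
          rw [dbar_kreg hε, kreg_den hε, norm_smul, Real.norm_of_nonneg (hδ0 n).le]
          have : (δ n * ‖y‖) ^ 2 + δ n ^ 2 = δ n ^ 2 * (1 + ‖y‖ ^ 2) := by ring
          rw [this]
          simp only [Complex.real_smul]
          have h1 : ((1 + ‖y‖ ^ 2 : ℝ) : ℂ) ≠ 0 := by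
            have : 0 < 1 + ‖y‖ ^ 2 := by positivity
            exact_mod_cast this.ne'
          have h2 : ((δ n : ℝ) : ℂ) ≠ 0 := by exact_mod_cast (hδ0 n).ne'
          push_cast at h1 ⊢
          field_simp
        simp only [e5] at e4
        rw [integral_smul] at e4
        simp only [Complex.finrank_real_complex] at e4
        rw [abs_of_pos (by positivity)] at e4
        exact ((smul_right_injective ℂ (inv_ne_zero hε.ne')) e4).symm
      rw [← e3]
      exact eq_neg_of_add_eq_zero_left e1
    · exact (hk.continuous.mul hdc).integrable_of_hasCompactSupport
        ((dbar_hasCompactSupport h).mul_left (f := kreg (δ n ^ 2)))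
    · exact (hG.continuous.mul (continuous_dbar hk)).integrable_of_hasCompactSupport
        (h.mul_right (f' := dbar (kreg (δ n ^ 2))))
  have t1 : Tendsto (fun n => ∫ z, kreg (δ n ^ 2) z * dbar G z) atTop
      (𝓝 (∫ z, z⁻¹ * dbar G z)) := by
    refine tendsto_integral_of_dominated_convergence (fun z => ‖z⁻¹ * dbar G z‖) ?_ hIntg.norm ?_ ?_
    · intro n
      exact ((contDiff_kreg (pow_pos (hδ0 n) 2)).continuous.mul hdc).aestronglyMeasurable
    · intro n
      refine Eventually.of_forall fun z => ?_
      rw [norm_mul, norm_mul, norm_inv]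
      gcongr
      exact norm_kreg_le (pow_pos (hδ0 n) 2) z
    · refine Eventually.of_forall fun z => ?_
      refine Tendsto.mul_const _ ?_
      rcases eq_or_ne z 0 with h0 | h0
      · simp [kreg, h0]
      · have hz : z * conj z ≠ 0 := mul_ne_zero h0 (by simpa using h0)
        have : z⁻¹ = conj z * (z * conj z + ((0 : ℝ) : ℂ))⁻¹ := by
          have : conj z ≠ 0 := by simpa using h0
          rw [Complex.ofReal_zero, add_zero]
          field_simp
        rw [this]
        refine Tendsto.const_mul _ (Tendsto.inv₀ (Tendsto.const_add _ ?_) (by simpa using h0))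
        have := hδt.pow 2
        simp only [ne_eq, OfNat.ofNat_ne_zero, not_false_eq_true, zero_pow] at this
        exact (Complex.continuous_ofReal.tendsto _).comp this
  obtain ⟨C, hC⟩ := h.exists_bound_of_continuous hG.continuous
  have t2 : Tendsto (fun n => -∫ y : ℂ, ((2 * ((1 + ‖y‖ ^ 2) ^ 2)⁻¹ : ℝ) : ℂ) * G (δ n • y)) atTop
      (𝓝 (-(∫ y : ℂ, ((2 * ((1 + ‖y‖ ^ 2) ^ 2)⁻¹ : ℝ) : ℂ) * G 0))) := by
    refine Tendsto.neg ?_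
    refine tendsto_integral_of_dominated_convergence (fun y : ℂ => 2 * ((1 + ‖y‖ ^ 2) ^ 2)⁻¹ * C)
      ?_ (integrable_pomp.mul_const C) ?_ ?_
    · intro n
      refine AEStronglyMeasurable.mul integrable_pomp.ofReal.aestronglyMeasurable ?_
      have := hG.continuous
      exact (by fun_prop : Continuous fun y : ℂ => G (δ n • y)).aestronglyMeasurable
    · intro n
      refine Eventually.of_forall fun y => ?_
      rw [norm_mul, Complex.norm_real, Real.norm_of_nonneg (by positivity)]
      gcongr
      exact hC _
    · refine Eventually.of_forall fun y => ?_
      refine Tendsto.const_mul _ ?_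
      have : Tendsto (fun n => δ n • y) atTop (𝓝 0) := by
        simpa using hδt.smul_const y
      exact (hG.continuous.tendsto 0).comp this
  simp only [key] at t1
  have := tendsto_nhds_unique t1 t2
  rw [this, integral_mul_const]
  rfl

theorem pompeiu {G : ℂ → ℂ} (hG : ContDiff ℝ 1 G) (h : HasCompactSupport G) (z₁ : ℂ) :
    ∫ z, (z - z₁)⁻¹ * dbar G z = - (pompC * G z₁) := by
  have e1 : ContDiff ℝ 1 (fun z => G (z + z₁)) := hG.comp (contDiff_id.add contDiff_const)
  have e2 : HasCompactSupport (fun z => G (z + z₁)) :=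
    h.comp_homeomorph (Homeomorph.addRight z₁)
  have e3 := pompeiu0 e1 e2
  rw [zero_add] at e3
  rw [← e3, ← integral_add_right_eq_self (fun z => (z - z₁)⁻¹ * dbar G z) z₁]
  congr 1
  funext z
  unfold dbar
  rw [fderiv_comp_add_right]
  simp

end PartPomp

section PartLA

open Filter Topology ComplexConjugate MeasureTheory
set_option linter.unusedSectionVars false

theorem exists_intCLM {X Y : Type*} [TopologicalSpace X] [CompactSpace X] [MeasurableSpace X]
    [BorelSpace X] [TopologicalSpace Y] [CompactSpace Y] (μ : Measure X) {k : X → ℂ}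
    (hk : Integrable k μ) (γ : C(X, Y)) :
    ∃ L : C(Y, ℂ) →L[ℂ] ℂ, ∀ φ, L φ = ∫ x, k x * φ (γ x) ∂μ := by
  have hi : ∀ φ : C(Y, ℂ), Integrable (fun x => k x * φ (γ x)) μ := by
    intro φ
    refine hk.mul_bdd (c := ‖φ‖) (φ.comp γ).continuous.aestronglyMeasurable
      (Eventually.of_forall fun x => φ.norm_coe_le_norm _)
  refine ⟨LinearMap.mkContinuous
    { toFun := fun φ => ∫ x, k x * φ (γ x) ∂μ
      map_add' := ?_
      map_smul' := ?_ } (∫ x, ‖k x‖ ∂μ) ?_, fun φ => rfl⟩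
  · intro φ ψ
    rw [← integral_add (hi φ) (hi ψ)]
    congr 1
    funext x
    simp [mul_add]
  · intro c φ
    rw [RingHom.id_apply, smul_eq_mul, ← integral_const_mul]
    congr 1
    funext x
    simp
    ring
  · intro φ
    change ‖∫ x, k x * φ (γ x) ∂μ‖ ≤ _
    rw [← integral_mul_const]
    refine norm_integral_le_of_norm_le (hk.norm.mul_const _) (Eventually.of_forall fun x => ?_)
    rw [norm_mul]
    gcongr
    exact φ.norm_coe_le_norm _

theorem contDiff_evh {h : ℂ → ℂ} (hh : ContDiff ℝ 1 h) (Q : MM) :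
    ContDiff ℝ 1 (fun z => ev z (h z) Q) ∧
    ∀ z, dbar (fun z => ev z (h z) Q) z = ev z (h z) (MvPolynomial.pderiv 1 Q) * dbar h z := by
  induction Q using MvPolynomial.induction_on with
  | C a =>
    simp only [ev_C, MvPolynomial.pderiv_C, map_zero, zero_mul]
    exact ⟨contDiff_const, fun z => by simp [dbar]⟩
  | add p q hp hq =>
    simp only [map_add]
    refine ⟨hp.1.add hq.1, fun z => ?_⟩
    rw [dbar_add (hp.1.differentiable (by norm_num) z) (hq.1.differentiable (by norm_num) z),
      hp.2, hq.2]
    ring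
  | mul_X p i hp =>
    have hX : ContDiff ℝ 1 (fun z => ev z (h z) (MvPolynomial.X i)) ∧
        ∀ z, dbar (fun z => ev z (h z) (MvPolynomial.X i)) z =
          ev z (h z) (MvPolynomial.pderiv 1 (MvPolynomial.X i)) * dbar h z := by
      fin_cases i
      · simp only [Fin.zero_eta, ev_X0]
        refine ⟨contDiff_id, fun z => ?_⟩
        rw [MvPolynomial.pderiv_X_of_ne (by decide)]
        simp [dbar]
      · simp only [Fin.mk_one, ev_X1]
        refine ⟨hh, fun z => ?_⟩
        simp
    simp only [map_mul]
    refine ⟨hp.1.mul hX.1, fun z => ?_⟩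
    rw [dbar_mul (hp.1.differentiable (by norm_num) z) (hX.1.differentiable (by norm_num) z),
      hp.2, hX.2, Derivation.leibniz]
    simp only [map_add, smul_eq_mul, map_mul]
    ring

theorem exists_pderiv (P : MM) : ∃ Q : MM, MvPolynomial.pderiv 1 Q = P := by
  induction P using MvPolynomial.induction_on' with
  | add p q hp hq =>
    obtain ⟨a, rfl⟩ := hp
    obtain ⟨b, rfl⟩ := hq
    exact ⟨a + b, by simp⟩
  | monomial u a =>
    refine ⟨MvPolynomial.monomial (u + Finsupp.single 1 1) (a * ((u 1 : ℂ) + 1)⁻¹), ?_⟩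
    rw [MvPolynomial.pderiv_monomial]
    have h : ((u 1 : ℂ) + 1) ≠ 0 := by exact_mod_cast Nat.succ_ne_zero (u 1)
    congr 1
    · simp
    · simp
      field_simp

theorem locInt_inv_sub (z₁ : ℂ) : LocallyIntegrable (fun z : ℂ => (z - z₁)⁻¹) := by
  rw [locallyIntegrable_iff]
  intro k hk
  have h := locallyIntegrable_inv.integrableOn_isCompact
    (hk.image (by fun_prop : Continuous fun z : ℂ => z - z₁))
  have := (measurePreserving_sub_right (volume : Measure ℂ) z₁).integrableOn_image
    (Homeomorph.subRight z₁).measurableEmbedding (f := fun z => z⁻¹) (s := k)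
  exact this.1 h

theorem lemA_smooth {h₂ e : ℂ → ℂ} (hh : ContDiff ℝ 1 h₂) (he : ContDiff ℝ 1 e) {a₀ : ℂ} {r : ℝ}
    (hsupp : tsupport e ⊆ closedBall a₀ r) {K : Set (ℂ × ℂ)} (hK : IsCompact K)
    (hK1 : ∀ z ∈ closedBall a₀ r, (z, h₂ z + e z) ∈ K)
    (hK2 : ∀ z ∈ closedBall a₀ r, (z, h₂ z) ∈ K) {z₁ : ℂ} {s : ℝ} (hs : 0 < s)
    (hs2 : s < ‖e z₁‖) :
    ∃ w, ‖w - (h₂ z₁ + e z₁)‖ = s ∧ (z₁, w) ∈ phull K := by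
  by_contra hcon
  push Not at hcon
  have hz₁ : z₁ ∈ closedBall a₀ r := hsupp (subset_tsupport _ (by
    rw [Function.mem_support]; intro h; rw [h, norm_zero] at hs2; linarith))
  set B := closedBall a₀ r with hB
  have : CompactSpace K := isCompact_iff_compactSpace.1 hK
  have : CompactSpace B := isCompact_iff_compactSpace.1 (isCompact_closedBall a₀ r)
  have : Nonempty K := ⟨⟨_, hK2 z₁ hz₁⟩⟩
  set h₁ : ℂ → ℂ := fun z => h₂ z + e z with hh₁
  have hh1 : ContDiff ℝ 1 h₁ := hh.add he
  have hBm : MeasurableSet B := measurableSet_closedBall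
  set μ : Measure B := Measure.comap Subtype.val volume with hμ
  have hint0 : IntegrableOn (fun z => (z - z₁)⁻¹) B := by
    have h1 : LocallyIntegrable (fun z : ℂ => (z - z₁)⁻¹) := by
      exact locInt_inv_sub z₁
    exact h1.integrableOn_isCompact (isCompact_closedBall a₀ r)
  have hIntg : ∀ h : ℂ → ℂ, ContDiff ℝ 1 h →
      Integrable (fun x : B => (x.1 - z₁)⁻¹ * dbar h x.1) μ := by
    intro h hc
    have : IntegrableOn (fun z => (z - z₁)⁻¹ * dbar h z) B :=
      hint0.mul_continuousOn (continuous_dbar hc).continuousOn (isCompact_closedBall a₀ r)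
    exact (integrableOn_iff_comap_subtypeVal hBm).1 this
  have hγ : ∀ h : ℂ → ℂ, ContDiff ℝ 1 h → (∀ z ∈ B, (z, h z) ∈ K) →
      ∃ γ : C(B, K), ∀ x, (γ x).1 = (x.1, h x.1) := by
    intro h hc hm
    refine ⟨⟨fun x => ⟨(x.1, h x.1), hm x.1 x.2⟩, ?_⟩, fun x => rfl⟩
    have := hc.continuous
    fun_prop
  obtain ⟨γ₁, hγ₁⟩ := hγ h₁ hh1 hK1
  obtain ⟨γ₂, hγ₂⟩ := hγ h₂ hh hK2
  obtain ⟨L₁, hL₁⟩ := exists_intCLM μ (hIntg h₁ hh1) γ₁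
  obtain ⟨L₂, hL₂⟩ := exists_intCLM μ (hIntg h₂ hh) γ₂
  set ι : pAlg K →L[ℂ] C(K, ℂ) := ⟨(pAlg K).val.toLinearMap, continuous_subtype_val⟩ with hι
  set L : pAlg K →L[ℂ] ℂ := (L₁ - L₂).comp ι with hL
  -- the difference function
  have hG : ∀ Q : MM, ContDiff ℝ 1 (fun z => ev z (h₁ z) Q - ev z (h₂ z) Q) := fun Q =>
    (contDiff_evh hh1 Q).1.sub (contDiff_evh hh Q).1
  have hdG : ∀ (Q : MM) z, dbar (fun z => ev z (h₁ z) Q - ev z (h₂ z) Q) z =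
      ev z (h₁ z) (MvPolynomial.pderiv 1 Q) * dbar h₁ z -
      ev z (h₂ z) (MvPolynomial.pderiv 1 Q) * dbar h₂ z := by
    intro Q z
    rw [dbar_sub ((contDiff_evh hh1 Q).1.differentiable (by norm_num) z)
      ((contDiff_evh hh Q).1.differentiable (by norm_num) z), (contDiff_evh hh1 Q).2,
      (contDiff_evh hh Q).2]
  have hsG : ∀ Q : MM, tsupport (fun z => ev z (h₁ z) Q - ev z (h₂ z) Q) ⊆ tsupport e := by
    intro Q
    refine closure_mono ?_
    intro z hz
    rw [Function.mem_support] at hz ⊢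
    intro h0
    apply hz
    simp [hh₁, h0]
  have hcG : ∀ Q : MM, HasCompactSupport (fun z => ev z (h₁ z) Q - ev z (h₂ z) Q) := fun Q =>
    HasCompactSupport.of_support_subset_isCompact (isCompact_closedBall a₀ r)
      ((subset_tsupport _).trans ((hsG Q).trans hsupp))
  have hd0 : ∀ (Q : MM) z, z ∉ B → dbar (fun z => ev z (h₁ z) Q - ev z (h₂ z) Q) z = 0 := by
    intro Q z hz
    have : z ∉ tsupport (fun z => ev z (h₁ z) Q - ev z (h₂ z) Q) := fun h => hz (hsupp (hsG Q h))
    have h1 := fderiv_of_notMem_tsupport ℝ this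
    unfold dbar
    rw [h1]
    simp
  -- value of `L`
  have hLv : ∀ R : MM, L (ev (pZ K) (pW K) R) =
      ∫ z in B, (z - z₁)⁻¹ * (ev z (h₁ z) R * dbar h₁ z - ev z (h₂ z) R * dbar h₂ z) := by
    intro R
    have e0 : L (ev (pZ K) (pW K) R) = L₁ (ev (cZ K) (cW K) R) - L₂ (ev (cZ K) (cW K) R) := by
      rw [← ev_pZ]
      rfl
    rw [e0, hL₁, hL₂, ← integral_sub, ← integral_subtype_comap hBm]
    · congr 1
      funext x
      rw [ev_cZ_apply, ev_cZ_apply, hγ₁, hγ₂]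
      ring
    · exact (hIntg h₁ hh1).mul_bdd (c := ‖ev (cZ K) (cW K) R‖)
        ((ev (cZ K) (cW K) R).comp γ₁).continuous.aestronglyMeasurable
        (Eventually.of_forall fun x => ContinuousMap.norm_coe_le_norm _ _)
    · exact (hIntg h₂ hh).mul_bdd (c := ‖ev (cZ K) (cW K) R‖)
        ((ev (cZ K) (cW K) R).comp γ₂).continuous.aestronglyMeasurable
        (Eventually.of_forall fun x => ContinuousMap.norm_coe_le_norm _ _)
  refine cfa (A := pAlg K) (Z := pZ K) (W := pW K) (η := z₁) (κ := -pompC) (c₁ := h₁ z₁)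
    (c₂ := h₂ z₁) (neg_ne_zero.2 pompC_ne) L ?_ ?_ ?_ ?_ hs ?_ ?_
  · have hpoly : ∀ P : MM, L ((pZ K - algebraMap ℂ (pAlg K) z₁) * ev (pZ K) (pW K) P) = 0 := by
      intro P
      obtain ⟨Q, rfl⟩ := exists_pderiv P
      have e1 : (pZ K - algebraMap ℂ (pAlg K) z₁) * ev (pZ K) (pW K) (MvPolynomial.pderiv 1 Q) =
          ev (pZ K) (pW K) ((MvPolynomial.X 0 - MvPolynomial.C z₁) * MvPolynomial.pderiv 1 Q) := by
        simp
      rw [e1, hLv]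
      have e2 : ∫ z in B, (z - z₁)⁻¹ *
          (ev z (h₁ z) ((MvPolynomial.X 0 - MvPolynomial.C z₁) * MvPolynomial.pderiv 1 Q) *
            dbar h₁ z -
          ev z (h₂ z) ((MvPolynomial.X 0 - MvPolynomial.C z₁) * MvPolynomial.pderiv 1 Q) *
            dbar h₂ z) = ∫ z in B, dbar (fun z => ev z (h₁ z) Q - ev z (h₂ z) Q) z := by
        refine integral_congr_ae ?_
        have : ∀ᵐ z ∂(volume.restrict B), z ≠ z₁ := by
          refine ae_restrict_of_ae ?_
          rw [ae_iff]
          simp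
        filter_upwards [this] with z hz
        rw [hdG]
        have : z - z₁ ≠ 0 := sub_ne_zero.2 hz
        simp only [map_mul, map_sub, ev_X0, ev_C, Algebra.algebraMap_self, RingHom.id_apply]
        field_simp
      rw [e2, setIntegral_eq_integral_of_forall_compl_eq_zero (hd0 Q),
        integral_dbar_zero (hG Q) (hcG Q)]
    have hcont : Continuous fun a : pAlg K => L ((pZ K - algebraMap ℂ (pAlg K) z₁) * a) := by
      fun_prop
    have hd : Dense (Set.range fun P : MM => ev (pZ K) (pW K) P) := by
      rw [Metric.dense_iff]
      intro a δ hδ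
      obtain ⟨P, hP⟩ := exists_approx_pAlg K a hδ
      exact ⟨_, by rw [mem_ball, dist_comm, dist_eq_norm]; exact hP, ⟨P, rfl⟩⟩
    have := hcont.ext_on hd continuous_const (g := fun _ => (0 : ℂ)) (by
      rintro _ ⟨P, rfl⟩
      exact hpoly P)
    exact fun a => congrFun this a
  · intro Q
    rw [hLv]
    have e2 : ∫ z in B, (z - z₁)⁻¹ *
          (ev z (h₁ z) (MvPolynomial.pderiv 1 Q) * dbar h₁ z -
          ev z (h₂ z) (MvPolynomial.pderiv 1 Q) * dbar h₂ z) =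
          ∫ z in B, (z - z₁)⁻¹ * dbar (fun z => ev z (h₁ z) Q - ev z (h₂ z) Q) z := by
      simp only [hdG]
    rw [e2, setIntegral_eq_integral_of_forall_compl_eq_zero (fun z hz => by
      rw [hd0 Q z hz, mul_zero]), pompeiu (hG Q) (hcG Q)]
    ring
  · intro Q
    have := norm_pEval_le K ⟨_, hK1 z₁ hz₁⟩ (ev (pZ K) (pW K) Q)
    rwa [pEval_ev] at this
  · intro Q
    have := norm_pEval_le K ⟨_, hK2 z₁ hz₁⟩ (ev (pZ K) (pW K) Q)
    rwa [pEval_ev] at this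
  · simpa [hh₁] using hs2
  · intro w hw
    have hw' : (z₁, w) ∉ phull K := hcon w (by
      rw [mem_sphere, dist_eq_norm] at hw
      exact hw)
    obtain ⟨P, hP⟩ := exists_poly_of_not_mem_phull hw'
    exact ⟨P, norm_ev_lt K hP⟩

end PartLA

section PartLA2

open Filter Topology ComplexConjugate MeasureTheory
set_option linter.unusedSectionVars false

theorem phull_limit {K : Set (ℂ × ℂ)} (hK : IsCompact K) (hne : K.Nonempty) {δ : ℕ → ℝ}
    (hδ : Tendsto δ atTop (𝓝 0)) {x : ℕ → ℂ × ℂ} {x₀ : ℂ × ℂ} (hx : Tendsto x atTop (𝓝 x₀))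
    (h : ∀ k, x k ∈ phull (cthickening (δ k) K)) : x₀ ∈ phull K := by
  rw [mem_phull_iff hK hne]
  intro P M hM
  refine le_of_forall_pos_le_add fun ε hε => ?_
  have hop : IsOpen {y : ℂ × ℂ | ‖ev y.1 y.2 P‖ < M + ε} :=
    isOpen_lt (continuous_ev P).norm continuous_const
  obtain ⟨δ₀, hδ₀, hsub⟩ := hK.exists_cthickening_subset_open hop
    (fun y hy => lt_of_le_of_lt (hM y hy) (by linarith))
  have h1 : ∀ᶠ k in atTop, ‖ev (x k).1 (x k).2 P‖ ≤ M + ε := by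
    filter_upwards [hδ.eventually_lt_const hδ₀] with k hk
    obtain ⟨y, hy, hxy⟩ := h k P
    exact hxy.trans (hsub (cthickening_mono hk.le K hy)).le
  exact le_of_tendsto ((((continuous_ev P).norm).tendsto x₀).comp hx) h1

theorem lemA {h₂ e : ℂ → ℂ} (hh : Continuous h₂) (he : Continuous e) {a₀ : ℂ} {r : ℝ}
    (hsupp : ∀ z, z ∉ closedBall a₀ r → e z = 0) {K : Set (ℂ × ℂ)} (hK : IsCompact K)
    (hK1 : ∀ z ∈ closedBall a₀ r, (z, h₂ z + e z) ∈ K)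
    (hK2 : ∀ z ∈ closedBall a₀ r, (z, h₂ z) ∈ K) {z₁ : ℂ} {s : ℝ} (hs : 0 < s)
    (hs2 : s < ‖e z₁‖) :
    ∃ w, ‖w - (h₂ z₁ + e z₁)‖ = s ∧ (z₁, w) ∈ phull K := by
  have hz₁ : z₁ ∈ closedBall a₀ r := by
    by_contra hz
    rw [hsupp z₁ hz, norm_zero] at hs2
    linarith
  set δ : ℕ → ℝ := fun n => 1 / ((n : ℝ) + 1) with hδ
  have hδ0 : ∀ n, 0 < δ n := fun n => by positivity
  have hδt : Tendsto δ atTop (𝓝 0) := tendsto_one_div_add_atTop_nhds_zero_nat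
  set d := ‖e z₁‖ - s with hd
  have hd0 : 0 < d := by linarith
  have step : ∀ k, ∃ w c : ℂ, ‖w - c‖ = s ∧ ‖c - (h₂ z₁ + e z₁)‖ ≤ δ k ∧
      (z₁, w) ∈ phull (cthickening (δ k) K) := by
    intro k
    set η := min (δ k / 2) (d / 2) with hη
    have hη0 : 0 < η := lt_min (by have := hδ0 k; positivity) (by positivity)
    have hη1 : η ≤ δ k / 2 := min_le_left _ _
    have hη2 : η ≤ d / 2 := min_le_right _ _
    obtain ⟨h', hh', hha, -⟩ := hh.exists_contDiff_approx 1 (continuous_const (y := η))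
      (fun _ => hη0)
    obtain ⟨e', he', hea, hes⟩ := he.exists_contDiff_approx 1 (continuous_const (y := η))
      (fun _ => hη0)
    have hsum : ∀ z, ‖(h' z + e' z) - (h₂ z + e z)‖ ≤ δ k := by
      intro z
      have h1 := hha z
      have h2 := hea z
      rw [dist_eq_norm] at h1 h2
      calc ‖(h' z + e' z) - (h₂ z + e z)‖ = ‖(h' z - h₂ z) + (e' z - e z)‖ := by ring_nf
        _ ≤ ‖h' z - h₂ z‖ + ‖e' z - e z‖ := norm_add_le _ _
        _ ≤ δ k := by linarith
    have hKc : IsCompact (cthickening (δ k) K) := hK.cthickening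
    have hs' : s < ‖e' z₁‖ := by
      have h2 := hea z₁
      rw [dist_comm, dist_eq_norm] at h2
      have := norm_sub_norm_le (e z₁) (e' z₁)
      linarith
    have hprod : ∀ z a b : ℂ, (z, b) ∈ K → ‖a - b‖ ≤ δ k → (z, a) ∈ cthickening (δ k) K := by
      intro z a b hb hab
      refine mem_cthickening_of_dist_le _ _ _ _ hb ?_
      rw [Prod.dist_eq]
      refine max_le ?_ ?_
      · simp [(hδ0 k).le]
      · rw [dist_eq_norm]; exact hab
    obtain ⟨w, hw1, hw2⟩ := lemA_smooth (h₂ := h') (e := e') (by exact_mod_cast hh')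
      (by exact_mod_cast he') (a₀ := a₀) (r := r) (K := cthickening (δ k) K) (z₁ := z₁) (by
        refine closure_minimal (hes.trans ?_) isClosed_closedBall
        intro z hz
        by_contra hc
        exact hz (hsupp z hc)) hKc
      (fun z hz => hprod z _ _ (hK1 z hz) (hsum z))
      (fun z hz => hprod z _ _ (hK2 z hz) (by
        have h1 := hha z
        rw [dist_eq_norm] at h1
        have := hδ0 k
        linarith)) hs hs'
    exact ⟨w, _, hw1, hsum z₁, hw2⟩
  choose w c hw hc hmem using step
  have hct : Tendsto c atTop (𝓝 (h₂ z₁ + e z₁)) := by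
    rw [tendsto_iff_norm_sub_tendsto_zero]
    exact squeeze_zero (fun _ => norm_nonneg _) hc hδt
  have hb : ∀ k, w k ∈ closedBall (h₂ z₁ + e z₁) (s + 1) := by
    intro k
    rw [mem_closedBall, dist_eq_norm]
    have h1 : δ k ≤ 1 := by
      simp only [hδ]
      rw [div_le_one (by positivity)]
      have : (0:ℝ) ≤ k := Nat.cast_nonneg k
      linarith
    calc ‖w k - (h₂ z₁ + e z₁)‖ = ‖(w k - c k) + (c k - (h₂ z₁ + e z₁))‖ := by ring_nf
      _ ≤ _ := norm_add_le _ _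
      _ ≤ s + 1 := by
        have := hc k
        have := hw k
        linarith
  obtain ⟨w₀, -, φ, hφ, hlim⟩ := (isCompact_closedBall _ _).tendsto_subseq hb
  refine ⟨w₀, ?_, ?_⟩
  · have h1 : Tendsto (fun k => ‖w (φ k) - c (φ k)‖) atTop (𝓝 ‖w₀ - (h₂ z₁ + e z₁)‖) :=
      (hlim.sub (hct.comp hφ.tendsto_atTop)).norm
    simp only [hw] at h1
    exact (tendsto_nhds_unique h1 tendsto_const_nhds)
  · refine phull_limit hK ⟨_, hK2 z₁ hz₁⟩ (hδt.comp hφ.tendsto_atTop)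
      (x := fun k => (z₁, w (φ k))) ?_ (fun k => hmem (φ k))
    exact tendsto_const_nhds.prodMk_nhds hlim

end PartLA2

section PartHC

open Filter Topology ComplexConjugate MeasureTheory
set_option linter.unusedSectionVars false

theorem hull_circle {f a p : ℂ → ℂ} {a₀ : ℂ} {r : ℝ} (hf : ContinuousOn f (closedBall a₀ r))
    (ha : Continuous a) (hp : Continuous p) (ha0 : ∀ z ∈ closedBall a₀ r, a z ≠ 0)
    (hbd : ∀ z ∈ sphere a₀ r, (a z * f z - p z).re ≤ 0) {t : ℝ} (ht : 0 < t) {z₁ : ℂ}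
    (hz₁ : z₁ ∈ closedBall a₀ r) {s : ℝ} (hs : 0 < s)
    (hs2 : s * ‖a z₁‖ < (a z₁ * f z₁ - p z₁).re - t) :
    ∃ K : Set (ℂ × ℂ), IsCompact K ∧ (∀ y ∈ K, y.1 ∈ closedBall a₀ r ∧
      (y.2 = f y.1 ∨ (a y.1 * y.2 - p y.1).re = t)) ∧
      ∃ w, ‖w - f z₁‖ = s ∧ (z₁, w) ∈ phull K := by
  classical
  set B := closedBall a₀ r with hB
  have hBc : IsClosed B := isClosed_closedBall
  have hai : ContinuousOn (fun z => (a z)⁻¹) B := ha.continuousOn.inv₀ ha0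
  set g : ℂ → ℂ := fun z => a z * f z - p z with hg
  have hgc : ContinuousOn g B := (ha.continuousOn.mul hf).sub hp.continuousOn
  have hre : ContinuousOn (fun z => (g z).re) B := Complex.continuous_re.comp_continuousOn hgc
  have him : ContinuousOn (fun z => (g z).im) B := Complex.continuous_im.comp_continuousOn hgc
  set F₂ : ℂ → ℂ := fun z => ((t : ℂ) + Complex.I * ((g z).im : ℂ) + p z) * (a z)⁻¹ with hF₂
  have hF₂c : ContinuousOn F₂ B := by
    refine ContinuousOn.mul ((continuousOn_const.add (continuousOn_const.mul
      (Complex.continuous_ofReal.comp_continuousOn him))).add hp.continuousOn) hai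
  obtain ⟨h₂, hh₂⟩ := ContinuousMap.exists_restrict_eq hBc ⟨B.domRestrict F₂, hF₂c.domRestrict⟩
  have hh₂' : ∀ z ∈ B, h₂ z = F₂ z := by
    intro z hz
    have := DFunLike.congr_fun hh₂ ⟨z, hz⟩
    exact this
  set E : ℂ → ℂ := fun z => ((max ((g z).re - t) 0 : ℝ) : ℂ) * (a z)⁻¹ with hE
  have hEc : ContinuousOn E B := by
    refine ContinuousOn.mul (Complex.continuous_ofReal.comp_continuousOn ?_) hai
    exact (hre.sub continuousOn_const).sup continuousOn_const
  set e : ℂ → ℂ := B.piecewise E (fun _ => 0) with he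
  have hec : Continuous e := by
    refine continuous_piecewise ?_ (by rwa [hBc.closure_eq]) continuousOn_const
    intro z hz
    have hz' := frontier_closedBall_subset_sphere hz
    have := hbd z hz'
    simp only [hE]
    rw [max_eq_right (by simp only [hg]; linarith)]
    simp
  have heB : ∀ z ∈ B, e z = E z := fun z hz => piecewise_eq_of_mem _ _ _ hz
  have hF2r : ∀ z ∈ B, (a z * F₂ z - p z).re = t := by
    intro z hz
    have : a z * F₂ z - p z = (t : ℂ) + Complex.I * ((g z).im : ℂ) := by
      simp only [hF₂]
      have := ha0 z hz
      field_simp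
      ring
    rw [this]
    simp
  have hsum : ∀ z ∈ B, t ≤ (g z).re → F₂ z + E z = f z := by
    intro z hz h
    simp only [hF₂, hE]
    rw [max_eq_left (by linarith)]
    have h0 := ha0 z hz
    have h1 : g z = ((g z).re : ℂ) + ((g z).im : ℂ) * Complex.I := (Complex.re_add_im _).symm
    have h2 : f z = (g z + p z) * (a z)⁻¹ := by
      simp only [hg]
      field_simp
      ring
    rw [h2]
    push_cast
    linear_combination (-(a z)⁻¹) * h1
  set K : Set (ℂ × ℂ) := (fun z => (z, h₂ z + e z)) '' B ∪ (fun z => (z, h₂ z)) '' B with hK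
  have hKc : IsCompact K := by
    have := h₂.continuous
    exact ((isCompact_closedBall a₀ r).image (by fun_prop)).union
      ((isCompact_closedBall a₀ r).image (by fun_prop))
  have hz1t : t < (g z₁).re := by
    have : 0 ≤ s * ‖a z₁‖ := by positivity
    simp only [hg]
    linarith
  have hfz : h₂ z₁ + e z₁ = f z₁ := by
    rw [hh₂' z₁ hz₁, heB z₁ hz₁, hsum z₁ hz₁ hz1t.le]
  have hez : s < ‖e z₁‖ := by
    rw [heB z₁ hz₁]
    simp only [hE]
    rw [max_eq_left (by linarith), norm_mul, Complex.norm_real, Real.norm_of_nonneg (by linarith),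
      norm_inv, ← div_eq_mul_inv, lt_div_iff₀ (norm_pos_iff.2 (ha0 z₁ hz₁))]
    exact hs2
  obtain ⟨w, hw1, hw2⟩ := lemA (h₂ := h₂) (e := e) h₂.continuous hec (a₀ := a₀) (r := r) (K := K)
    (fun z hz => piecewise_eq_of_notMem _ _ _ hz) hKc
    (fun z hz => Or.inl ⟨z, hz, rfl⟩) (fun z hz => Or.inr ⟨z, hz, rfl⟩) hs hez
  refine ⟨K, hKc, ?_, w, by rwa [hfz] at hw1, hw2⟩
  rintro y (⟨z, hz, rfl⟩ | ⟨z, hz, rfl⟩)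
  · refine ⟨hz, ?_⟩
    rcases le_total t (g z).re with h | h
    · left
      simp only
      rw [hh₂' z hz, heB z hz, hsum z hz h]
    · right
      have : e z = 0 := by
        rw [heB z hz]
        simp only [hE]
        rw [max_eq_right (by linarith)]
        simp
      simp only [this, add_zero]
      rw [hh₂' z hz, hF2r z hz]
  · refine ⟨hz, Or.inr ?_⟩
    simp only
    rw [hh₂' z hz, hF2r z hz]

end PartHC

section PartSub1

open Filter Topology ComplexConjugate MeasureTheory
set_option linter.unusedSectionVars false

theorem circ_approx {φ : ℂ → ℂ} {c : ℂ} {r : ℝ} (hr : 0 < r) (hφ : ContinuousOn φ (sphere c r))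
    {ε : ℝ} (hε : 0 < ε) :
    ∃ P Q : Polynomial ℂ, ∀ z ∈ sphere c r, ‖φ z - (P.eval z + conj (Q.eval z))‖ < ε := by
  have : Fact ((0 : ℝ) < 1) := ⟨one_pos⟩
  set m : AddCircle (1 : ℝ) → ℂ := fun x => c + r * (fourier 1 x : ℂ) with hm
  have hmc : Continuous m := by
    simp only [hm]
    exact continuous_const.add (continuous_const.mul (fourier 1).continuous)
  have hm1 : ∀ x, m x ∈ sphere c r := by
    intro x
    rw [mem_sphere, dist_eq_norm]
    simp only [hm]
    rw [add_sub_cancel_left, norm_mul, Complex.norm_real, Real.norm_of_nonneg hr.le, fourier_one,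
      Circle.norm_coe, mul_one]
  have hm2 : ∀ z ∈ sphere c r, ∃ x, m x = z := by
    intro z hz
    rw [mem_sphere, dist_eq_norm] at hz
    have hn : ‖(z - c) / r‖ = 1 := by
      rw [norm_div, hz, Complex.norm_real, Real.norm_of_nonneg hr.le, div_self hr.ne']
    obtain ⟨x, hx⟩ := (AddCircle.homeomorphCircle (one_ne_zero : (1 : ℝ) ≠ 0)).surjective
      ⟨(z - c) / r, mem_sphere_zero_iff_norm.2 hn⟩
    refine ⟨x, ?_⟩
    have hx' : ((AddCircle.toCircle x : Circle) : ℂ) = (z - c) / r := by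
      rw [AddCircle.homeomorphCircle_apply] at hx
      rw [hx]
    simp only [hm]
    rw [fourier_one, hx']
    have : (r : ℂ) ≠ 0 := by exact_mod_cast hr.ne'
    field_simp
    ring
  set Φ : C(AddCircle (1 : ℝ), ℂ) := ⟨fun x => φ (m x), hφ.comp_continuous hmc hm1⟩ with hΦ
  have hmem : Φ ∈ (Submodule.span ℂ (range <| @fourier (1 : ℝ))).topologicalClosure := by
    rw [span_fourier_closure_eq_top]
    trivial
  have hmem' : Φ ∈ closure ((Submodule.span ℂ (range <| @fourier (1 : ℝ)) : Set _)) := hmem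
  obtain ⟨F, hF, hd⟩ := Metric.mem_closure_iff.1 hmem' ε hε
  have key : ∃ P Q : Polynomial ℂ, ∀ x, F x = P.eval (m x) + conj (Q.eval (m x)) := by
    refine Submodule.span_induction (p := fun F _ => ∃ P Q : Polynomial ℂ, ∀ x,
      F x = P.eval (m x) + conj (Q.eval (m x))) ?_ ?_ ?_ ?_ hF
    · rintro _ ⟨n, rfl⟩
      set R : Polynomial ℂ := (Polynomial.C ((r : ℂ)⁻¹) * (Polynomial.X - Polynomial.C c)) with hR
      have hRe : ∀ x, R.eval (m x) = fourier 1 x := by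
        intro x
        have : (r : ℂ) ≠ 0 := by exact_mod_cast hr.ne'
        simp [hR, hm]
        field_simp
      have hfp : ∀ (k : ℕ) (x : AddCircle (1 : ℝ)), (fourier (k : ℤ) x : ℂ) = (fourier 1 x) ^ k := by
        intro k x
        induction k with
        | zero => simp
        | succ k ih =>
          rw [Nat.cast_succ, fourier_add, ih, pow_succ]
      rcases Int.eq_nat_or_neg n with ⟨k, rfl | rfl⟩
      · refine ⟨R ^ k, 0, fun x => ?_⟩
        rw [hfp, Polynomial.eval_pow, hRe]
        simp
      · refine ⟨0, R ^ k, fun x => ?_⟩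
        rw [fourier_neg, hfp, Polynomial.eval_pow, hRe]
        simp
    · exact ⟨0, 0, by simp⟩
    · rintro F G - - ⟨P, Q, h1⟩ ⟨P', Q', h2⟩
      refine ⟨P + P', Q + Q', fun x => ?_⟩
      simp only [ContinuousMap.add_apply, h1, h2, Polynomial.eval_add, map_add]
      ring
    · rintro a F - ⟨P, Q, h1⟩
      refine ⟨Polynomial.C a * P, Polynomial.C (conj a) * Q, fun x => ?_⟩
      simp only [ContinuousMap.smul_apply, h1, Polynomial.eval_mul, Polynomial.eval_C, map_mul,
        Complex.conj_conj, smul_eq_mul]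
      ring
  obtain ⟨P, Q, h⟩ := key
  refine ⟨P, Q, fun z hz => ?_⟩
  obtain ⟨x, rfl⟩ := hm2 z hz
  rw [← h x, ← dist_eq_norm]
  exact (ContinuousMap.dist_apply_le_dist x).trans_lt hd

theorem circ_approx_real {φ : ℂ → ℝ} {c : ℂ} {r : ℝ} (hr : 0 < r)
    (hφ : ContinuousOn φ (sphere c r)) {ε : ℝ} (hε : 0 < ε) :
    ∃ P : Polynomial ℂ, ∀ z ∈ sphere c r, |φ z - (P.eval z).re| < ε := by
  obtain ⟨P, Q, h⟩ := circ_approx (φ := fun z => (φ z : ℂ)) hr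
    (Complex.continuous_ofReal.comp_continuousOn hφ) hε
  refine ⟨P + Q, fun z hz => ?_⟩
  have h1 := (Complex.abs_re_le_norm _).trans_lt (h z hz)
  simpa using h1

theorem submean_cont {φ : ℂ → ℝ} {a : ℝ} (hφ : Continuous φ)
    (hs : ∀ p : Polynomial ℂ, (∀ z ∈ sphere (0 : ℂ) 1, φ z ≤ (p.eval z).re) → a ≤ (p.eval 0).re) :
    a ≤ Real.circleAverage φ 0 1 := by
  refine le_of_forall_pos_le_add fun ε hε => ?_
  obtain ⟨P, hP⟩ := circ_approx_real (φ := φ) (c := 0) one_pos hφ.continuousOn (half_pos hε)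
  have h1 := hs (P + Polynomial.C ((ε / 2 : ℝ) : ℂ)) (fun z hz => by
    have := (abs_lt.1 (hP z hz)).2
    simp only [Polynomial.eval_add, Polynomial.eval_C, Complex.add_re, Complex.ofReal_re]
    linarith)
  simp only [Polynomial.eval_add, Polynomial.eval_C, Complex.add_re, Complex.ofReal_re] at h1
  have hPd : Differentiable ℂ (fun z => P.eval z) := P.differentiable
  have h2 := circleAverage_re_entire hPd 1
  have hPc : Continuous fun z => (P.eval z).re := Complex.continuous_re.comp P.continuous
  have h3 : Real.circleAverage (fun z => (P.eval z).re) 0 1 ≤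
      Real.circleAverage (fun z => φ z + ε / 2) 0 1 := by
    refine Real.circleAverage_mono hPc.continuousOn.circleIntegrable'
      (hφ.add continuous_const).continuousOn.circleIntegrable' ?_
    intro z hz
    rw [abs_one] at hz
    have := (abs_lt.1 (hP z hz)).1
    linarith
  rw [Real.circleAverage_fun_add hφ.continuousOn.circleIntegrable'
    continuous_const.continuousOn.circleIntegrable', Real.circleAverage_const] at h3
  linarith

/-- Lipschitz regularization from above on the unit circle -/
def lipReg (s : ℂ → ℝ) (n : ℕ) (x : ℂ) : ℝ := ⨆ y : sphere (0 : ℂ) 1, (s y - n * ‖x - y‖)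

section lipReg
variable {s : ℂ → ℝ} {M : ℝ} (hM : ∀ y ∈ sphere (0 : ℂ) 1, s y ≤ M)
include hM

theorem lipReg_bdd (n : ℕ) (x : ℂ) :
    BddAbove (range fun y : sphere (0 : ℂ) 1 => (s y - n * ‖x - y‖)) := by
  refine ⟨M, ?_⟩
  rintro _ ⟨y, rfl⟩
  have := hM y y.2
  have : 0 ≤ n * ‖x - y‖ := by positivity
  simp only
  linarith

theorem lipReg_cont (n : ℕ) : Continuous (lipReg s n) := by
  have hne : Nonempty (sphere (0 : ℂ) 1) := ⟨⟨1, by simp⟩⟩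
  have h1 : ∀ x x', lipReg s n x ≤ lipReg s n x' + n * dist x x' := by
    intro x x'
    refine ciSup_le fun y => ?_
    have := le_ciSup (lipReg_bdd hM n x') y
    have h2 : ‖x' - y‖ ≤ dist x x' + ‖x - y‖ := by
      rw [dist_comm, dist_eq_norm]
      calc ‖x' - y‖ = ‖(x' - x) + (x - y)‖ := by ring_nf
        _ ≤ _ := norm_add_le _ _
    have h3 : n * ‖x' - y‖ ≤ n * (dist x x' + ‖x - y‖) := by gcongr
    unfold lipReg
    linarith
  exact (LipschitzWith.of_le_add_mul (K := (n : NNReal)) (f := lipReg s n)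
    (fun x x' => by simpa using h1 x x')).continuous

theorem le_lipReg (n : ℕ) {x : ℂ} (hx : x ∈ sphere (0 : ℂ) 1) : s x ≤ lipReg s n x := by
  have := le_ciSup (lipReg_bdd hM n x) ⟨x, hx⟩
  simp only [sub_self, norm_zero, mul_zero, sub_zero] at this
  exact this

theorem lipReg_le (n : ℕ) (x : ℂ) : lipReg s n x ≤ M := by
  have hne : Nonempty (sphere (0 : ℂ) 1) := ⟨⟨1, by simp⟩⟩
  refine ciSup_le fun y => ?_
  have := hM y y.2
  have : 0 ≤ n * ‖x - y‖ := by positivity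
  linarith

theorem lipReg_tendsto (hs : UpperSemicontinuous s) {x : ℂ} (hx : x ∈ sphere (0 : ℂ) 1) :
    Tendsto (fun n => lipReg s n x) atTop (𝓝 (s x)) := by
  have hne : Nonempty (sphere (0 : ℂ) 1) := ⟨⟨1, by simp⟩⟩
  rw [tendsto_order]
  refine ⟨fun a ha => Eventually.of_forall fun n => ha.trans_le (le_lipReg hM n hx), fun a ha => ?_⟩
  obtain ⟨b, hb1, hb2⟩ := exists_between ha
  obtain ⟨ρ, hρ, hball⟩ := Metric.eventually_nhds_iff.1 (hs x b hb1)
  obtain ⟨N, hN⟩ := exists_nat_gt ((M - b) / ρ)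
  filter_upwards [eventually_ge_atTop N] with n hn
  refine lt_of_le_of_lt (ciSup_le fun y => ?_) hb2
  have h0 : 0 ≤ (n : ℝ) * ‖x - y‖ := by positivity
  by_cases hy : dist (y : ℂ) x < ρ
  · have := hball hy
    linarith
  · push Not at hy
    rw [dist_comm, dist_eq_norm] at hy
    rw [div_lt_iff₀ hρ] at hN
    have h1 : (N : ℝ) ≤ n := by exact_mod_cast hn
    have h2 : (N : ℝ) * ρ ≤ n * ‖x - y‖ := by gcongr
    have := hM y y.2
    linarith

end lipReg

theorem submean {s : ℂ → ℝ} (husc : UpperSemicontinuous s) {m : ℝ} (hm : ∀ z, m ≤ s z)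
    (hs : ∀ p : Polynomial ℂ, (∀ z ∈ sphere (0 : ℂ) 1, s z ≤ (p.eval z).re) →
      s 0 ≤ (p.eval 0).re) :
    s 0 ≤ Real.circleAverage s 0 1 := by
  obtain ⟨y, hy, hmax⟩ := (husc.upperSemicontinuousOn (sphere (0:ℂ) 1)).exists_isMaxOn
    (⟨1, by simp⟩ : (sphere (0 : ℂ) 1).Nonempty) (isCompact_sphere 0 1)
  have hM : ∀ z ∈ sphere (0 : ℂ) 1, s z ≤ s y := fun z hz => hmax hz
  have h1 : ∀ n, s 0 ≤ Real.circleAverage (lipReg s n) 0 1 := fun n =>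
    submean_cont (lipReg_cont hM n) fun p hp => hs p fun z hz => (le_lipReg hM n hz).trans (hp z hz)
  have h2 : Tendsto (fun n => Real.circleAverage (lipReg s n) 0 1) atTop
      (𝓝 (Real.circleAverage s 0 1)) := by
    unfold Real.circleAverage
    refine Tendsto.const_smul ?_ _
    have hcm : ∀ θ, circleMap 0 1 θ ∈ sphere (0 : ℂ) 1 := fun θ =>
      circleMap_mem_sphere 0 zero_le_one θ
    refine intervalIntegral.tendsto_integral_filter_of_dominated_convergence
      (fun _ => max |m| |s y|) (Eventually.of_forall fun n => ?_)
      (Eventually.of_forall fun n => Eventually.of_forall fun θ _ => ?_) (by simp)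
      (Eventually.of_forall fun θ _ => lipReg_tendsto hM husc (hcm θ))
    · exact ((lipReg_cont hM n).comp (continuous_circleMap 0 1)).aestronglyMeasurable
    · rw [Real.norm_eq_abs]
      exact abs_le_max_abs_abs ((hm _).trans (le_lipReg hM n (hcm θ))) (lipReg_le hM n _)
  exact ge_of_tendsto' h2 h1

end PartSub1

section PartMoll

open Filter Topology ComplexConjugate MeasureTheory
set_option linter.unusedSectionVars false

theorem usc_bdd {X : Type*} [TopologicalSpace X] {v : X → ℝ} (husc : UpperSemicontinuous v) {m : ℝ}
    (hm : ∀ z, m ≤ v z) {K : Set X} (hK : IsCompact K) : ∃ C, 0 ≤ C ∧ ∀ x ∈ K, |v x| ≤ C := by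
  rcases K.eq_empty_or_nonempty with rfl | hne
  · exact ⟨0, le_rfl, by simp⟩
  · obtain ⟨y, hy, hmax⟩ := (husc.upperSemicontinuousOn K).exists_isMaxOn hne hK
    exact ⟨max |m| |v y|, le_max_of_le_left (abs_nonneg _),
      fun x hx => abs_le_max_abs_abs (hm x) (hmax hx)⟩

theorem usc_locInt {v : ℂ × ℂ → ℝ} (husc : UpperSemicontinuous v) {m : ℝ}
    (hm : ∀ z, m ≤ v z) : LocallyIntegrable v := by
  rw [locallyIntegrable_iff]
  intro K hK
  obtain ⟨C, -, hC⟩ := usc_bdd husc hm hK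
  refine Measure.integrableOn_of_bounded (M := C) hK.measure_lt_top.ne
    husc.measurable.aestronglyMeasurable ?_
  exact (ae_restrict_iff' hK.measurableSet).2 (Eventually.of_forall fun x hx => hC x hx)

theorem moll_key {v : ℂ × ℂ → ℝ} (husc : UpperSemicontinuous v) {m : ℝ} (hm : ∀ z, m ≤ v z)
    {ρ : ℂ × ℂ → ℝ} (hρ : Continuous ρ) (hρ0 : ∀ y, 0 ≤ ρ y) (hρs : HasCompactSupport ρ)
    {A : ℝ × (ℂ × ℂ) → ℂ × ℂ} (hA : Continuous A) {g : ℂ × ℂ → ℝ}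
    (hgi : Integrable (fun y => ρ y * g y))
    (hg : ∀ y, g y ≤ (2 * Real.pi)⁻¹ * ∫ θ in 0..2 * Real.pi, v (A (θ, y))) :
    ∫ y, ρ y * g y ≤ (2 * Real.pi)⁻¹ * ∫ θ in 0..2 * Real.pi, ∫ y, ρ y * v (A (θ, y)) := by
  have hπ : (0 : ℝ) ≤ 2 * Real.pi := by positivity
  set μ : Measure ℝ := volume.restrict (Ioc 0 (2 * Real.pi)) with hμ
  obtain ⟨C, hC0, hC⟩ := usc_bdd husc hm
    (((isCompact_Icc (a := 0) (b := 2 * Real.pi)).prod hρs).image hA)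
  have hFi : Integrable (fun q : ℝ × (ℂ × ℂ) => ρ q.2 * v (A q)) (μ.prod volume) := by
    have hdom : Integrable (fun q : ℝ × (ℂ × ℂ) => C * ρ q.2) (μ.prod volume) :=
      ((hρ.integrable_of_hasCompactSupport hρs).comp_snd μ).const_mul C
    refine hdom.mono' ?_ ?_
    · exact ((hρ.measurable.comp measurable_snd).mul
        (husc.measurable.comp hA.measurable)).aestronglyMeasurable
    · have h1 : ∀ᵐ q : ℝ × (ℂ × ℂ) ∂(μ.prod volume), q.1 ∈ Ioc 0 (2 * Real.pi) :=
        Measure.quasiMeasurePreserving_fst.ae (ae_restrict_mem measurableSet_Ioc)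
      filter_upwards [h1] with q hq
      rw [Real.norm_eq_abs, abs_mul, abs_of_nonneg (hρ0 _), mul_comm]
      by_cases h : q.2 ∈ tsupport ρ
      · exact mul_le_mul_of_nonneg_right (hC _ ⟨q, ⟨Ioc_subset_Icc_self hq, h⟩, rfl⟩) (hρ0 _)
      · rw [image_eq_zero_of_notMem_tsupport h]
        simp
  have e1 : ∫ θ in 0..2 * Real.pi, ∫ y, ρ y * v (A (θ, y)) =
      ∫ y, ρ y * ∫ θ in 0..2 * Real.pi, v (A (θ, y)) := by
    rw [intervalIntegral.integral_of_le hπ]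
    rw [integral_integral_swap (f := fun θ y => ρ y * v (A (θ, y))) hFi]
    congr 1
    funext y
    rw [intervalIntegral.integral_of_le hπ, integral_const_mul]
  rw [e1, ← integral_const_mul]
  refine integral_mono hgi ?_ ?_
  · have := hFi.integral_prod_right
    refine (this.const_mul (2 * Real.pi)⁻¹).congr (Eventually.of_forall fun y => ?_)
    simp only
    rw [intervalIntegral.integral_of_le hπ, integral_const_mul]
  · intro y
    simp only
    have := mul_le_mul_of_nonneg_left (hg y) (hρ0 y)
    linarith

theorem integral_rot (F : ℂ × ℂ → ℝ) (ζ : Circle) :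
    ∫ y : ℂ × ℂ, F ((ζ : ℂ) • y) = ∫ y, F y := by
  have h1 : MeasurePreserving (fun z : ℂ => (ζ : ℂ) * z) := (rotation ζ).measurePreserving
  have h2 := h1.prod h1
  have hemb : MeasurableEmbedding (Prod.map (fun z : ℂ => (ζ : ℂ) * z) (fun z : ℂ => (ζ : ℂ) * z)) :=
    ((rotation ζ).toHomeomorph.prodCongr (rotation ζ).toHomeomorph).measurableEmbedding
  exact h2.integral_comp hemb F

/-- the (unnormalized) mollifier -/
def mol0 (ε : ℝ) (y : ℂ × ℂ) : ℝ :=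
  expNegInvGlue (ε ^ 2 - ‖y.1‖ ^ 2) * expNegInvGlue (ε ^ 2 - ‖y.2‖ ^ 2)

theorem mol0_smooth (ε : ℝ) : ContDiff ℝ 2 (mol0 ε) := by
  unfold mol0
  have h : ContDiff ℝ 2 expNegInvGlue := expNegInvGlue.contDiff
  have h1 : ContDiff ℝ 2 (fun y : ℂ × ℂ => ε ^ 2 - ‖y.1‖ ^ 2) :=
    contDiff_const.sub (contDiff_fst.norm_sq ℝ)
  have h2 : ContDiff ℝ 2 (fun y : ℂ × ℂ => ε ^ 2 - ‖y.2‖ ^ 2) :=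
    contDiff_const.sub (contDiff_snd.norm_sq ℝ)
  exact (h.comp h1).mul (h.comp h2)

theorem mol0_nonneg (ε : ℝ) (y : ℂ × ℂ) : 0 ≤ mol0 ε y :=
  mul_nonneg (expNegInvGlue.nonneg _) (expNegInvGlue.nonneg _)

theorem mol0_zero {ε : ℝ} (hε : 0 < ε) {y : ℂ × ℂ} (hy : y ∉ ball (0 : ℂ × ℂ) ε) : mol0 ε y = 0 := by
  rw [mem_ball_zero_iff, Prod.norm_def, max_lt_iff, not_and_or, not_lt, not_lt] at hy
  unfold mol0
  rcases hy with h | h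
  · rw [expNegInvGlue.zero_of_nonpos, zero_mul]
    have : ε ^ 2 ≤ ‖y.1‖ ^ 2 := by gcongr
    linarith
  · rw [mul_comm, expNegInvGlue.zero_of_nonpos, zero_mul]
    have : ε ^ 2 ≤ ‖y.2‖ ^ 2 := by gcongr
    linarith

theorem mol0_supp {ε : ℝ} (hε : 0 < ε) : HasCompactSupport (mol0 ε) := by
  refine HasCompactSupport.of_support_subset_isCompact (isCompact_closedBall (0 : ℂ × ℂ) ε) ?_
  intro y hy
  by_contra h
  exact hy (mol0_zero hε fun h' => h (ball_subset_closedBall h'))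

theorem mol0_rot (ε : ℝ) (ζ : Circle) (y : ℂ × ℂ) : mol0 ε ((ζ : ℂ) • y) = mol0 ε y := by
  simp [mol0, Circle.norm_coe]

theorem mol0_integral_pos {ε : ℝ} (hε : 0 < ε) : 0 < ∫ y, mol0 ε y := by
  refine (mol0_smooth ε).continuous.integral_pos_of_hasCompactSupport_nonneg_nonzero (mol0_supp hε)
    (mol0_nonneg ε) (x := 0) ?_
  have : 0 < expNegInvGlue (ε ^ 2) := expNegInvGlue.pos_of_pos (by positivity)
  simp [mol0, this.ne']

theorem mollify {v : ℂ × ℂ → ℝ} (husc : UpperSemicontinuous v) {m : ℝ} (hm : ∀ z, m ≤ v z)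
    (hs : CSub v) {ε : ℝ} (hε : 0 < ε) :
    ∃ v' : ℂ × ℂ → ℝ, ContDiff ℝ 2 v' ∧ CSub v' ∧ (∀ x, v x ≤ v' x) ∧
      ∀ x C, (∀ y ∈ ball x ε, v y ≤ C) → v' x ≤ C := by
  set c := ∫ y, mol0 ε y with hc
  have hc0 : 0 < c := mol0_integral_pos hε
  set ρ : ℂ × ℂ → ℝ := fun y => c⁻¹ * mol0 ε y with hρdef
  have hρd : ContDiff ℝ 2 ρ := contDiff_const.mul (mol0_smooth ε)
  have hρ0 : ∀ y, 0 ≤ ρ y := fun y => mul_nonneg (inv_nonneg.2 hc0.le) (mol0_nonneg ε y)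
  have hρs : HasCompactSupport ρ := (mol0_supp hε).mul_left (f := fun _ => c⁻¹)
  have hρi : ∫ y, ρ y = 1 := by
    simp only [hρdef]
    rw [integral_const_mul, ← hc, inv_mul_cancel₀ hc0.ne']
  have hρI : Integrable ρ := hρd.continuous.integrable_of_hasCompactSupport hρs
  have hvl := usc_locInt husc hm
  have hLI : (volume : Measure (ℂ × ℂ)).IsAddHaarMeasure := by
    change ((volume : Measure ℂ).prod (volume : Measure ℂ)).IsAddHaarMeasure
    infer_instance
  set v' : ℂ × ℂ → ℝ := convolution ρ v (ContinuousLinearMap.lsmul ℝ ℝ) volume with hv'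
  have hval : ∀ x, v' x = ∫ y, ρ y * v (x - y) := fun x => rfl
  have hIntg : ∀ x, Integrable (fun y => ρ y * v (x - y)) := by
    intro x
    have := hρs.convolutionExists_left (ContinuousLinearMap.lsmul ℝ ℝ) hρd.continuous hvl x
    exact this
  refine ⟨v', hρs.contDiff_convolution_left _ hρd hvl, ?_, ?_, ?_⟩
  · intro x h
    rw [hval, Real.circleAverage, smul_eq_mul]
    simp only [hval]
    have := moll_key husc hm hρd.continuous hρ0 hρs
      (A := fun q => x - q.2 + circleMap 0 1 q.1 • h) (by fun_prop) (g := fun y => v (x - y))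
      (hIntg x) (fun y => hs (x - y) h)
    refine this.trans (le_of_eq ?_)
    congr 2
    funext θ
    congr 1
    funext y
    congr 2
    simp only
    abel
  · intro x
    have := moll_key husc hm hρd.continuous hρ0 hρs
      (A := fun q => x - circleMap 0 1 q.1 • q.2) (by fun_prop) (g := fun y => v x)
      (hρI.mul_const _) (fun y => by
        have := hs x (-y)
        rw [Real.circleAverage, smul_eq_mul] at this
        refine this.trans (le_of_eq ?_)
        simp only [smul_neg, sub_eq_add_neg])
    rw [integral_mul_const, hρi, one_mul] at this
    refine this.trans (le_of_eq ?_)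
    have e : ∀ θ : ℝ, ∫ y, ρ y * v (x - circleMap 0 1 θ • y) = v' x := by
      intro θ
      rw [hval, ← integral_rot (fun y => ρ y * v (x - y)) (Circle.exp θ)]
      congr 1
      funext y
      simp only [hρdef]
      rw [mol0_rot]
      simp [circleMap]
    simp only [e]
    rw [intervalIntegral.integral_const, smul_eq_mul, sub_zero, ← mul_assoc,
      inv_mul_cancel₀ (by positivity), one_mul]
  · intro x C hC
    rw [hval]
    have : ∫ y, ρ y * v (x - y) ≤ ∫ y, ρ y * C := by
      refine integral_mono (hIntg x) (hρI.mul_const C) fun y => ?_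
      simp only
      by_cases hy : y ∈ ball (0 : ℂ × ℂ) ε
      · refine mul_le_mul_of_nonneg_left (hC _ ?_) (hρ0 y)
        rw [mem_ball, dist_eq_norm]
        simpa using hy
      · simp only [hρdef]
        rw [mol0_zero hε hy]
        simp
    rwa [integral_mul_const, hρi, one_mul] at this

end PartMoll

section PartHB

open Filter Topology ComplexConjugate MeasureTheory
set_option linter.unusedSectionVars false

/-- plurisubharmonic functions on `ℂ × ℂ` -/
def PSH2 (U : ℂ × ℂ → EReal) : Prop :=
  UpperSemicontinuous U ∧ (∀ x, U x ≠ ⊤) ∧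
    ∀ x h : ℂ × ℂ, SubharmonicOn (fun t : ℂ => U (x + t • h)) univ

/-- truncation from below -/
def trunc (U : ℂ × ℂ → EReal) (m : ℝ) (x : ℂ × ℂ) : ℝ := (max (U x) (m : EReal)).toReal

section trunc
variable {U : ℂ × ℂ → EReal} (hU : PSH2 U) (m : ℝ)
include hU

theorem trunc_coe (x : ℂ × ℂ) : ((trunc U m x : ℝ) : EReal) = max (U x) (m : EReal) := by
  refine EReal.coe_toReal ?_ ?_
  · rcases max_choice (U x) (m : EReal) with h | h
    · rw [h]; exact hU.2.1 x
    · rw [h]; exact EReal.coe_ne_top m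
  · exact ne_bot_of_le_ne_bot (EReal.coe_ne_bot m) (le_max_right _ _)

theorem trunc_le_iff (x : ℂ × ℂ) (C : ℝ) : trunc U m x ≤ C ↔ U x ≤ (C : EReal) ∧ m ≤ C := by
  rw [← EReal.coe_le_coe_iff, trunc_coe hU, max_le_iff, EReal.coe_le_coe_iff]

theorem trunc_lt_iff (x : ℂ × ℂ) (C : ℝ) : trunc U m x < C ↔ U x < (C : EReal) ∧ m < C := by
  rw [← EReal.coe_lt_coe_iff, trunc_coe hU, max_lt_iff, EReal.coe_lt_coe_iff]

theorem le_trunc (x : ℂ × ℂ) : m ≤ trunc U m x := ((trunc_le_iff hU m x _).1 le_rfl).2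

theorem trunc_ge (x : ℂ × ℂ) : U x ≤ (trunc U m x : EReal) := ((trunc_le_iff hU m x _).1 le_rfl).1

theorem trunc_usc : UpperSemicontinuous (trunc U m) := by
  intro x a ha
  rw [trunc_lt_iff hU] at ha
  filter_upwards [hU.1 x _ ha.1] with y hy
  exact (trunc_lt_iff hU m y a).2 ⟨hy, ha.2⟩

theorem trunc_csub : CSub (trunc U m) := by
  intro x h
  have key := submean (s := fun t : ℂ => trunc U m (x + t • h)) (m := m)
    ((trunc_usc hU m).comp (by fun_prop : Continuous fun t : ℂ => x + t • h))
    (fun t => le_trunc hU m _) ?_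
  · simpa using key
  · intro p hp
    simp only [trunc_le_iff hU] at hp ⊢
    refine ⟨(hU.2.2 x h).2 0 1 one_pos (subset_univ _) p (fun z hz => (hp z hz).1) 0 (by simp), ?_⟩
    have hPd : Differentiable ℂ (fun z => p.eval z) := p.differentiable
    rw [← circleAverage_re_entire hPd 1, ← Real.circleAverage_const m (0 : ℂ) 1]
    have hPc : Continuous fun z => (p.eval z).re := Complex.continuous_re.comp p.continuous
    refine Real.circleAverage_mono continuous_const.continuousOn.circleIntegrable'
      hPc.continuousOn.circleIntegrable' ?_
    intro z hz
    rw [abs_one] at hz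
    exact (hp z hz).2

end trunc

theorem hull_bot {U : ℂ × ℂ → EReal} (hU : PSH2 U) {f : ℂ → ℂ} {a p : Polynomial ℂ}
    {a₀ : ℂ} {r : ℝ} (hf : ContinuousOn f (closedBall a₀ r))
    (hbot : ∀ z ∈ closedBall a₀ r, U (z, f z) = ⊥)
    (ha0 : ∀ z ∈ closedBall a₀ r, a.eval z ≠ 0)
    (hbd : ∀ z ∈ sphere a₀ r, (a.eval z * f z - p.eval z).re ≤ 0) {t : ℝ} (ht : 0 < t) {z₁ : ℂ}
    (hz₁ : z₁ ∈ closedBall a₀ r) {s : ℝ} (hs : 0 < s)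
    (hs2 : s * ‖a.eval z₁‖ < (a.eval z₁ * f z₁ - p.eval z₁).re - t) :
    ∃ w, ‖w - f z₁‖ = s ∧ U (z₁, w) = ⊥ := by
  obtain ⟨K, hK, hKp, w, hw, hwK⟩ := hull_circle hf a.continuous p.continuous ha0 hbd ht hz₁ hs hs2
  refine ⟨w, hw, ?_⟩
  by_contra hne
  have hKne : K.Nonempty := by
    obtain ⟨y, hy, _⟩ := hwK 0
    exact ⟨y, hy⟩
  obtain ⟨β, hβ⟩ : ∃ β : ℝ, U (z₁, w) = (β : EReal) :=
    ⟨_, (EReal.coe_toReal (hU.2.1 _) hne).symm⟩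
  set F₀ : ℂ × ℂ → ℂ := fun x => a.eval x.1 * x.2 - p.eval x.1 with hF₀
  have hF₀d : ContDiff ℂ 2 F₀ := by
    have h1 : ContDiff ℂ 2 (fun x : ℂ × ℂ => a.eval x.1) := a.differentiable.contDiff.comp contDiff_fst
    have h2 : ContDiff ℂ 2 (fun x : ℂ × ℂ => p.eval x.1) := p.differentiable.contDiff.comp contDiff_fst
    exact (h1.mul contDiff_snd).sub h2
  -- bounds
  obtain ⟨C, hC⟩ : ∃ C : ℝ, ∀ x ∈ cthickening 1 K, U x ≤ (C : EReal) := by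
    obtain ⟨y, hy, hmax⟩ := (hU.1.upperSemicontinuousOn (cthickening 1 K)).exists_isMaxOn
      (hKne.mono (self_subset_cthickening K)) hK.cthickening
    obtain ⟨C, hC⟩ : ∃ C : ℝ, U y ≤ (C : EReal) := ⟨_, EReal.le_coe_toReal (hU.2.1 y)⟩
    exact ⟨C, fun x hx => (hmax hx).trans hC⟩
  obtain ⟨M, hM⟩ := hK.exists_bound_of_continuousOn (f := F₀) hF₀d.continuous.continuousOn
  obtain ⟨R, hR⟩ := hK.exists_bound_of_continuousOn
    (f := fun x : ℂ × ℂ => Complex.normSq x.1 + Complex.normSq x.2)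
    (by
      have := Complex.continuous_normSq
      fun_prop)
  have hR0 : 0 ≤ R := by
    obtain ⟨y, hy⟩ := hKne
    exact (norm_nonneg _).trans (hR y hy)
  set τ := (F₀ (z₁, w)).re - t with hτ
  have hτ0 : 0 < τ := by
    have e : F₀ (z₁, w) = (a.eval z₁ * f z₁ - p.eval z₁) + a.eval z₁ * (w - f z₁) := by
      simp only [hF₀]; ring
    have h1 : |(a.eval z₁ * (w - f z₁)).re| ≤ ‖a.eval z₁‖ * s := by
      refine (Complex.abs_re_le_norm _).trans ?_
      rw [norm_mul, hw]
    have h2 := (abs_le.1 h1).1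
    have : (F₀ (z₁, w)).re = (a.eval z₁ * f z₁ - p.eval z₁).re + (a.eval z₁ * (w - f z₁)).re := by
      rw [e, Complex.add_re]
    rw [hτ, this]
    linarith
  obtain ⟨N, hN0, hN⟩ : ∃ N : ℝ, 0 ≤ N ∧ C + 2 - β ≤ N * τ := by
    refine ⟨max 0 ((C + 2 - β) / τ), le_max_left _ _, ?_⟩
    rw [← div_le_iff₀ hτ0]
    exact le_max_right _ _
  set m := min C (β + N * (t + τ) - N * M - 2) with hm
  have hm1 : m ≤ C := min_le_left _ _
  have hm2 : m ≤ β + N * (t + τ) - N * M - 2 := min_le_right _ _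
  have hop : IsOpen {x | U x < (m : EReal)} := hU.1.isOpen_preimage _
  have hΓ : IsCompact ((fun z => (z, f z)) '' closedBall a₀ r) :=
    (isCompact_closedBall a₀ r).image_of_continuousOn (continuousOn_id.prodMk hf)
  obtain ⟨ε₀, hε₀, hthick⟩ := hΓ.exists_thickening_subset_open hop (by
    rintro _ ⟨z, hz, rfl⟩
    change U (z, f z) < _
    rw [hbot z hz]
    exact EReal.bot_lt_coe m)
  set ε := min ε₀ 1 with hε
  have hεp : 0 < ε := lt_min hε₀ one_pos
  obtain ⟨v, hvd, hvs, hvge, hvle⟩ := mollify (trunc_usc hU m) (le_trunc hU m) (trunc_csub hU m) hεp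
  set F : ℂ × ℂ → ℂ := fun x => (N : ℂ) * F₀ x with hF
  have hFd : ContDiff ℂ 2 F := contDiff_const.mul hF₀d
  have hFre : ∀ x, (F x).re = N * (F₀ x).re := fun x => by simp [hF]
  have hs1 : CSub (fun x => v x + (F x).re) :=
    hvs.add_re hvd.continuous (hFd.differentiable (by norm_num))
  have hd1 : ContDiff ℝ 2 (fun x => v x + (F x).re) :=
    hvd.add (Complex.reCLM.contDiff.comp (hFd.restrict_scalars ℝ))
  set δ : ℝ := 1 / (R + 1) with hδ
  have hδ0 : 0 < δ := by positivity
  have hT := strictTaylor_of_CSub hd1 hs1 hδ0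
  obtain ⟨y, hyK, hy⟩ := hull_max hK (by
    have := hd1.continuous
    have := Complex.continuous_normSq
    fun_prop) hT hwK
  simp only [hFre] at hy
  have hδR : δ * (Complex.normSq y.1 + Complex.normSq y.2) ≤ 1 := by
    have h1 := (le_abs_self _).trans (hR y hyK)
    calc δ * (Complex.normSq y.1 + Complex.normSq y.2) ≤ δ * R := by gcongr
      _ ≤ 1 := by
        rw [hδ, one_div, inv_mul_eq_div, div_le_one (by positivity)]
        linarith
  have hp0 : 0 ≤ δ * (Complex.normSq z₁ + Complex.normSq w) := by
    have := Complex.normSq_nonneg z₁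
    have := Complex.normSq_nonneg w
    positivity
  have hvp : β ≤ v (z₁, w) := by
    refine le_trans ?_ (hvge _)
    have := trunc_ge hU m (z₁, w)
    rw [hβ, EReal.coe_le_coe_iff] at this
    exact this
  have hFp : (F₀ (z₁, w)).re = t + τ := by rw [hτ]; ring
  rw [hFp] at hy
  obtain ⟨hyB, hy2 | hy2⟩ := hKp y hyK
  · have hvy : v y ≤ m := by
      refine hvle y m fun x hx => ?_
      rw [trunc_le_iff hU]
      refine ⟨?_, le_rfl⟩
      have hx' : x ∈ thickening ε₀ ((fun z => (z, f z)) '' closedBall a₀ r) := by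
        rw [mem_thickening_iff]
        refine ⟨y, ⟨y.1, hyB, Prod.ext rfl hy2.symm⟩, ?_⟩
        rw [mem_ball] at hx
        exact hx.trans_le (min_le_left _ _)
      exact le_of_lt (hthick hx')
    have hFy : N * (F₀ y).re ≤ N * M :=
      mul_le_mul_of_nonneg_left ((Complex.re_le_norm _).trans (hM y hyK)) hN0
    linarith
  · have hvy : v y ≤ C := by
      refine hvle y C fun x hx => ?_
      rw [trunc_le_iff hU]
      refine ⟨hC x (mem_cthickening_of_dist_le x y 1 K hyK ?_), hm1⟩
      rw [mem_ball] at hx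
      exact hx.le.trans (min_le_right _ _)
    have hFy : (F₀ y).re = t := hy2
    rw [hFy] at hy
    have : N * (t + τ) = N * t + N * τ := by ring
    linarith

end PartHB

section PartLP1

open Filter Topology ComplexConjugate MeasureTheory
set_option linter.unusedSectionVars false

theorem sqrt_add_le' (a b : ℝ) (ha : 0 ≤ a) (hb : 0 ≤ b) : √(a + b) ≤ √a + √b := by
  rw [Real.sqrt_le_iff]
  refine ⟨by positivity, ?_⟩
  nlinarith [Real.mul_self_sqrt ha, Real.mul_self_sqrt hb,
    mul_nonneg (Real.sqrt_nonneg a) (Real.sqrt_nonneg b)]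

/-- signed square root -/
def ssq (d : ℝ) : ℝ := √d - √(-d)

theorem ssq_mono : Monotone ssq := fun a b h => by
  unfold ssq
  have h1 := Real.sqrt_le_sqrt h
  have h2 := Real.sqrt_le_sqrt (neg_le_neg h)
  linarith

theorem ssq_holder (y n : ℝ) (hn : 0 ≤ n) : ssq (y + n) - ssq y ≤ 2 * √n := by
  unfold ssq
  have h1 : √(y + n) ≤ √y + √n := by
    rcases le_total 0 y with h | h
    · exact sqrt_add_le' y n h hn
    · have := Real.sqrt_le_sqrt (show y + n ≤ n by linarith)
      have := Real.sqrt_nonneg y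
      linarith
  have h2 : √(-y) ≤ √(-(y + n)) + √n := by
    rcases le_total 0 (-(y+n)) with h | h
    · have := sqrt_add_le' (-(y+n)) n h hn
      rwa [show -(y+n)+n = -y by ring] at this
    · have := Real.sqrt_le_sqrt (show -y ≤ n by linarith)
      have := Real.sqrt_nonneg (-(y+n))
      linarith
  linarith

theorem ssq_step_pos (d : ℝ) (hd : 1 ≤ d) : 1 / √d ≤ 2 * (√d - √(d - 1)) := by
  have h0 : 0 < √d := Real.sqrt_pos.2 (by linarith)
  have h1 : √(d - 1) * √(d-1) = d - 1 := Real.mul_self_sqrt (by linarith)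
  have h2 : √d * √d = d := Real.mul_self_sqrt (by linarith)
  rw [div_le_iff₀ h0]
  nlinarith [sq_nonneg (√d - √(d-1))]

theorem ssq_step (d : ℤ) : 1 / √|(d : ℝ)| ≤ 2 * (ssq (d + 1) - ssq (d - 1)) := by
  rcases lt_trichotomy d 0 with h | h | h
  · have h' : (d : ℝ) ≤ -1 := by exact_mod_cast (by omega : d ≤ -1)
    rw [abs_of_nonpos (by linarith)]
    have h1 := ssq_step_pos (-d) (by linarith)
    have h2 : ssq (d - 1) ≤ ssq d := ssq_mono (by linarith)
    have h3 : ssq (d + 1) - ssq d = √(-(d:ℝ)) - √(-d - 1) := by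
      unfold ssq
      rw [Real.sqrt_eq_zero_of_nonpos (by linarith : (d:ℝ) + 1 ≤ 0),
        Real.sqrt_eq_zero_of_nonpos (by linarith : (d:ℝ) ≤ 0), show -((d:ℝ)+1) = -d - 1 by ring]
      ring
    linarith
  · subst h
    have := ssq_mono (show ((0:ℤ):ℝ) - 1 ≤ (0:ℤ) + 1 by norm_num)
    simp only [Int.cast_zero, abs_zero, Real.sqrt_zero, div_zero] at *
    linarith
  · have h' : (1 : ℝ) ≤ d := by exact_mod_cast (by omega : 1 ≤ d)
    rw [abs_of_nonneg (by linarith)]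
    have h1 := ssq_step_pos d h'
    have h2 : ssq d ≤ ssq (d + 1) := ssq_mono (by linarith)
    have h3 : ssq d - ssq (d - 1) = √(d:ℝ) - √(d - 1) := by
      unfold ssq
      rw [Real.sqrt_eq_zero_of_nonpos (by linarith : -(d:ℝ) ≤ 0),
        Real.sqrt_eq_zero_of_nonpos (by linarith : -((d:ℝ)-1) ≤ 0)]
      ring
    linarith

theorem sum_inv_sqrt (n : ℕ) (j₀ : ℤ) :
    ∑ j ∈ Finset.range n, 1 / √|((j : ℝ) - j₀)| ≤ 8 * √n := by
  have h1 : ∀ n : ℕ, ∑ j ∈ Finset.range n, 1 / √|((j : ℝ) - j₀)| ≤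
      2 * (ssq ((-j₀ : ℝ) + n) - ssq (-j₀)) + 2 * (ssq ((-j₀ - 1 : ℝ) + n) - ssq (-j₀ - 1)) := by
    intro n
    induction n with
    | zero => simp
    | succ n ih =>
      rw [Finset.sum_range_succ]
      have := ssq_step ((n : ℤ) - j₀)
      push_cast at this ⊢
      rw [show (-j₀ : ℝ) + (n + 1) = n - j₀ + 1 by ring, show (-j₀ - 1 : ℝ) + (n + 1) = -j₀ + n by ring]
      rw [show (n - j₀ - 1 : ℝ) = (-j₀ - 1 : ℝ) + n by ring] at this
      linarith
  have h2 := ssq_holder (-j₀) n (by positivity)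
  have h3 := ssq_holder (-j₀ - 1) n (by positivity)
  linarith [h1 n]

theorem neg_log_le (t : ℝ) (ht : 0 < t) : -Real.log t ≤ 2 * (1 / √t) := by
  have h0 : 0 < √t := Real.sqrt_pos.2 ht
  have h1 := Real.log_le_sub_one_of_pos (show 0 < 1 / √t by positivity)
  have h2 : Real.log (1 / √t) = - (Real.log t / 2) := by
    rw [one_div, Real.log_inv, Real.log_sqrt ht.le]
  rw [h2] at h1
  linarith

theorem nodes_bound {L r₁ : ℝ} (hL : 0 < L) {n : ℕ} (hn : 0 < n) {w : ℕ → ℂ}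
    (hw : ∀ j, ‖w j‖ = r₁ + L * j / n) {z : ℂ}
    (hz : ∀ j ∈ Finset.range n, Real.exp (-n) ≤ ‖z - w j‖) :
    -((1 + 16 * √(2 / L)) * n) ≤ ∑ j ∈ Finset.range n, Real.log ‖z - w j‖ := by
  have hn' : (0 : ℝ) < n := by exact_mod_cast hn
  set x := (‖z‖ - r₁) * n / L with hx
  set j₀ := round x with hj₀
  have hterm : ∀ j ∈ Finset.range n, -Real.log ‖z - w j‖ ≤
      (if (j : ℤ) = j₀ then (n : ℝ) else 0) + 2 * (√(2 / L) * √n) * (1 / √|((j : ℝ) - j₀)|) := by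
    intro j hj
    have hpos : 0 < ‖z - w j‖ := (Real.exp_pos _).trans_le (hz j hj)
    split_ifs with h
    · have h1 := Real.log_le_log (Real.exp_pos _) (hz j hj)
      rw [Real.log_exp] at h1
      have : 0 ≤ 2 * (√(2 / L) * √n) * (1 / √|((j : ℝ) - j₀)|) := by positivity
      linarith
    · have hd : (1 : ℝ) ≤ |(j : ℝ) - j₀| := by
        have : (1 : ℤ) ≤ |(j : ℤ) - j₀| := Int.one_le_abs (sub_ne_zero.2 h)
        exact_mod_cast this
      have h1 : |(j : ℝ) - j₀| / 2 ≤ |x - j| := by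
        have h2 : |x - j₀| ≤ 1 / 2 := abs_sub_round x
        have h3 := abs_sub_le (j : ℝ) x j₀
        rw [abs_sub_comm (j : ℝ) x] at h3
        linarith
      have h2 : L / n * |x - j| ≤ ‖z - w j‖ := by
        have h3 := abs_norm_sub_norm_le z (w j)
        rw [hw] at h3
        refine le_trans (le_of_eq ?_) h3
        rw [show ‖z‖ - (r₁ + L * j / n) = L / n * (x - j) by rw [hx]; field_simp; ring, abs_mul,
          abs_of_pos (show 0 < L / n by positivity)]
      have h3 : L / (2 * n) * |(j : ℝ) - j₀| ≤ ‖z - w j‖ := by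
        refine le_trans ?_ h2
        calc L / (2 * n) * |(j : ℝ) - j₀| = L / n * (|(j : ℝ) - j₀| / 2) := by field_simp
          _ ≤ _ := by gcongr
      have h4 : 0 < L / (2 * n) * |(j : ℝ) - j₀| := by positivity
      have h5 := Real.log_le_log h4 h3
      have h6 := neg_log_le _ h4
      have h7 : 1 / √(L / (2 * n) * |(j : ℝ) - j₀|) = √(2 / L) * √n * (1 / √|((j : ℝ) - j₀)|) := by
        have e : √(L / (2 * n)) = (√(2 / L) * √n)⁻¹ := by
          rw [← Real.sqrt_mul (by positivity), ← Real.sqrt_inv]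
          congr 1
          field_simp
        rw [Real.sqrt_mul (by positivity), e, one_div, mul_inv, inv_inv, one_div]
      rw [h7] at h6
      linarith
  have hsum := Finset.sum_le_sum hterm
  rw [Finset.sum_add_distrib, ← Finset.mul_sum, Finset.sum_neg_distrib] at hsum
  have hs1 : ∑ j ∈ Finset.range n, (if (j : ℤ) = j₀ then (n : ℝ) else 0) ≤ n := by
    rw [← Finset.sum_filter, Finset.sum_const, nsmul_eq_mul]
    have : (Finset.filter (fun j : ℕ => (j : ℤ) = j₀) (Finset.range n)).card ≤ 1 := by
      rw [Finset.card_le_one]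
      intro a ha b hb
      simp only [Finset.mem_filter] at ha hb
      have := ha.2.trans hb.2.symm
      exact_mod_cast this
    have : ((Finset.filter (fun j : ℕ => (j : ℤ) = j₀) (Finset.range n)).card : ℝ) ≤ 1 := by
      exact_mod_cast this
    nlinarith
  have hs2 := sum_inv_sqrt n j₀
  have hs3 : 2 * (√(2 / L) * √n) * ∑ j ∈ Finset.range n, 1 / √|((j : ℝ) - j₀)| ≤
      16 * √(2 / L) * n := by
    calc _ ≤ 2 * (√(2 / L) * √n) * (8 * √n) := by gcongr
      _ = 16 * √(2/L) * (√n * √n) := by ring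
      _ = _ := by rw [Real.mul_self_sqrt hn'.le]
  linarith

end PartLP1

section PartLP2

open Filter Topology ComplexConjugate MeasureTheory
set_option linter.unusedSectionVars false

/-- subharmonic functions on the plane, in an affinely invariant form -/
def SH (s : ℂ → EReal) : Prop :=
  UpperSemicontinuous s ∧ (∀ x, s x ≠ ⊤) ∧
    ∀ x h : ℂ, SubharmonicOn (fun t : ℂ => s (x + t • h)) univ

theorem SH.psh2 {s : ℂ → EReal} (hs : SH s) : PSH2 (fun x => s x.2) :=
  ⟨hs.1.comp continuous_snd, fun _ => hs.2.1 _, fun x h => hs.2.2 x.2 h.2⟩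

theorem max_princ {v : ℂ → ℝ} (husc : UpperSemicontinuous v) {m : ℝ} (hm : ∀ z, m ≤ v z)
    (hsub : ∀ c h : ℂ, v c ≤ Real.circleAverage (fun t => v (c + t • h)) 0 1)
    {K : Set ℂ} (hK : IsCompact K) {P : Polynomial ℂ} (hP : ∀ z ∈ K, P.eval z ≠ 0) {κ B : ℝ}
    (hB : ∀ y ∈ K, v y - κ * Real.log ‖P.eval y‖ ≤ B ∨ ∃ ρ > 0, closedBall y ρ ⊆ K)
    {z : ℂ} (hz : z ∈ K) : v z - κ * Real.log ‖P.eval z‖ ≤ B := by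
  obtain ⟨R, hR⟩ := hK.exists_bound_of_continuousOn (f := Complex.normSq)
    Complex.continuous_normSq.continuousOn
  have hR0 : 0 ≤ R := (norm_nonneg _).trans (hR z hz)
  refine le_of_forall_pos_le_add fun η hη => ?_
  set ε := η / (R + 1) with hε
  have hε0 : 0 < ε := by positivity
  have hεR : ε * R ≤ η := by
    rw [hε, div_mul_eq_mul_div, div_le_iff₀ (by positivity)]
    nlinarith
  have hlog : ContinuousOn (fun y => -(κ * Real.log ‖P.eval y‖) + ε * Complex.normSq y) K := by
    refine ContinuousOn.add (ContinuousOn.neg (continuousOn_const.mul (ContinuousOn.log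
      P.continuous.norm.continuousOn fun y hy => norm_ne_zero_iff.2 (hP y hy)))) ?_
    exact (continuous_const.mul Complex.continuous_normSq).continuousOn
  have hψ : UpperSemicontinuousOn
      (fun y => v y + (-(κ * Real.log ‖P.eval y‖) + ε * Complex.normSq y)) K :=
    (husc.upperSemicontinuousOn K).add hlog.upperSemicontinuousOn
  obtain ⟨y, hy, hmax⟩ := hψ.exists_isMaxOn ⟨z, hz⟩ hK
  have hzy := hmax hz
  simp only [mem_ofPred_eq] at hzy
  have hz0 : 0 ≤ ε * Complex.normSq z := mul_nonneg hε0.le (Complex.normSq_nonneg z)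
  rcases hB y hy with h | ⟨ρ, hρ, hball⟩
  · have h2 : ε * Complex.normSq y ≤ ε * R :=
      mul_le_mul_of_nonneg_left ((le_abs_self _).trans (hR y hy)) hε0.le
    linarith
  · exfalso
    have hmem : ∀ t ∈ closedBall (0 : ℂ) 1, y + t • (ρ : ℂ) ∈ K := fun t ht => by
      refine hball ?_
      rw [mem_closedBall_zero_iff] at ht
      rw [mem_closedBall, dist_eq_norm, add_sub_cancel_left, smul_eq_mul, norm_mul,
        Complex.norm_real, Real.norm_of_nonneg hρ.le]
      nlinarith
    set c₀ := v y + (-(κ * Real.log ‖P.eval y‖) + ε * Complex.normSq y) with hc₀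
    set lg : ℂ → ℝ := fun t => Real.log ‖P.eval (y + t • (ρ : ℂ))‖ with hlg
    set G : ℂ → ℂ := fun t => (c₀ - ε * (Complex.normSq y + ρ ^ 2) : ℝ)
      - (2 * ε * ρ : ℝ) * (conj y * t) with hG
    have hGd : Differentiable ℂ G := by fun_prop
    have hGa := circleAverage_re_entire hGd 1
    have hGc : Continuous (fun t => (G t).re) := by
      have := hGd.continuous
      fun_prop
    have hG0 : (G 0).re = c₀ - ε * (Complex.normSq y + ρ ^ 2) := by
      rw [hG]; simp [-Complex.ofReal_sub, -Complex.ofReal_mul]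
    have hlgc : ContinuousOn lg (sphere 0 |1|) := by
      refine ContinuousOn.log (by fun_prop) fun t ht => norm_ne_zero_iff.2 (hP _ (hmem _ ?_))
      rw [abs_one] at ht
      exact sphere_subset_closedBall ht
    have hlga : Real.circleAverage lg 0 1 = Real.log ‖P.eval y‖ := by
      have := AnalyticOnNhd.circleAverage_log_norm_of_ne_zero (c := 0) (R := 1)
        (g := fun t => P.eval (y + t • (ρ : ℂ))) ?_ ?_
      · simp only [zero_smul, add_zero] at this
        exact this
      · intro t _
        refine Differentiable.analyticAt (f := fun t => P.eval (y + t • (ρ : ℂ))) ?_ t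
        have := P.differentiable
        exact this.comp (by fun_prop)
      · intro t ht
        rw [abs_one] at ht
        exact hP _ (hmem _ ht)
    have hle : ∀ t ∈ sphere (0 : ℂ) |1|, v (y + t • (ρ : ℂ)) ≤ (G t).re + κ * lg t := by
      intro t ht
      rw [abs_one] at ht
      have h1 := hmax (hmem t (sphere_subset_closedBall ht))
      simp only [mem_ofPred_eq] at h1
      have h2 : Complex.normSq (y + t • (ρ : ℂ)) =
          Complex.normSq y + ρ ^ 2 + 2 * ρ * (conj y * t).re := by
        have h3 : Complex.normSq t = 1 := by
          rw [Complex.normSq_eq_norm_sq, mem_sphere_zero_iff_norm.1 ht]; norm_num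
        rw [Complex.normSq_apply] at h3
        simp only [Complex.normSq_apply, smul_eq_mul, Complex.add_re, Complex.add_im,
          Complex.mul_re, Complex.mul_im, Complex.ofReal_re, Complex.ofReal_im, Complex.conj_re,
          Complex.conj_im]
        linear_combination ρ ^ 2 * h3
      have h4 : (G t).re = c₀ - ε * (Complex.normSq y + ρ ^ 2) - 2 * ε * ρ * (conj y * t).re := by
        simp only [hG, Complex.sub_re, Complex.re_ofReal_mul, Complex.ofReal_re]
      rw [h2] at h1
      rw [h4]
      simp only [hlg]
      linarith
    have hvi : CircleIntegrable (fun t => v (y + t • (ρ : ℂ))) 0 1 := by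
      have husc' : UpperSemicontinuous (fun t : ℂ => v (y + t • (ρ : ℂ))) :=
        husc.comp (by fun_prop : Continuous fun t : ℂ => y + t • (ρ : ℂ))
      obtain ⟨C, -, hC⟩ := usc_bdd husc' (fun t => hm _) (isCompact_sphere (0 : ℂ) 1)
      unfold CircleIntegrable
      rw [intervalIntegrable_iff]
      refine Measure.integrableOn_of_bounded (M := C) (by simp [ENNReal.mul_eq_top])
        (husc'.measurable.comp (continuous_circleMap 0 1).measurable).aestronglyMeasurable ?_
      refine Eventually.of_forall fun θ => hC _ ?_
      exact circleMap_mem_sphere 0 zero_le_one θ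
    have hκi : CircleIntegrable (fun t => κ * lg t) 0 1 :=
      (continuousOn_const.mul hlgc).circleIntegrable'
    have h5 : v y ≤ Real.circleAverage (fun t => (G t).re + κ * lg t) 0 1 :=
      (hsub y ρ).trans (Real.circleAverage_mono hvi
        (hGc.continuousOn.circleIntegrable'.add hκi) hle)
    have h6 : Real.circleAverage (fun t => (G t).re + κ * lg t) 0 1 =
        (G 0).re + κ * Real.log ‖P.eval y‖ := by
      rw [Real.circleAverage_fun_add hGc.continuousOn.circleIntegrable' hκi, hGa, ← hlga]
      congr 1
      exact Real.circleAverage_fun_smul (a := κ) (f := lg)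
    rw [h6, hG0] at h5
    have : 0 < ε * ρ ^ 2 := by positivity
    linarith

end PartLP2

section PartLP3

open Filter Topology ComplexConjugate MeasureTheory
set_option linter.unusedSectionVars false

theorem unif_delta {V : Set ℂ} (hV : IsOpen V) {r₁ r₂ : ℝ} (hr₁ : 0 < r₁)
    (h : ∀ r ∈ Icc r₁ r₂, ∃ w ∈ V, ‖w‖ = r) :
    ∃ δ > 0, ∀ r ∈ Icc r₁ r₂, ∃ w, ‖w‖ = r ∧ ball w δ ⊆ V := by
  have key : ∃ δ > 0, ∀ r ∈ Icc r₁ r₂, ∀ δ' ≤ δ, ∃ w, ‖w‖ = r ∧ ball w δ' ⊆ V := by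
    refine (isCompact_Icc (a := r₁) (b := r₂)).induction_on
      (p := fun S => ∃ δ > 0, ∀ r ∈ S, ∀ δ' ≤ δ, ∃ w, ‖w‖ = r ∧ ball w δ' ⊆ V) ?_ ?_ ?_ ?_
    · exact ⟨1, one_pos, by simp⟩
    · rintro S T hST ⟨δ, hδ, h⟩
      exact ⟨δ, hδ, fun r hr => h r (hST hr)⟩
    · rintro S T ⟨δ, hδ, h⟩ ⟨δ', hδ', h'⟩
      refine ⟨min δ δ', lt_min hδ hδ', ?_⟩
      rintro r (hr | hr) δ'' hd
      · exact h r hr δ'' (hd.trans (min_le_left _ _))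
      · exact h' r hr δ'' (hd.trans (min_le_right _ _))
    · intro r hr
      obtain ⟨w, hwV, hw⟩ := h r hr
      have hr0 : 0 < r := hr₁.trans_le hr.1
      obtain ⟨ε, hε, hball⟩ := Metric.isOpen_iff.1 hV w hwV
      refine ⟨ball r (ε / 2) ∩ Ioi 0, ?_, ε / 2, half_pos hε, ?_⟩
      · exact mem_nhdsWithin_of_mem_nhds (inter_mem (ball_mem_nhds _ (half_pos hε)) (Ioi_mem_nhds hr0))
      · rintro r' ⟨hr', hr'0⟩ δ' hδ'
        rw [mem_Ioi] at hr'0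
        refine ⟨((r' / r : ℝ) : ℂ) * w, ?_, ?_⟩
        · rw [norm_mul, Complex.norm_real, hw, Real.norm_of_nonneg (by positivity)]
          field_simp
        · intro x hx
          refine hball ?_
          rw [mem_ball, dist_eq_norm] at hx hr' ⊢
          have h1 : ‖((r' / r : ℝ) : ℂ) * w - w‖ = |r' - r| := by
            have : ((r' / r : ℝ) : ℂ) * w - w = (((r' - r) / r : ℝ) : ℂ) * w := by
              have : (r : ℂ) ≠ 0 := by exact_mod_cast hr0.ne'
              push_cast
              field_simp
            rw [this, norm_mul, hw, Complex.norm_real, Real.norm_eq_abs, abs_div, abs_of_pos hr0]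
            field_simp
          rw [Real.norm_eq_abs] at hr'
          calc ‖x - w‖ = ‖(x - ((r' / r : ℝ) : ℂ) * w) + (((r' / r : ℝ) : ℂ) * w - w)‖ := by
                congr 1; ring
            _ ≤ _ := norm_add_le _ _
            _ < ε := by rw [h1]; linarith
  obtain ⟨δ, hδ, h⟩ := key
  exact ⟨δ, hδ, fun r hr => h r hr δ le_rfl⟩

theorem polar_circles₀ {s : ℂ → EReal} (hs : SH s) {r₀ : ℝ} (hr₀ : 0 < r₀)
    (h : ∀ r, 0 < r → r < r₀ → ∃ w, ‖w‖ = r ∧ s w = ⊥) (ζ : ℂ) : s ζ = ⊥ := by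
  by_contra hne
  obtain ⟨β, hβ⟩ : ∃ β : ℝ, s ζ = (β : EReal) := ⟨_, (EReal.coe_toReal (hs.2.1 _) hne).symm⟩
  set L := r₀ / 3 with hL
  have hL0 : 0 < L := by positivity
  set R := 2 * (‖ζ‖ + r₀) + r₀ with hR
  have hζ0 := norm_nonneg ζ
  obtain ⟨C, hC⟩ : ∃ C : ℝ, ∀ x ∈ closedBall (0 : ℂ) R, s x ≤ (C : EReal) := by
    obtain ⟨y, hy, hmax⟩ := (hs.1.upperSemicontinuousOn (closedBall (0:ℂ) R)).exists_isMaxOn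
      ⟨0, by rw [mem_closedBall, dist_self]; positivity⟩ (isCompact_closedBall 0 R)
    obtain ⟨C, hC⟩ : ∃ C : ℝ, s y ≤ (C : EReal) := ⟨_, EReal.le_coe_toReal (hs.2.1 y)⟩
    exact ⟨C, fun x hx => (hmax hx).trans hC⟩
  set D := Real.log (2 * (‖ζ‖ + r₀)) with hD
  set A₀ := 1 + 16 * √(2 / L) with hA₀
  set A := |D| + A₀ with hA
  have hA0 : 0 < A := by positivity
  have hlog2 : 0 < Real.log 2 := Real.log_pos (by norm_num)
  obtain ⟨N, hN1, hN2, hN3⟩ : ∃ N : ℝ, 0 ≤ C + N ∧ -N < β ∧ C - (C + N) / A * Real.log 2 < β := by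
    refine ⟨max (-C) (max (-β + 1) ((C - β + 1) * A / Real.log 2 - C)), ?_, ?_, ?_⟩
    · have := le_max_left (-C) (max (-β + 1) ((C - β + 1) * A / Real.log 2 - C))
      linarith
    · have := (le_max_left _ _).trans
        (le_max_right (-C) (max (-β + 1) ((C - β + 1) * A / Real.log 2 - C)))
      linarith
    · have := (le_max_right _ _).trans
        (le_max_right (-C) (max (-β + 1) ((C - β + 1) * A / Real.log 2 - C)))
      set N := max (-C) (max (-β + 1) ((C - β + 1) * A / Real.log 2 - C))
      have h1 : (C - β + 1) * A / Real.log 2 ≤ C + N := by linarith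
      rw [div_le_iff₀ hlog2] at h1
      have h2 : C - β + 1 ≤ (C + N) / A * Real.log 2 := by
        rw [div_mul_eq_mul_div, le_div_iff₀ hA0]; exact h1
      linarith
  set k := (C + N) / A with hk
  have hk0 : 0 ≤ k := by positivity
  have hkA : k * A = C + N := by rw [hk]; field_simp
  set V : Set ℂ := {x | s x < ((-N : ℝ) : EReal)} with hV
  have hVo : IsOpen V := hs.1.isOpen_preimage _
  obtain ⟨δ, hδ, hδV⟩ := unif_delta hVo (r₁ := L) (r₂ := 2 * L) hL0 (fun r hr => by
    obtain ⟨w, hw, hb⟩ := h r (hL0.trans_le hr.1) (hr.2.trans_lt (by rw [hL]; linarith))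
    refine ⟨w, ?_, hw⟩
    change s w < _
    rw [hb]
    exact EReal.bot_lt_coe _)
  obtain ⟨n, hn0, hn⟩ : ∃ n : ℕ, 0 < n ∧ Real.exp (-n) < δ := by
    have h1 : Tendsto (fun n : ℕ => Real.exp (-(n : ℝ))) atTop (𝓝 0) :=
      Real.tendsto_exp_neg_atTop_nhds_zero.comp tendsto_natCast_atTop_atTop
    obtain ⟨n, hn, hn'⟩ := ((h1.eventually_lt_const hδ).and (eventually_gt_atTop 0)).exists
    exact ⟨n, hn', hn⟩
  have hn' : (0 : ℝ) < n := by exact_mod_cast hn0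
  have hchoose : ∀ j : ℕ, ∃ w : ℂ, ‖w‖ = L + L * j / n ∧ (j < n → ball w δ ⊆ V) := by
    intro j
    by_cases hj : j < n
    · obtain ⟨w, hw, hwV⟩ := hδV (L + L * j / n) ⟨by
        have : 0 ≤ L * j / n := by positivity
        linarith, by
        have : L * j / n ≤ L := by
          rw [div_le_iff₀ hn']
          have : (j : ℝ) ≤ n := by exact_mod_cast hj.le
          gcongr
        linarith⟩
      exact ⟨w, hw, fun _ => hwV⟩
    · refine ⟨((L + L * j / n : ℝ) : ℂ), ?_, fun h => absurd h hj⟩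
      rw [Complex.norm_real, Real.norm_of_nonneg (by positivity)]
  choose w hw hwV using hchoose
  have hwr : ∀ j < n, ‖w j‖ ≤ r₀ := by
    intro j hj
    rw [hw]
    have : L * j / n ≤ L := by
      rw [div_le_iff₀ hn']
      have : (j : ℝ) ≤ n := by exact_mod_cast hj.le
      gcongr
    rw [hL] at *
    linarith
  set P : Polynomial ℂ := ∏ j ∈ Finset.range n, (X - Polynomial.C (w j)) with hP
  have hPe : ∀ z, P.eval z = ∏ j ∈ Finset.range n, (z - w j) := by
    intro z; simp [hP, Polynomial.eval_prod]
  set K : Set ℂ := closedBall 0 R ∩ {z | ∀ j ∈ Finset.range n, Real.exp (-n) ≤ ‖z - w j‖} with hK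
  have hKc : IsCompact K := by
    refine (isCompact_closedBall 0 R).inter_right ?_
    have : {z : ℂ | ∀ j ∈ Finset.range n, Real.exp (-n) ≤ ‖z - w j‖} =
        ⋂ j ∈ Finset.range n, {z : ℂ | Real.exp (-n) ≤ ‖z - w j‖} := by
      ext; simp
    rw [this]
    exact isClosed_biInter fun j _ => isClosed_le continuous_const (by fun_prop)
  have hne0 : ∀ z ∈ K, ∀ j ∈ Finset.range n, ‖z - w j‖ ≠ 0 := fun z hz j hj =>
    ((Real.exp_pos _).trans_le (hz.2 j hj)).ne'
  have hPlog : ∀ z ∈ K, Real.log ‖P.eval z‖ = ∑ j ∈ Finset.range n, Real.log ‖z - w j‖ := by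
    intro z hz
    rw [hPe, norm_prod, Real.log_prod (hne0 z hz)]
  have hPne : ∀ z ∈ K, P.eval z ≠ 0 := by
    intro z hz
    rw [hPe, Finset.prod_ne_zero_iff]
    exact fun j hj => norm_ne_zero_iff.1 (hne0 z hz j hj)
  set U : ℂ × ℂ → EReal := fun x => s x.2 with hUdef
  have hU : PSH2 U := hs.psh2
  set v : ℂ → ℝ := fun z => trunc U (-N) (0, z) with hv
  have hvusc : UpperSemicontinuous v :=
    (trunc_usc hU (-N)).comp (by fun_prop : Continuous fun z : ℂ => ((0 : ℂ), z))
  have hvsub : ∀ c h : ℂ, v c ≤ Real.circleAverage (fun t => v (c + t • h)) 0 1 := by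
    intro c h
    have := trunc_csub hU (-N) (0, c) (0, h)
    simpa [hv] using this
  have hvle : ∀ z (C' : ℝ), s z ≤ (C' : EReal) → -N ≤ C' → v z ≤ C' := fun z C' h1 h2 =>
    (trunc_le_iff hU (-N) (0, z) C').2 ⟨h1, h2⟩
  have hkn : ∀ x : ℝ, k / n * (n * x) = k * x := fun x => by field_simp
  have hmain : ∀ z ∈ K, v z - k / n * Real.log ‖P.eval z‖ ≤ C - k * D := by
    intro z hz
    refine max_princ hvusc (fun z => le_trunc hU (-N) (0, z)) hvsub hKc hPne ?_ hz
    intro y hy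
    by_cases h1 : ‖y‖ = R
    · left
      have h2 := hvle y C (hC y hy.1) (by linarith)
      have h3 : n * D ≤ Real.log ‖P.eval y‖ := by
        rw [hPlog y hy]
        have : ∀ j ∈ Finset.range n, D ≤ Real.log ‖y - w j‖ := by
          intro j hj
          refine Real.log_le_log (by positivity) ?_
          have := norm_sub_norm_le y (w j)
          have := hwr j (Finset.mem_range.1 hj)
          linarith
        have := Finset.sum_le_sum this
        rw [Finset.sum_const, Finset.card_range, nsmul_eq_mul] at this
        exact this
      have h4 : k / n * (n * D) ≤ k / n * Real.log ‖P.eval y‖ := by gcongr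
      rw [hkn] at h4
      linarith
    by_cases h2 : ∃ j ∈ Finset.range n, ‖y - w j‖ = Real.exp (-n)
    · left
      obtain ⟨j, hj, hje⟩ := h2
      have h3 : s y < ((-N : ℝ) : EReal) := hwV j (Finset.mem_range.1 hj) (by
        rw [mem_ball, dist_eq_norm, hje]; exact hn)
      have h4 := hvle y (-N) h3.le le_rfl
      have h5 := nodes_bound hL0 hn0 hw hy.2
      rw [← hPlog y hy] at h5
      have h6 : k / n * (-(A₀ * n)) ≤ k / n * Real.log ‖P.eval y‖ := by gcongr
      have h7 : k / n * (-(A₀ * n)) = - (k * A₀) := by rw [← hkn A₀]; ring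
      have h8 : k * D ≤ k * |D| := by gcongr; exact le_abs_self D
      have h9 : k * A = k * |D| + k * A₀ := by rw [hA]; ring
      linarith
    · right
      push Not at h2
      have hopen : IsOpen (ball (0 : ℂ) R ∩ ⋂ j ∈ Finset.range n, {z : ℂ | Real.exp (-n) < ‖z - w j‖}) := by
        refine isOpen_ball.inter (isOpen_biInter_finset fun j _ => ?_)
        exact isOpen_lt continuous_const (by fun_prop)
      have hyo : y ∈ (ball (0 : ℂ) R ∩ ⋂ j ∈ Finset.range n, {z : ℂ | Real.exp (-n) < ‖z - w j‖}) := by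
        refine ⟨?_, ?_⟩
        · have := mem_closedBall_zero_iff.1 hy.1
          exact mem_ball_zero_iff.2 (lt_of_le_of_ne this h1)
        · simp only [mem_iInter]
          exact fun j hj => lt_of_le_of_ne (hy.2 j hj) (h2 j hj).symm
      obtain ⟨ρ, hρ, hρs⟩ := nhds_basis_closedBall.mem_iff.1 (hopen.mem_nhds hyo)
      refine ⟨ρ, hρ, hρs.trans fun x hx => ⟨ball_subset_closedBall hx.1, fun j hj => ?_⟩⟩
      have := hx.2
      simp only [mem_iInter] at this
      exact le_of_lt (this j hj)
  by_cases hζK : ζ ∈ K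
  · have h1 := hmain ζ hζK
    have h2 : β ≤ v ζ := by
      have := trunc_ge hU (-N) (0, ζ)
      simp only [hUdef, hβ, EReal.coe_le_coe_iff] at this
      exact this
    have h3 : Real.log ‖P.eval ζ‖ ≤ n * (D - Real.log 2) := by
      rw [hPlog ζ hζK]
      have : ∀ j ∈ Finset.range n, Real.log ‖ζ - w j‖ ≤ D - Real.log 2 := by
        intro j hj
        rw [hD, Real.log_mul (by norm_num) (by positivity), add_sub_cancel_left]
        refine Real.log_le_log (lt_of_le_of_ne (norm_nonneg _) (hne0 ζ hζK j hj).symm) ?_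
        have := norm_sub_le ζ (w j)
        have := hwr j (Finset.mem_range.1 hj)
        linarith
      have := Finset.sum_le_sum this
      rw [Finset.sum_const, Finset.card_range, nsmul_eq_mul] at this
      exact this
    have h4 : k / n * Real.log ‖P.eval ζ‖ ≤ k / n * (n * (D - Real.log 2)) := by gcongr
    rw [hkn, mul_sub] at h4
    linarith
  · have : ζ ∈ closedBall (0 : ℂ) R := by
      rw [mem_closedBall_zero_iff, hR]; linarith
    have h2 : ¬ (∀ j ∈ Finset.range n, Real.exp (-n) ≤ ‖ζ - w j‖) := fun h => hζK ⟨this, h⟩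
    push Not at h2
    obtain ⟨j, hj, hjl⟩ := h2
    have h3 : s ζ < ((-N : ℝ) : EReal) := hwV j (Finset.mem_range.1 hj) (by
      rw [mem_ball, dist_eq_norm]; exact hjl.trans hn)
    rw [hβ, EReal.coe_lt_coe_iff] at h3
    linarith

theorem polar_circles {s : ℂ → EReal} (hs : SH s) {r₀ : ℝ} (hr₀ : 0 < r₀) {w₀ : ℂ}
    (h : ∀ r, 0 < r → r < r₀ → ∃ w, ‖w - w₀‖ = r ∧ s w = ⊥) (ζ : ℂ) : s ζ = ⊥ := by
  have hs' : SH (fun w => s (w₀ + w)) := by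
    refine ⟨hs.1.comp (by fun_prop : Continuous fun w : ℂ => w₀ + w), fun x => hs.2.1 _, ?_⟩
    intro x h
    have := hs.2.2 (w₀ + x) h
    simpa only [add_assoc] using this
  have := polar_circles₀ hs' hr₀ (fun r h1 h2 => by
    obtain ⟨w, hw, hb⟩ := h r h1 h2
    exact ⟨w - w₀, hw, by simpa using hb⟩) (ζ - w₀)
  simpa using this

theorem polar_open {s : ℂ → EReal} (hs : SH s) {w₀ : ℂ}
    (h : ∀ᶠ w in 𝓝 w₀, s w = ⊥) (ζ : ℂ) : s ζ = ⊥ := by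
  obtain ⟨ε, hε, hb⟩ := Metric.eventually_nhds_iff.1 h
  refine polar_circles hs hε (w₀ := w₀) (fun r h1 h2 => ⟨w₀ + r, ?_, hb ?_⟩) ζ
  · rw [add_sub_cancel_left, Complex.norm_real, Real.norm_of_nonneg h1.le]
  · rw [dist_eq_norm, add_sub_cancel_left, Complex.norm_real, Real.norm_of_nonneg h1.le]
    exact h2

end PartLP3

section PartCrit

open Filter Topology ComplexConjugate MeasureTheory
set_option linter.unusedSectionVars false

/-- `Re (a f)` obeys the maximum principle relative to `Re p` -/
def HMax (f : ℂ → ℂ) (Ω : Set ℂ) : Prop :=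
  ∀ (a₀ : ℂ) (r : ℝ), 0 < r → closedBall a₀ r ⊆ Ω → ∀ a p : Polynomial ℂ,
    (∀ z ∈ closedBall a₀ r, a.eval z ≠ 0) →
    (∀ z ∈ sphere a₀ r, (a.eval z * f z - p.eval z).re ≤ 0) →
    ∀ z ∈ closedBall a₀ r, (a.eval z * f z - p.eval z).re ≤ 0

theorem norm_circleAverage_le {g : ℂ → ℂ} {c : ℂ} {R C : ℝ} (hR : 0 ≤ R)
    (h : ∀ z ∈ sphere c R, ‖g z‖ ≤ C) : ‖Real.circleAverage g c R‖ ≤ C := by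
  have h1 := intervalIntegral.norm_integral_le_of_norm_le_const (a := 0) (b := 2 * Real.pi) (C := C)
    (f := fun θ => g (circleMap c R θ)) (fun θ _ => h _ (circleMap_mem_sphere c hR θ))
  rw [Real.circleAverage_def, norm_smul, norm_inv, Real.norm_of_nonneg (by positivity)]
  rw [sub_zero, abs_of_pos (by positivity)] at h1
  rw [inv_mul_le_iff₀ (by positivity)]
  linarith

theorem circleAverage_conj {g : ℂ → ℂ} {c : ℂ} {R : ℝ} (hg : Continuous g) :
    Real.circleAverage (fun z => conj (g z)) c R = conj (Real.circleAverage g c R) :=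
  Complex.conjCLE.toContinuousLinearMap.circleAverage_comp_comm
    hg.continuousOn.circleIntegrable'

theorem circleAverage_pq (P Q : Polynomial ℂ) (c : ℂ) (R : ℝ) :
    Real.circleAverage (fun z => P.eval z + conj (Q.eval z)) c R = P.eval c + conj (Q.eval c) := by
  have hP : Differentiable ℂ (fun z => P.eval z) := P.differentiable
  have hQ : Differentiable ℂ (fun z => Q.eval z) := Q.differentiable
  have hQc := hQ.continuous
  rw [Real.circleAverage_fun_add hP.continuous.continuousOn.circleIntegrable'
    (by fun_prop : Continuous fun z => conj (Q.eval z)).continuousOn.circleIntegrable',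
    circleAverage_conj hQc, hP.diffContOnCl.circleAverage, hQ.diffContOnCl.circleAverage]

theorem circleAverage_pq1 (P Q : Polynomial ℂ) (c : ℂ) {R : ℝ} (hR : 0 < R) :
    Real.circleAverage (fun z => (z - c) * (P.eval z + conj (Q.eval z))) c R =
      R ^ 2 * conj (deriv (fun z => Q.eval z) c) := by
  have hP : Differentiable ℂ (fun z => P.eval z) := P.differentiable
  have hQ : Differentiable ℂ (fun z => Q.eval z) := Q.differentiable
  have hPc := hP.continuous
  have hQc := hQ.continuous
  have e : (fun z => (z - c) * (P.eval z + conj (Q.eval z))) =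
      fun z => (z - c) * P.eval z + conj (conj (z - c) * Q.eval z) := by
    funext z
    simp only [map_mul, Complex.conj_conj]
    ring
  have h1 : Real.circleAverage (fun z => (z - c) * P.eval z) c R = 0 := by
    have hd : Differentiable ℂ (fun z => (z - c) * P.eval z) := by fun_prop
    rw [hd.diffContOnCl.circleAverage]
    simp
  have h2 : Real.circleAverage (fun z => conj (z - c) * Q.eval z) c R =
      R ^ 2 * deriv (fun z => Q.eval z) c := by
    rw [Real.circleAverage_eq_circleIntegral hR.ne',
      ← Complex.two_pi_I_inv_smul_circleIntegral_sub_sq_inv_smul_of_differentiable isOpen_univ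
        (subset_univ (closedBall c R)) hQ.differentiableOn (mem_ball_self hR)]
    have : (∮ z in C(c, R), (z - c)⁻¹ • (conj (z - c) * Q.eval z)) =
        ∮ z in C(c, R), ((R : ℂ) ^ 2) • (((z - c) ^ 2)⁻¹ • Q.eval z) := by
      refine circleIntegral.integral_congr hR.le fun z hz => ?_
      have hz0 : z - c ≠ 0 := by
        rw [mem_sphere, dist_eq_norm] at hz
        exact norm_ne_zero_iff.1 (by rw [hz]; exact hR.ne')
      have h3 : (z - c) * conj (z - c) = (R : ℂ) ^ 2 := by
        rw [mem_sphere, dist_eq_norm] at hz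
        rw [Complex.mul_conj, Complex.normSq_eq_norm_sq, hz]
        push_cast
        rfl
      simp only [smul_eq_mul]
      rw [← h3]
      field_simp
    rw [this, circleIntegral.integral_smul]
    simp only [smul_eq_mul]
    ring
  rw [e, Real.circleAverage_fun_add
    (by fun_prop : Continuous fun z => (z - c) * P.eval z).continuousOn.circleIntegrable'
    (by fun_prop : Continuous fun z => conj (conj (z - c) * Q.eval z)).continuousOn.circleIntegrable',
    h1, circleAverage_conj (by fun_prop), h2]
  simp

section
variable {f : ℂ → ℂ} {Ω : Set ℂ} (hH : HMax f Ω) (hf : ContinuousOn f Ω) {a₀ : ℂ} {r : ℝ}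
  (hr : 0 < r) (hB : closedBall a₀ r ⊆ Ω)
include hH hf hr hB

theorem hmax_approx {a : Polynomial ℂ} (ha : ∀ z ∈ closedBall a₀ r, a.eval z ≠ 0) {ε : ℝ}
    (hε : 0 < ε) : ∃ P Q : Polynomial ℂ, ∀ z ∈ closedBall a₀ r,
      ‖a.eval z * f z - (P.eval z + conj (Q.eval z))‖ < ε := by
  obtain ⟨P, Q, hPQ⟩ := circ_approx (φ := fun z => a.eval z * f z) (c := a₀) hr
    (a.continuous.continuousOn.mul (hf.mono (sphere_subset_closedBall.trans hB)))
    (show 0 < ε / 4 by positivity)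
  refine ⟨P, Q, fun z hz => ?_⟩
  have hre : ∀ z ∈ sphere a₀ r, |(a.eval z * f z - (P.eval z + conj (Q.eval z))).re| ≤ ε / 4 :=
    fun z hz => (Complex.abs_re_le_norm _).trans (hPQ z hz).le
  have him : ∀ z ∈ sphere a₀ r, |(a.eval z * f z - (P.eval z + conj (Q.eval z))).im| ≤ ε / 4 :=
    fun z hz => (Complex.abs_im_le_norm _).trans (hPQ z hz).le
  have k1 := hH a₀ r hr hB a (P + Q + C ((ε / 4 : ℝ) : ℂ)) ha (fun z hz => by
    have := (abs_le.1 (hre z hz)).2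
    simp only [eval_add, eval_C, Complex.sub_re, Complex.add_re, Complex.conj_re,
      Complex.ofReal_re] at this ⊢
    linarith) z hz
  have k2 := hH a₀ r hr hB (-a) (-(P + Q) + C ((ε / 4 : ℝ) : ℂ))
    (fun z hz => by rw [eval_neg]; exact neg_ne_zero.2 (ha z hz)) (fun z hz => by
    have := (abs_le.1 (hre z hz)).1
    simp only [eval_add, eval_neg, eval_C, Complex.sub_re, Complex.add_re, Complex.conj_re,
      Complex.ofReal_re, neg_mul, Complex.neg_re] at this ⊢
    linarith) z hz
  have k3 := hH a₀ r hr hB (-(C Complex.I * a)) (-(C Complex.I * (P - Q)) + C ((ε / 4 : ℝ) : ℂ))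
    (fun z hz => by simpa using ha z hz) (fun z hz => by
    have := (abs_le.1 (him z hz)).2
    simp only [eval_add, eval_sub, eval_neg, eval_C, eval_mul, Complex.sub_re, Complex.add_re,
      Complex.sub_im, Complex.add_im, Complex.conj_im, mul_assoc, Complex.I_mul_re,
      Complex.ofReal_re, neg_mul, Complex.neg_re] at this ⊢
    linarith) z hz
  have k4 := hH a₀ r hr hB (C Complex.I * a) (C Complex.I * (P - Q) + C ((ε / 4 : ℝ) : ℂ))
    (fun z hz => by simpa using ha z hz) (fun z hz => by
    have := (abs_le.1 (him z hz)).1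
    simp only [eval_add, eval_sub, eval_neg, eval_C, eval_mul, Complex.sub_re, Complex.add_re,
      Complex.sub_im, Complex.add_im, Complex.conj_im, mul_assoc, Complex.I_mul_re,
      Complex.ofReal_re, neg_mul, Complex.neg_re] at this ⊢
    linarith) z hz
  simp only [eval_add, eval_sub, eval_neg, eval_C, eval_mul, Complex.sub_re, Complex.add_re,
      Complex.sub_im, mul_assoc, Complex.I_mul_re,
      Complex.ofReal_re, neg_mul, Complex.neg_re] at k1 k2 k3 k4
  have j1 : |(a.eval z * f z - (P.eval z + conj (Q.eval z))).re| ≤ ε / 4 := by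
    rw [abs_le]
    simp only [Complex.sub_re, Complex.add_re, Complex.conj_re]
    constructor <;> linarith
  have j2 : |(a.eval z * f z - (P.eval z + conj (Q.eval z))).im| ≤ ε / 4 := by
    rw [abs_le]
    simp only [Complex.sub_im, Complex.add_im, Complex.conj_im]
    constructor <;> linarith
  have := Complex.norm_le_abs_re_add_abs_im (a.eval z * f z - (P.eval z + conj (Q.eval z)))
  linarith

theorem hmax_mean {a : Polynomial ℂ} (ha : ∀ z ∈ closedBall a₀ r, a.eval z ≠ 0) :
    Real.circleAverage (fun z => a.eval z * f z) a₀ r = a.eval a₀ * f a₀ := by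
  rw [← sub_eq_zero, ← norm_le_zero_iff]
  refine le_of_forall_pos_le_add fun ε hε => ?_
  obtain ⟨P, Q, hPQ⟩ := hmax_approx hH hf hr hB ha (half_pos hε)
  have hac : ContinuousOn (fun z => a.eval z * f z) (sphere a₀ |r|) := by
    rw [abs_of_pos hr]
    exact a.continuous.continuousOn.mul (hf.mono (sphere_subset_closedBall.trans hB))
  have hPc : Continuous (fun z => P.eval z + conj (Q.eval z)) := by
    have := P.continuous
    have := Q.continuous
    fun_prop
  have h1 : ‖Real.circleAverage (fun z => a.eval z * f z - (P.eval z + conj (Q.eval z))) a₀ r‖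
      ≤ ε / 2 := norm_circleAverage_le hr.le fun z hz => (hPQ z (sphere_subset_closedBall hz)).le
  rw [Real.circleAverage_fun_sub hac.circleIntegrable' hPc.continuousOn.circleIntegrable',
    circleAverage_pq] at h1
  have h2 := (hPQ a₀ (mem_closedBall_self hr.le)).le
  have := norm_sub_le (Real.circleAverage (fun z => a.eval z * f z) a₀ r -
    (P.eval a₀ + conj (Q.eval a₀))) (a.eval a₀ * f a₀ - (P.eval a₀ + conj (Q.eval a₀)))
  rw [sub_sub_sub_cancel_right] at this
  linarith

theorem hmax_diff_ball : DifferentiableOn ℂ f (ball a₀ (r / 2)) := by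
  have hρ : 0 < r / 2 := half_pos hr
  have key : ∀ n : ℕ, ∃ P : Polynomial ℂ, ∀ z ∈ ball a₀ (r / 2),
      ‖f z - P.eval z‖ < 2 * (1 / ((n : ℝ) + 1)) := by
    intro n
    set ε := 1 / ((n : ℝ) + 1) with hεd
    have hε : 0 < ε := by positivity
    obtain ⟨P, Q, hPQ⟩ := hmax_approx hH hf hr hB (a := 1) (by simp) hε
    simp only [eval_one, one_mul] at hPQ
    have hQ' : ∀ c ∈ ball a₀ (r / 2), ‖deriv (fun z => Q.eval z) c‖ ≤ ε / (r / 2) := by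
      intro c hc
      rw [mem_ball] at hc
      have hsub : closedBall c (r / 2) ⊆ closedBall a₀ r :=
        closedBall_subset_closedBall' (by linarith)
      have m1 := hmax_mean hH hf hρ (hsub.trans hB) (a := 1) (by simp)
      set b := a₀ + 2 * r with hb
      have m2 := hmax_mean hH hf hρ (hsub.trans hB) (a := X - C b) (by
        intro z hz h0
        have h1 := hsub hz
        simp only [eval_sub, eval_X, eval_C, sub_eq_zero] at h0
        rw [h0, hb, mem_closedBall, dist_eq_norm, add_sub_cancel_left, norm_mul, Complex.norm_real,
          Real.norm_of_nonneg hr.le] at h1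
        norm_num at h1
        linarith)
      simp only [eval_one, one_mul, eval_sub, eval_X, eval_C] at m1 m2
      have hfc : ContinuousOn f (sphere c |r / 2|) := by
        rw [abs_of_pos hρ]
        exact hf.mono (sphere_subset_closedBall.trans (hsub.trans hB))
      have hpc : Continuous (fun z => P.eval z + conj (Q.eval z)) := by
        have := P.continuous
        have := Q.continuous
        fun_prop
      have m3 : Real.circleAverage (fun z => (z - c) * f z) c (r / 2) = 0 := by
        have : (fun z => (z - c) * f z) = fun z => (z - b) * f z - (c - b) • f z := by
          funext z; simp only [smul_eq_mul]; ring
        rw [this, Real.circleAverage_fun_sub, Real.circleAverage_fun_smul, m1, m2, smul_eq_mul,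
          sub_self]
        · exact ((by fun_prop : Continuous fun z : ℂ => z - b).continuousOn.mul hfc).circleIntegrable'
        · exact (hfc.const_smul (c - b)).circleIntegrable'
      have m4 : ‖Real.circleAverage
          (fun z => (z - c) * f z - (z - c) * (P.eval z + conj (Q.eval z))) c (r / 2)‖
          ≤ r / 2 * ε := by
        refine norm_circleAverage_le hρ.le fun z hz => ?_
        rw [← mul_sub, norm_mul]
        have h1 := (hPQ z (hsub (sphere_subset_closedBall hz))).le
        rw [mem_sphere, dist_eq_norm] at hz
        rw [hz]
        gcongr
      rw [Real.circleAverage_fun_sub, m3, circleAverage_pq1 P Q c hρ, zero_sub, norm_neg, norm_mul,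
        norm_pow, RCLike.norm_conj, Complex.norm_real, Real.norm_of_nonneg hρ.le] at m4
      · rw [le_div_iff₀ hρ]
        have : r / 2 * (‖deriv (fun z => Q.eval z) c‖ * (r / 2)) ≤ r / 2 * ε := by
          calc _ = (r / 2) ^ 2 * ‖deriv (fun z => Q.eval z) c‖ := by ring
            _ ≤ _ := m4
        exact le_of_mul_le_mul_left this hρ
      · exact ((by fun_prop : Continuous fun z : ℂ => z - c).continuousOn.mul hfc).circleIntegrable'
      · exact ((by fun_prop : Continuous fun z : ℂ => z - c).continuousOn.mul
          hpc.continuousOn).circleIntegrable'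
    refine ⟨P + C (conj (Q.eval a₀)), fun z hz => ?_⟩
    have hQd : ∀ x ∈ ball a₀ (r / 2), DifferentiableAt ℂ (fun z => Q.eval z) x :=
      fun x _ => Q.differentiable x
    have h1 := (convex_ball a₀ (r / 2)).norm_image_sub_le_of_norm_deriv_le hQd hQ'
      (mem_ball_self hρ) hz
    have h2 : ‖Q.eval z - Q.eval a₀‖ ≤ ε := by
      refine h1.trans ?_
      rw [mem_ball, dist_eq_norm] at hz
      rw [div_mul_eq_mul_div, div_le_iff₀ hρ]
      gcongr
    have h3 := hPQ z ((ball_subset_closedBall.trans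
      (closedBall_subset_closedBall (by linarith))) hz)
    simp only [eval_add, eval_C]
    calc ‖f z - (P.eval z + conj (Q.eval a₀))‖
        = ‖(f z - (P.eval z + conj (Q.eval z))) + conj (Q.eval z - Q.eval a₀)‖ := by
          rw [map_sub]; congr 1; ring
      _ ≤ _ := norm_add_le _ _
      _ < 2 * ε := by
        rw [RCLike.norm_conj]
        linarith
  choose P hP using key
  refine TendstoLocallyUniformlyOn.differentiableOn (φ := atTop) (F := fun n z => (P n).eval z) ?_
    (Eventually.of_forall fun n => (P n).differentiable.differentiableOn) isOpen_ball
  refine TendstoUniformlyOn.tendstoLocallyUniformlyOn ?_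
  rw [Metric.tendstoUniformlyOn_iff]
  intro ε hε
  have ht : Tendsto (fun n : ℕ => 2 * (1 / ((n : ℝ) + 1))) atTop (𝓝 (2 * 0)) :=
    tendsto_one_div_add_atTop_nhds_zero_nat.const_mul 2
  rw [mul_zero] at ht
  filter_upwards [ht.eventually_lt_const hε] with n hn z hz
  rw [dist_eq_norm]
  exact (hP n z hz).trans hn

end

theorem hmax_diff {f : ℂ → ℂ} {Ω : Set ℂ} (hH : HMax f Ω) (hf : ContinuousOn f Ω)
    (hΩ : IsOpen Ω) : DifferentiableOn ℂ f Ω := by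
  intro z hz
  obtain ⟨r, hr, hB⟩ := nhds_basis_closedBall.mem_iff.1 (hΩ.mem_nhds hz)
  have := hmax_diff_ball hH hf hr hB
  exact (this.differentiableAt (isOpen_ball.mem_nhds (mem_ball_self (half_pos hr)))).differentiableWithinAt

end PartCrit

section PartFin1

open Filter Topology ComplexConjugate MeasureTheory
set_option linter.unusedSectionVars false

theorem PSH2.sh_snd {U : ℂ × ℂ → EReal} (hU : PSH2 U) (z : ℂ) : SH (fun w => U (z, w)) := by
  refine ⟨hU.1.comp (by fun_prop : Continuous fun w : ℂ => (z, w)), fun x => hU.2.1 _, ?_⟩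
  intro x h
  have := hU.2.2 (z, x) (0, h)
  simpa using this

theorem PSH2.sh_fst {U : ℂ × ℂ → EReal} (hU : PSH2 U) (w : ℂ) : SH (fun z => U (z, w)) := by
  refine ⟨hU.1.comp (by fun_prop : Continuous fun z : ℂ => (z, w)), fun x => hU.2.1 _, ?_⟩
  intro x h
  have := hU.2.2 (x, w) (h, 0)
  simpa using this

theorem one_dim {U : ℂ × ℂ → EReal} (hU : PSH2 U) (hne : ∃ x, U x ≠ ⊥) {Ω : Set ℂ}
    (hΩ : IsOpen Ω) {f : ℂ → ℂ} (hf : ContinuousOn f Ω) (hbot : ∀ z ∈ Ω, U (z, f z) = ⊥) :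
    DifferentiableOn ℂ f Ω := by
  refine hmax_diff ?_ hf hΩ
  intro a₀ r hr hB a p ha hbd z₁ hz₁
  by_contra hcon
  push Not at hcon
  obtain ⟨x, hx⟩ := hne
  refine hx ?_
  set g : ℂ → ℝ := fun z => (a.eval z * f z - p.eval z).re with hg
  set t := g z₁ / 2 with ht
  have ht0 : 0 < t := half_pos hcon
  have hfB := hf.mono hB
  have hz₁b : z₁ ∈ ball a₀ r := by
    rw [mem_ball]
    refine lt_of_le_of_ne hz₁ fun h => ?_
    exact absurd (hbd z₁ h) (not_le.2 hcon)
  have hgc : ContinuousAt g z₁ := by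
    have h1 : ContinuousAt f z₁ := hfB.continuousAt (closedBall_mem_nhds_of_mem hz₁b)
    have h2 := a.continuous.continuousAt (x := z₁)
    have h3 := p.continuous.continuousAt (x := z₁)
    exact Complex.continuous_re.continuousAt.comp ((h2.mul h1).sub h3)
  have hev : ∀ᶠ z in 𝓝 z₁, t < g z := hgc.eventually_const_lt (half_lt_self hcon)
  have hev2 : ∀ᶠ z in 𝓝 z₁, ∀ w, U (z, w) = ⊥ := by
    filter_upwards [hev, closedBall_mem_nhds_of_mem hz₁b] with z hz hzB w
    have ha' : 0 < ‖a.eval z‖ := norm_pos_iff.2 (ha z hzB)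
    refine polar_circles (hU.sh_snd z) (r₀ := (g z - t) / ‖a.eval z‖) (w₀ := f z)
      (div_pos (by linarith) ha') (fun s hs1 hs2 => ?_) w
    refine hull_bot hU hfB (fun z hz => hbot z (hB hz)) ha hbd ht0 hzB hs1 ?_
    exact (lt_div_iff₀ ha').1 hs2
  have := polar_open (hU.sh_fst x.2) (w₀ := z₁) (hev2.mono fun z hz => hz x.2) x.1
  exact this

section multi
variable {n : ℕ}

theorem psh_line {u : (Fin n → ℂ) → EReal} (hu : Plurisubharmonic u) (p b : Fin n → ℂ) :
    SH (fun t => u (p + t • b)) := by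
  refine ⟨hu.1.comp (by fun_prop : Continuous fun t : ℂ => p + t • b), fun x => hu.2.1 _, ?_⟩
  intro x h
  have := hu.2.2 (p + x • b) (h • b)
  simpa only [add_smul, smul_smul, add_assoc, smul_eq_mul] using this

theorem psh_open {u : (Fin n → ℂ) → EReal} (hu : Plurisubharmonic u) {p : Fin n → ℂ}
    (h : ∀ᶠ q in 𝓝 p, u q = ⊥) (q : Fin n → ℂ) : u q = ⊥ := by
  have hc : Tendsto (fun t : ℂ => p + t • (q - p)) (𝓝 0) (𝓝 p) := by
    have : Continuous (fun t : ℂ => p + t • (q - p)) := by fun_prop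
    simpa using this.tendsto 0
  have := polar_open (psh_line hu p (q - p)) (hc.eventually h) 1
  simpa using this

theorem snoc_line (z b : Fin n → ℂ) (x h : ℂ × ℂ) (t : ℂ) :
    (Fin.snoc (z + (x + t • h).1 • b) (x + t • h).2 : Fin (n + 1) → ℂ) =
      (Fin.snoc (z + x.1 • b) x.2 : Fin (n + 1) → ℂ) + t • (Fin.snoc (h.1 • b) h.2 : Fin (n + 1) → ℂ) := by
  ext i
  refine Fin.lastCases ?_ (fun i => ?_) i
  · simp
  · simp
    ring

theorem snoc_cont {X : Type*} [TopologicalSpace X] {g : X → Fin n → ℂ} {w : X → ℂ}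
    (hg : Continuous g) (hw : Continuous w) :
    Continuous (fun x => (Fin.snoc (g x) (w x) : Fin (n + 1) → ℂ)) := by
  refine continuous_pi fun i => ?_
  refine Fin.lastCases ?_ (fun i => ?_) i
  · simpa using hw
  · simp only [Fin.snoc_castSucc]
    fun_prop

theorem psh_slice {u : (Fin (n + 1) → ℂ) → EReal} (hu : Plurisubharmonic u) (z b : Fin n → ℂ) :
    PSH2 (fun x => u (Fin.snoc (z + x.1 • b) x.2)) := by
  refine ⟨hu.1.comp (snoc_cont (by fun_prop) (by fun_prop)), fun x => hu.2.1 _, ?_⟩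
  intro x h
  have := hu.2.2 (Fin.snoc (z + x.1 • b) x.2) (Fin.snoc (h.1 • b) h.2)
  simp only [snoc_line]
  exact this

theorem slice_diff {D : Set (Fin n → ℂ)} (hD : IsOpen D) {f : (Fin n → ℂ) → ℂ}
    (hf : ContinuousOn f D) {u : (Fin (n + 1) → ℂ) → EReal} (hu : Plurisubharmonic u)
    (hne : ¬ ∀ z, u z = ⊥) (hbot : ∀ z ∈ D, u (Fin.snoc z (f z)) = ⊥) {z : Fin n → ℂ} (hz : z ∈ D)
    (b : Fin n → ℂ) : DifferentiableAt ℂ (fun t : ℂ => f (z + t • b)) 0 := by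
  have hlc : ∀ z', Continuous (fun t : ℂ => z' + t • b) := fun z' => by fun_prop
  -- generic slices
  have hgood : ∀ z', (∃ x : ℂ × ℂ, u (Fin.snoc (z' + x.1 • b) x.2) ≠ ⊥) →
      DifferentiableOn ℂ (fun t : ℂ => f (z' + t • b)) ((fun t : ℂ => z' + t • b) ⁻¹' D) := by
    intro z' hz'
    refine one_dim (psh_slice hu z' b) hz' (hD.preimage (hlc z'))
      (hf.comp (hlc z').continuousOn (mapsTo_preimage _ _)) fun t ht => hbot _ ht
  -- density of good slices
  have hdense : ∃ᶠ z' in 𝓝 z, ∃ x : ℂ × ℂ, u (Fin.snoc (z' + x.1 • b) x.2) ≠ ⊥ := by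
    intro hcon
    refine hne (psh_open hu (p := Fin.snoc z 0) ?_)
    have hFirst : Tendsto (fun q : Fin (n + 1) → ℂ => (Fin.init q : Fin n → ℂ))
        (𝓝 (Fin.snoc z 0)) (𝓝 z) := by
      have : Continuous (fun q : Fin (n + 1) → ℂ => (Fin.init q : Fin n → ℂ)) :=
        continuous_pi fun i => continuous_apply _
      have h2 := this.tendsto (Fin.snoc z 0)
      simp only [Fin.init_snoc] at h2
      exact h2
    filter_upwards [hFirst.eventually hcon] with q hq
    push Not at hq
    have := hq (0, q (Fin.last n))
    simp only [zero_smul, add_zero, Fin.snoc_init_self] at this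
    exact this
  -- a compact neighbourhood
  obtain ⟨ρ, hρ, hB⟩ := nhds_basis_closedBall.mem_iff.1 (hD.mem_nhds hz)
  set ρ' := ρ / 2 / (‖b‖ + 1) with hρ'
  have hb0 := norm_nonneg b
  have hρ'0 : 0 < ρ' := by positivity
  have hmem : ∀ z' ∈ ball z (ρ / 2), ∀ t ∈ ball (0 : ℂ) ρ', z' + t • b ∈ closedBall z ρ := by
    intro z' hz' t ht
    rw [mem_ball_zero_iff] at ht
    rw [mem_ball, dist_eq_norm] at hz'
    rw [mem_closedBall, dist_eq_norm]
    have h1 : ‖t • b‖ ≤ ρ / 2 := by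
      rw [norm_smul]
      calc ‖t‖ * ‖b‖ ≤ ρ' * (‖b‖ + 1) := by gcongr; linarith
        _ = ρ / 2 := by rw [hρ']; field_simp
    calc ‖z' + t • b - z‖ = ‖(z' - z) + t • b‖ := by congr 1; abel
      _ ≤ _ := norm_add_le _ _
      _ ≤ ρ := by linarith
  have huc : UniformContinuousOn f (closedBall z ρ) :=
    (isCompact_closedBall z ρ).uniformContinuousOn_of_continuous (hf.mono hB)
  have key : ∀ k : ℕ, ∃ g : ℂ → ℂ, DifferentiableOn ℂ g (ball 0 ρ') ∧
      ∀ t ∈ ball (0 : ℂ) ρ', dist (f (z + t • b)) (g t) < 1 / ((k : ℝ) + 1) := by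
    intro k
    obtain ⟨δ, hδ, hd⟩ := Metric.uniformContinuousOn_iff.1 huc (1 / ((k : ℝ) + 1)) (by positivity)
    obtain ⟨z', hx, hz'⟩ := (hdense.and_eventually
      (inter_mem (ball_mem_nhds z (half_pos hρ)) (ball_mem_nhds z hδ))).exists
    refine ⟨fun t => f (z' + t • b), (hgood z' hx).mono fun t ht => hB (hmem z' hz'.1 t ht), ?_⟩
    intro t ht
    refine hd _ (hmem z (mem_ball_self (half_pos hρ)) t ht) _ (hmem z' hz'.1 t ht) ?_
    rw [dist_add_right, dist_comm]
    exact hz'.2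
  choose g hgd hg using key
  have hfin : DifferentiableOn ℂ (fun t : ℂ => f (z + t • b)) (ball 0 ρ') := by
    refine TendstoLocallyUniformlyOn.differentiableOn (φ := atTop) (F := g) ?_
      (Eventually.of_forall hgd) isOpen_ball
    refine TendstoUniformlyOn.tendstoLocallyUniformlyOn ?_
    rw [Metric.tendstoUniformlyOn_iff]
    intro ε hε
    filter_upwards [(tendsto_one_div_add_atTop_nhds_zero_nat (𝕜 := ℝ)).eventually_lt_const hε] with k hk t ht
    exact (hg k t ht).trans hk
  exact hfin.differentiableAt (ball_mem_nhds 0 hρ'0)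

end multi

end PartFin1

section PartFin2

open Filter Topology ComplexConjugate MeasureTheory
set_option linter.unusedSectionVars false

theorem taylor_two_hol {φ : ℂ → ℂ} {ρ M : ℝ} (hρ : 0 < ρ)
    (hd : DifferentiableOn ℂ φ (ball 0 ρ)) (hM : ∀ t ∈ ball (0 : ℂ) ρ, ‖φ t‖ ≤ M) {t : ℂ}
    (ht : t ∈ ball (0 : ℂ) ρ) :
    ‖φ t - φ 0 - t * deriv φ 0‖ ≤ 4 * M / ρ ^ 2 * ‖t‖ ^ 2 := by
  have h0 : (0 : ℂ) ∈ ball (0 : ℂ) ρ := mem_ball_self hρ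
  set g := dslope φ 0 with hg
  have hg0 : g 0 = deriv φ 0 := dslope_same _ _
  have h1 : ∀ t ∈ ball (0 : ℂ) ρ, ‖g t‖ ≤ 2 * M / ρ := fun t ht =>
    Complex.norm_dslope_le_div_of_mapsTo_ball hd (fun x hx => by
      rw [mem_closedBall, dist_eq_norm]
      have := norm_sub_le (φ x) (φ 0)
      have := hM x hx
      have := hM 0 h0
      linarith) ht
  have hgd : DifferentiableOn ℂ g (ball 0 ρ) :=
    (Complex.differentiableOn_dslope (isOpen_ball.mem_nhds h0)).2 hd
  have h2 : ‖dslope g 0 t‖ ≤ (4 * M / ρ) / ρ :=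
    Complex.norm_dslope_le_div_of_mapsTo_ball hgd (fun x hx => by
      rw [mem_closedBall, dist_eq_norm]
      have := norm_sub_le (g x) (g 0)
      have := h1 x hx
      have := h1 0 h0
      have : 4 * M / ρ = 2 * M / ρ + 2 * M / ρ := by ring
      linarith) ht
  have e1 : t * g t = φ t - φ 0 := by
    have := sub_smul_dslope φ 0 t
    simpa using this
  have e2 : t * dslope g 0 t = g t - g 0 := by
    have := sub_smul_dslope g 0 t
    simpa using this
  have e3 : φ t - φ 0 - t * deriv φ 0 = t ^ 2 * dslope g 0 t := by
    rw [← e1, ← hg0]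
    linear_combination -t * e2
  rw [e3, norm_mul, norm_pow]
  calc ‖t‖ ^ 2 * ‖dslope g 0 t‖ ≤ ‖t‖ ^ 2 * ((4 * M / ρ) / ρ) := by gcongr
    _ = _ := by field_simp

section osgood
variable {n : ℕ} {D : Set (Fin n → ℂ)} (hD : IsOpen D) {f : (Fin n → ℂ) → ℂ}
  (hf : ContinuousOn f D)
  (hG : ∀ z ∈ D, ∀ b : Fin n → ℂ, DifferentiableAt ℂ (fun t : ℂ => f (z + t • b)) 0)

/-- directional derivative -/
def dd (f : (Fin n → ℂ) → ℂ) (z b : Fin n → ℂ) : ℂ := deriv (fun t : ℂ => f (z + t • b)) 0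

theorem dd_smul (f : (Fin n → ℂ) → ℂ) (z b : Fin n → ℂ) (c : ℂ) :
    dd f z (c • b) = c * dd f z b := by
  unfold dd
  have := deriv_comp_mul_left c (fun t : ℂ => f (z + t • b)) 0
  simp only [mul_zero, smul_eq_mul] at this
  rw [← this]
  congr 1
  funext t
  rw [smul_smul, mul_comm]

include hD hf hG

theorem dd_bound {z : Fin n → ℂ} (hz : z ∈ D) (K : ℝ) (hK : 0 ≤ K) :
    ∃ ρ > 0, ∃ A, ∀ z' ∈ ball z ρ, ∀ h : Fin n → ℂ, ‖h‖ ≤ K → ∀ t : ℂ, ‖t‖ < ρ →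
      ‖f (z' + t • h) - f z' - t * dd f z' h‖ ≤ A * ‖t‖ ^ 2 := by
  obtain ⟨R, hR, hB⟩ := nhds_basis_closedBall.mem_iff.1 (hD.mem_nhds hz)
  obtain ⟨M, hM⟩ := (isCompact_closedBall z R).exists_bound_of_continuousOn (hf.mono hB)
  set ρ := R / (K + 1) with hρ
  have hρ0 : 0 < ρ := by positivity
  have hρR : ρ + ρ * K = R := by rw [hρ]; field_simp; ring
  refine ⟨ρ, hρ0, 4 * M / ρ ^ 2, fun z' hz' h hh t ht => ?_⟩
  have hmem : ∀ t ∈ ball (0 : ℂ) ρ, z' + t • h ∈ closedBall z R := by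
    intro t ht
    rw [mem_ball_zero_iff] at ht
    rw [mem_ball, dist_eq_norm] at hz'
    rw [mem_closedBall, dist_eq_norm]
    have h1 : ‖t • h‖ ≤ ρ * K := by
      rw [norm_smul]; gcongr
    calc ‖z' + t • h - z‖ = ‖(z' - z) + t • h‖ := by congr 1; abel
      _ ≤ _ := norm_add_le _ _
      _ ≤ R := by linarith
  have := taylor_two_hol (φ := fun t : ℂ => f (z' + t • h)) hρ0 (M := M) ?_ (fun t ht => hM _ (hmem t ht))
    (mem_ball_zero_iff.2 ht)
  · simp only [zero_smul, add_zero] at this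
    exact this
  · intro t₀ ht₀
    have h1 := hG _ (hB (hmem t₀ ht₀)) h
    have h2 : DifferentiableAt ℂ (fun t : ℂ => f ((z' + t₀ • h) + (t - t₀) • h)) t₀ := by
      have h3 : DifferentiableAt ℂ (fun t : ℂ => f ((z' + t₀ • h) + t • h)) (t₀ - t₀) := by
        rw [sub_self]; exact h1
      have h4 : DifferentiableAt ℂ (fun t : ℂ => t - t₀) t₀ := by fun_prop
      exact DifferentiableAt.comp (g := fun t : ℂ => f ((z' + t₀ • h) + t • h)) t₀ h3 h4
    refine DifferentiableAt.differentiableWithinAt ?_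
    convert h2 using 2 with t
    rw [sub_smul]
    congr 1
    abel

theorem dd_cont {z : Fin n → ℂ} (hz : z ∈ D) (b : Fin n → ℂ) :
    ContinuousAt (fun z' => dd f z' b) z := by
  obtain ⟨ρ, hρ, A, hA⟩ := dd_bound hD hf hG hz ‖b‖ (norm_nonneg b)
  rw [Metric.continuousAt_iff']
  intro ε hε
  -- choose a step
  have hdo : ∀ᶠ s : ℂ in 𝓝[≠] 0, s ≠ 0 ∧ ‖s‖ < ρ ∧ |A| * ‖s‖ < ε / 3 ∧ z + s • b ∈ D := by
    have h1 : ∀ᶠ s : ℂ in 𝓝 0, ‖s‖ < ρ := by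
      have : Tendsto (fun s : ℂ => ‖s‖) (𝓝 0) (𝓝 0) := tendsto_norm_zero
      exact this.eventually_lt_const hρ
    have h2 : ∀ᶠ s : ℂ in 𝓝 0, |A| * ‖s‖ < ε / 3 := by
      have : Tendsto (fun s : ℂ => |A| * ‖s‖) (𝓝 0) (𝓝 (|A| * 0)) := tendsto_norm_zero.const_mul _
      rw [mul_zero] at this
      exact this.eventually_lt_const (by positivity)
    have h3 : ∀ᶠ s : ℂ in 𝓝 0, z + s • b ∈ D := by
      have : Continuous (fun s : ℂ => z + s • b) := by fun_prop
      exact this.continuousAt.eventually_mem (by simpa using hD.mem_nhds hz)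
    filter_upwards [self_mem_nhdsWithin, h1.filter_mono nhdsWithin_le_nhds,
      h2.filter_mono nhdsWithin_le_nhds, h3.filter_mono nhdsWithin_le_nhds] with s a1 a2 a3 a4
    exact ⟨a1, a2, a3, a4⟩
  obtain ⟨s, hs0, hsρ, hsA, hsD⟩ := hdo.exists
  have hq : ∀ z' ∈ ball z ρ, ‖(f (z' + s • b) - f z') / s - dd f z' b‖ < ε / 3 := by
    intro z' hz'
    have h1 := hA z' hz' b le_rfl s hsρ
    have h2 : (f (z' + s • b) - f z') / s - dd f z' b =
        (f (z' + s • b) - f z' - s * dd f z' b) / s := by field_simp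
    have hs' : 0 < ‖s‖ := norm_pos_iff.2 hs0
    rw [h2, norm_div, div_lt_iff₀ hs']
    calc _ ≤ A * ‖s‖ ^ 2 := h1
      _ ≤ |A| * ‖s‖ ^ 2 := by gcongr; exact le_abs_self A
      _ = |A| * ‖s‖ * ‖s‖ := by ring
      _ < _ := by gcongr
  have hqc : ContinuousAt (fun z' => (f (z' + s • b) - f z') / s) z := by
    have h1 : ContinuousAt f z := hf.continuousAt (hD.mem_nhds hz)
    have h2 : ContinuousAt f (z + s • b) := hf.continuousAt (hD.mem_nhds hsD)
    have h3 : ContinuousAt (fun z' => f (z' + s • b)) z :=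
      ContinuousAt.comp (f := fun z' : Fin n → ℂ => z' + s • b) h2 (by fun_prop)
    exact (h3.sub h1).div_const s
  filter_upwards [Metric.continuousAt_iff'.1 hqc (ε / 3) (by positivity), ball_mem_nhds z hρ]
    with z' hz'1 hz'2
  have e1 := hq z' hz'2
  have e2 := hq z (mem_ball_self hρ)
  rw [← dist_eq_norm] at e1 e2
  rw [dist_comm] at e1
  calc dist (dd f z' b) (dd f z b) ≤ _ := dist_triangle4 _ _ _ _
    _ < ε / 3 + ε / 3 + ε / 3 := by gcongr
    _ = ε := by ring

theorem dd_add {z : Fin n → ℂ} (hz : z ∈ D) (b c : Fin n → ℂ) :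
    dd f z (b + c) = dd f z b + dd f z c := by
  obtain ⟨ρ, hρ, A, hA⟩ := dd_bound hD hf hG hz (‖b‖ + ‖c‖) (by positivity)
  have hl : Tendsto (fun t : ℂ => z + t • b) (𝓝 0) (𝓝 z) := by
    have : Continuous (fun t : ℂ => z + t • b) := by fun_prop
    simpa using this.tendsto 0
  have h1 : Tendsto (fun t : ℂ => 3 * A * ‖t‖ + ‖dd f (z + t • b) c - dd f z c‖) (𝓝[≠] 0) (𝓝 0) := by
    have h2 := ((dd_cont hD hf hG hz c).tendsto.comp hl)
    have h3 : Tendsto (fun t : ℂ => ‖dd f (z + t • b) c - dd f z c‖) (𝓝 0) (𝓝 0) := by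
      have := (h2.sub_const (dd f z c)).norm
      simpa using this
    have h4 : Tendsto (fun t : ℂ => 3 * A * ‖t‖) (𝓝 0) (𝓝 (3 * A * 0)) :=
      tendsto_norm_zero.const_mul _
    have := h4.add h3
    simp only [mul_zero, add_zero] at this
    exact this.mono_left nhdsWithin_le_nhds
  have h2 : ‖dd f z (b + c) - dd f z b - dd f z c‖ ≤ 0 := by
    refine ge_of_tendsto h1 ?_
    have a1 : ∀ᶠ t : ℂ in 𝓝 0, ‖t‖ < ρ :=
      (tendsto_norm_zero (E := ℂ)).eventually_lt_const hρ
    filter_upwards [self_mem_nhdsWithin, a1.filter_mono nhdsWithin_le_nhds,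
      (hl.eventually (ball_mem_nhds z hρ)).filter_mono nhdsWithin_le_nhds] with t ht0 ht htz
    have hb := norm_nonneg b
    have hc := norm_nonneg c
    have k1 := hA z (mem_ball_self hρ) (b + c) (norm_add_le b c) t ht
    have k2 := hA z (mem_ball_self hρ) b (by linarith) t ht
    have k3 := hA (z + t • b) htz c (by linarith) t ht
    rw [add_assoc, ← smul_add] at k3
    have ht' : 0 < ‖t‖ := norm_pos_iff.2 ht0
    have k4 : ‖dd f z (b + c) - dd f z b - dd f (z + t • b) c‖ ≤ 3 * A * ‖t‖ := by
      refine le_of_mul_le_mul_left ?_ ht'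
      rw [← norm_mul]
      have e : t * (dd f z (b + c) - dd f z b - dd f (z + t • b) c) =
          -(f (z + t • (b + c)) - f z - t * dd f z (b + c)) +
          ((f (z + t • b) - f z - t * dd f z b) +
          (f (z + t • (b + c)) - f (z + t • b) - t * dd f (z + t • b) c)) := by ring
      rw [e]
      refine (norm_add_le _ _).trans ?_
      rw [norm_neg]
      refine (add_le_add_right (norm_add_le _ _) _).trans ?_
      calc _ ≤ A * ‖t‖ ^ 2 + (A * ‖t‖ ^ 2 + A * ‖t‖ ^ 2) := by gcongr
        _ = _ := by ring
    calc _ = ‖(dd f z (b + c) - dd f z b - dd f (z + t • b) c) + (dd f (z + t • b) c - dd f z c)‖ := by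
          congr 1; ring
      _ ≤ _ := norm_add_le _ _
      _ ≤ _ := by gcongr
  have := norm_le_zero_iff.1 h2
  linear_combination this

theorem osgood {z : Fin n → ℂ} (hz : z ∈ D) : DifferentiableAt ℂ f z := by
  obtain ⟨ρ, hρ, A, hA⟩ := dd_bound hD hf hG hz 1 zero_le_one
  let L : (Fin n → ℂ) →ₗ[ℂ] ℂ :=
    { toFun := dd f z
      map_add' := dd_add hD hf hG hz
      map_smul' := fun c b => dd_smul f z b c }
  refine HasFDerivAt.differentiableAt (f' := LinearMap.toContinuousLinearMap L) ?_
  rw [hasFDerivAt_iff_isLittleO_nhds_zero]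
  have hO : (fun h : Fin n → ℂ => f (z + h) - f z - L h) =O[𝓝 0] fun h => ‖h‖ ^ 2 := by
    refine Asymptotics.IsBigO.of_bound A ?_
    filter_upwards [ball_mem_nhds (0 : Fin n → ℂ) hρ] with h hh
    rw [mem_ball_zero_iff] at hh
    rw [norm_pow, norm_norm]
    rcases eq_or_ne h 0 with rfl | h0
    · simp
    · have hn : 0 < ‖h‖ := norm_pos_iff.2 h0
      have hn' : ((‖h‖ : ℝ) : ℂ) ≠ 0 := by exact_mod_cast hn.ne'
      have k := hA z (mem_ball_self hρ) (((‖h‖ : ℝ) : ℂ)⁻¹ • h) (by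
        rw [norm_smul, norm_inv, Complex.norm_real, norm_norm, inv_mul_cancel₀ hn.ne'])
        ((‖h‖ : ℝ) : ℂ) (by rw [Complex.norm_real, norm_norm]; exact hh)
      rw [← dd_smul, smul_inv_smul₀ hn', Complex.norm_real, norm_norm] at k
      exact k
  refine hO.trans_isLittleO ?_
  have := Asymptotics.isLittleO_norm_pow_id (E' := Fin n → ℂ) (n := 2) one_lt_two
  exact this

end osgood

/-- the main theorem, unpacked -/
theorem main_aux {n : ℕ} {D : Set (Fin n → ℂ)} (hD : IsOpen D) {f : (Fin n → ℂ) → ℂ}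
    (hf : ContinuousOn f D)
    (hE : Pluripolar {p : Fin (n + 1) → ℂ | ∃ z ∈ D, p = Fin.snoc z (f z)}) :
    DifferentiableOn ℂ f D := by
  obtain ⟨u, hu, hne, hbot⟩ := hE
  intro z hz
  refine (osgood hD hf (fun z hz b => ?_) hz).differentiableWithinAt
  exact slice_diff hD hf hu hne (fun z hz => hbot _ ⟨z, hz, rfl⟩) hz b

end PartFin2

/-- If the graph of a continuous function `f` on a domain `D ⊆ ℂⁿ` is pluripolar in
`ℂ^{n+1}`, then `f` is holomorphic on `D`. -/
theorem holomorphic_of_graph_pluripolar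
    {n : ℕ} (D : Set (Fin n → ℂ))
    (hDopen : IsOpen D) (hDconn : IsConnected D)
    (f : (Fin n → ℂ) → ℂ) (hf : ContinuousOn f D)
    (hE : Pluripolar {p : Fin (n + 1) → ℂ | ∃ z ∈ D, p = Fin.snoc z (f z)}) :
    DifferentiableOn ℂ f D := by
  exact main_aux hDopen hf hE
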